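/- arXiv:1610.09268 — 2 statements merged into one kernel-verified Lean document; each statement's English description precedes it below -/
import Mathlib

section
/- There exists a function L(n,d), independent of N and of K, such that for every algebraically closed field K, every N, and every ideal I of R = K[x_1,…,x_N] generated by n polynomials f_1,…,f_n of degree at most d, the ideal of R generated by the leading forms of all nonzero elements of I can be generated by at most L(n,d) elements. -/
open MvPolynomial

universe u

section DivExponents

variable {σ K : Type*} [Field K]

theorem mem_range_expand_iff (p : ℕ) (a : MvPolynomial σ K) :
    a ∈ (expand p : MvPolynomial σ K →ₐ[K] _).range ↔ ∀ α ∈ a.support, ∀ i, p ∣ α i := by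
  constructor
  · rintro ⟨g, rfl⟩ α hα i
    by_contra h
    exact (mem_support_iff.mp hα) (coeff_expand_of_not_dvd g h)
  · intro h
    rw [a.as_sum]
    refine Subalgebra.sum_mem _ fun α hα => ⟨monomial (α.mapRange (· / p) (by simp)) (coeff α a), ?_⟩
    change expand p _ = _
    rw [expand_monomial]
    have : p • α.mapRange (· / p) (by simp) = α := by
      ext i
      simpa using Nat.mul_div_cancel' (h α hα i)
    rw [this]

theorem pow_mem_range_expand (p : ℕ) [CharP K p] (a : MvPolynomial σ K) :
    a ^ p ∈ (expand p : MvPolynomial σ K →ₐ[K] _).range := by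
  rcases CharP.char_is_prime_or_zero K p with hp | rfl
  · have := Fact.mk hp
    rw [mem_range_expand_iff]
    intro α hα
    rw [← map_frobenius_expand] at hα
    exact (mem_range_expand_iff p _).mp ⟨a, rfl⟩ α (support_map_subset _ _ hα)
  · simp

theorem AlgHom.mem_range_expand {τ : Type*} (p : ℕ) [CharP K p]
    (Φ : MvPolynomial σ K →ₐ[K] MvPolynomial τ K)
    {a : MvPolynomial σ K} (ha : a ∈ (expand p : MvPolynomial σ K →ₐ[K] _).range) :
    Φ a ∈ (expand p : MvPolynomial τ K →ₐ[K] _).range := by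
  obtain ⟨g, rfl⟩ := ha
  change Φ (expand p g) ∈ _
  induction g using MvPolynomial.induction_on with
  | C c =>
    rw [← algebraMap_eq, AlgHom.commutes, AlgHom.commutes]
    exact Subalgebra.algebraMap_mem _ c
  | add g h hg hh => simpa using Subalgebra.add_mem _ hg hh
  | mul_X g i hg =>
    simpa using Subalgebra.mul_mem _ hg (pow_mem_range_expand p (Φ (X i)))

theorem Derivation.eq_zero_of_mem_range_expand (p : ℕ) [CharP K p]
    (δ : Derivation K (MvPolynomial σ K) (MvPolynomial σ K))
    {a : MvPolynomial σ K} (ha : a ∈ (expand p : MvPolynomial σ K →ₐ[K] _).range) : δ a = 0 := by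
  obtain ⟨g, rfl⟩ := ha
  change δ (expand p g) = _
  induction g using MvPolynomial.induction_on with
  | C c => simp
  | add g h hg hh => simp [hg, hh]
  | mul_X g i hg => simp [hg, Derivation.leibniz_pow]

theorem exists_split_range_expand (p : ℕ) (a : MvPolynomial σ K) :
    ∃ a₀ a₁, a = a₀ + a₁ ∧ a₀ ∈ (expand p : MvPolynomial σ K →ₐ[K] _).range ∧
      a₁.support ⊆ a.support ∧ ∀ α ∈ a₁.support, ¬ ∀ i, p ∣ α i := by
  classical
  set f : ((σ →₀ ℕ) → Prop) → MvPolynomial σ K :=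
    fun q => ∑ α ∈ a.support with q α, monomial α (coeff α a) with hf
  have hco : ∀ q α, coeff α (f q) = if q α then coeff α a else 0 := by
    intro q α
    simp only [hf, coeff_sum, coeff_monomial, Finset.sum_ite_eq', Finset.mem_filter, mem_support_iff]
    by_cases h : coeff α a = 0 <;> simp [h]
  refine ⟨f fun α => ∀ i, p ∣ α i, f fun α => ¬ ∀ i, p ∣ α i, ?_, ?_, ?_, ?_⟩
  · ext α
    rw [coeff_add, hco, hco]
    by_cases h : ∀ i, p ∣ α i <;> simp only [h, not_true, not_false_iff, if_true, if_false,
      implies_true, add_zero, zero_add]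
  · rw [mem_range_expand_iff]
    intro α hα
    rw [mem_support_iff, hco] at hα
    by_contra h
    exact hα (if_neg h)
  · intro α hα
    rw [mem_support_iff, hco] at hα
    rw [mem_support_iff]
    intro h
    exact hα (by simp [h])
  · intro α hα h
    rw [mem_support_iff, hco] at hα
    exact hα (if_neg (not_not.mpr h))

end DivExponents

section SplitVariable

variable {σ K : Type*} [Field K]

open Classical in
/-- View a polynomial as a univariate polynomial in the variable `x`, with coefficients in the
other variables. -/
noncomputable def splitVar (x : σ) :
    MvPolynomial σ K →ₐ[K] Polynomial (MvPolynomial σ K) :=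
  aeval fun e => if e = x then Polynomial.X else Polynomial.C (X e)

theorem splitVar_X_self (x : σ) :
    splitVar x (X x : MvPolynomial σ K) = Polynomial.X := by
  simp [splitVar]

theorem splitVar_X_of_ne {x e : σ} (h : e ≠ x) :
    splitVar x (X e : MvPolynomial σ K) = Polynomial.C (X e) := by
  simp [splitVar, h]

theorem splitVar_monomial (x : σ) (α : σ →₀ ℕ) (c : K) :
    splitVar x (monomial α c) =
      Polynomial.C (monomial (α.erase x) c) * Polynomial.X ^ α x := by
  classical
  rw [← Finsupp.erase_add_single x α]
  have h1 : ∀ β : σ →₀ ℕ, β x = 0 → splitVar x (monomial β c) = Polynomial.C (monomial β c) := by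
    intro β hβ
    rw [splitVar, aeval_monomial, monomial_eq, Finsupp.prod, Finsupp.prod, map_mul, map_prod]
    congr 1
    refine Finset.prod_congr rfl fun e he => ?_
    have : e ≠ x := by
      rintro rfl
      exact (Finsupp.mem_support_iff.mp he) hβ
    simp [this]
  have h2 : monomial (α.erase x + Finsupp.single x (α x)) c =
      monomial (α.erase x) c * X x ^ α x := by
    rw [X_pow_eq_monomial, monomial_mul, mul_one]
  rw [h2, map_mul, map_pow, splitVar_X_self, h1 _ (by simp)]
  simp

open Classical in
theorem coeff_coeff_splitVar (x : σ) (a : MvPolynomial σ K) (k : ℕ) (β : σ →₀ ℕ) :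
    coeff β ((splitVar x a).coeff k) =
      if β x = 0 then coeff (β + Finsupp.single x k) a else 0 := by
  induction a using MvPolynomial.induction_on' with
  | add a b ha hb =>
    rw [map_add, Polynomial.coeff_add, coeff_add, ha, hb, coeff_add]
    split_ifs <;> simp
  | monomial α c =>
    rw [splitVar_monomial, Polynomial.coeff_C_mul_X_pow, coeff_monomial]
    by_cases hk : k = α x
    · subst hk
      rw [if_pos rfl, coeff_monomial]
      by_cases h : α.erase x = β
      · subst h
        simp [Finsupp.erase_add_single]
      · rw [if_neg h]
        split_ifs with h1 h2
        · exfalso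
          apply h
          rw [h2]
          ext i
          by_cases hi : i = x
          · subst hi; simp [h1]
          · simp [Finsupp.erase_ne hi]
        · rfl
        · rfl
    · rw [if_neg hk, coeff_zero]
      split_ifs with h1 h2
      · exfalso; apply hk; rw [h2]; simp [h1]
      · rfl
      · rfl

theorem splitVar_of_mem_supported {x : σ} {s : Set σ} (hx : x ∉ s) {a : MvPolynomial σ K}
    (ha : a ∈ supported K s) : splitVar x a = Polynomial.C a := by
  rw [supported_eq_adjoin_X] at ha
  induction ha using Algebra.adjoin_induction with
  | mem y hy =>
    obtain ⟨e, he, rfl⟩ := hy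
    exact splitVar_X_of_ne (by rintro rfl; exact hx he)
  | algebraMap r => simp
  | add y z _ _ hy hz => simp [hy, hz]
  | mul y z _ _ hy hz => simp [hy, hz]

theorem splitVar_algHom {x : σ} {s : Set σ} (hx : x ∉ s)
    (Φ : MvPolynomial σ K →ₐ[K] MvPolynomial σ K)
    (hs : ∀ e ∈ s, Φ (X e) ∈ supported K s) (hΦx : Φ (X x) - X x ∈ supported K s)
    {a : MvPolynomial σ K} (ha : a ∈ supported K (insert x s)) :
    splitVar x (Φ a) =
      Polynomial.taylor (Φ (X x) - X x) ((splitVar x a).map (Φ : _ →+* MvPolynomial σ K)) := by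
  rw [supported_eq_adjoin_X] at ha
  induction ha using Algebra.adjoin_induction with
  | mem y hy =>
    obtain ⟨e, rfl | he, rfl⟩ := hy
    · rw [splitVar_X_self, Polynomial.map_X, Polynomial.taylor_X,
        ← splitVar_of_mem_supported hx hΦx, map_sub, splitVar_X_self]
      ring
    · rw [splitVar_of_mem_supported hx (hs e he), splitVar_X_of_ne (by rintro rfl; exact hx he)]
      simp
  | algebraMap r => simp [algHom_C]
  | add y z _ _ hy hz => simp only [map_add, hy, hz, Polynomial.map_add]
  | mul y z _ _ hy hz => simp only [map_mul, hy, hz, Polynomial.map_mul, Polynomial.taylor_mul]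

/-- The coefficientwise extension of a derivation to univariate polynomials. -/
noncomputable def coeffDerivation (δ : Derivation K (MvPolynomial σ K) (MvPolynomial σ K)) :
    Derivation K (Polynomial (MvPolynomial σ K)) (Polynomial (MvPolynomial σ K)) :=
  PolynomialModule.equivPolynomialSelf.compDer δ.mapCoeffs

theorem coeff_coeffDerivation (δ : Derivation K (MvPolynomial σ K) (MvPolynomial σ K))
    (q : Polynomial (MvPolynomial σ K)) (i : ℕ) :
    (coeffDerivation δ q).coeff i = δ (q.coeff i) := rfl

theorem coeffDerivation_C (δ : Derivation K (MvPolynomial σ K) (MvPolynomial σ K))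
    (c : MvPolynomial σ K) :
    coeffDerivation δ (Polynomial.C c) = Polynomial.C (δ c) := by
  ext1 i
  rw [coeff_coeffDerivation, Polynomial.coeff_C, Polynomial.coeff_C]
  split_ifs <;> simp

theorem coeffDerivation_X (δ : Derivation K (MvPolynomial σ K) (MvPolynomial σ K)) :
    coeffDerivation δ (Polynomial.X) = 0 := by
  ext1 i
  rw [coeff_coeffDerivation, Polynomial.coeff_X]
  split_ifs <;> simp

theorem splitVar_derivation {x : σ} {s : Set σ} (hx : x ∉ s)
    (δ : Derivation K (MvPolynomial σ K) (MvPolynomial σ K))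
    (hs : ∀ e ∈ s, δ (X e) ∈ supported K s) (hδx : δ (X x) ∈ supported K s)
    {a : MvPolynomial σ K} (ha : a ∈ supported K (insert x s)) :
    splitVar x (δ a) = coeffDerivation δ (splitVar x a) +
      (splitVar x a).derivative * Polynomial.C (δ (X x)) := by
  rw [supported_eq_adjoin_X] at ha
  induction ha using Algebra.adjoin_induction with
  | mem y hy =>
    obtain ⟨e, rfl | he, rfl⟩ := hy
    · rw [splitVar_X_self, splitVar_of_mem_supported hx hδx, coeffDerivation_X]
      simp
    · rw [splitVar_of_mem_supported hx (hs e he), splitVar_X_of_ne (by rintro rfl; exact hx he),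
        coeffDerivation_C]
      simp
  | algebraMap r =>
    rw [Derivation.map_algebraMap, AlgHom.commutes, map_zero,
      IsScalarTower.algebraMap_apply K (MvPolynomial σ K), Polynomial.algebraMap_eq,
      coeffDerivation_C]
    simp
  | add y z _ _ hy hz => simp only [map_add, hy, hz]; ring
  | mul y z _ _ hy hz =>
    simp only [Derivation.leibniz, map_mul, map_add, hy, hz, smul_eq_mul,
      Polynomial.derivative_mul]
    ring

end SplitVariable

section SplitVariable

variable {σ K : Type*} [Field K]

theorem isWeightedHomogeneous_coeff_splitVar {w : σ → ℕ} {a : MvPolynomial σ K} {n : ℕ}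
    (ha : IsWeightedHomogeneous w a n) (x : σ) {k m : ℕ} (hm : m + k * w x = n) :
    IsWeightedHomogeneous w ((splitVar x a).coeff k) m := by
  intro β hβ
  rw [coeff_coeff_splitVar] at hβ
  split_ifs at hβ with h
  · have := ha hβ
    rw [map_add, Finsupp.weight_single, smul_eq_mul] at this
    omega
  · exact absurd rfl hβ

theorem coeff_splitVar_mem_range_expand (p : ℕ) {a : MvPolynomial σ K}
    (ha : a ∈ (expand p : MvPolynomial σ K →ₐ[K] _).range) (x : σ) (k : ℕ) :
    (splitVar x a).coeff k ∈ (expand p : MvPolynomial σ K →ₐ[K] _).range := by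
  rw [mem_range_expand_iff] at ha ⊢
  intro β hβ i
  rw [mem_support_iff, coeff_coeff_splitVar] at hβ
  split_ifs at hβ with h
  · by_cases hi : i = x
    · subst hi; simp [h]
    · have := ha _ (mem_support_iff.mpr hβ) i
      simpa [Finsupp.single_eq_of_ne hi] using this
  · exact absurd rfl hβ

theorem coeff_splitVar_eq_zero (p : ℕ) {a : MvPolynomial σ K}
    (ha : a ∈ (expand p : MvPolynomial σ K →ₐ[K] _).range) (x : σ) {k : ℕ} (hk : ¬ p ∣ k) :
    (splitVar x a).coeff k = 0 := by
  rw [mem_range_expand_iff] at ha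
  ext β
  rw [coeff_coeff_splitVar, coeff_zero]
  split_ifs with h
  · by_contra h0
    have := ha _ (mem_support_iff.mpr h0) x
    simp [h] at this
    exact hk this
  · rfl

theorem mem_range_expand_of_invariant {w : σ → ℕ} (hw : ∀ e, 0 < w e) (p : ℕ) [CharP K p]
    {S : Set (MvPolynomial σ K →ₐ[K] MvPolynomial σ K)}
    (hS : ∀ Φ ∈ S, ∀ e, Φ (X e) - X e ∈ supported K {e' | w e' < w e})
    {Δ : Set (Derivation K (MvPolynomial σ K) (MvPolynomial σ K))}
    (hΔ : ∀ δ ∈ Δ, ∀ e, δ (X e) ∈ supported K {e' | w e' < w e}) {D : ℕ}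
    (hinv : ∀ n a, 0 < n → n < D → IsWeightedHomogeneous w a n → (∀ Φ ∈ S, Φ a = a) → a = 0)
    (hlin : ∀ n a, n ≤ D → IsWeightedHomogeneous w a n → (∀ δ ∈ Δ, δ a = 0) →
      ∀ e, w e = n → coeff (Finsupp.single e 1) a = 0)
    {n : ℕ} (hnD : n ≤ D) {a : MvPolynomial σ K} (ha : IsWeightedHomogeneous w a n)
    (hδ : ∀ δ ∈ Δ, δ a = 0)
    (hΦ : ∀ Φ ∈ S, Φ a - a ∈ (expand p : MvPolynomial σ K →ₐ[K] _).range) :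
    a ∈ (expand p : MvPolynomial σ K →ₐ[K] _).range := by
  classical
  induction n using Nat.strong_induction_on generalizing a with
  | _ n ih =>
  have hzero : ∀ b : MvPolynomial σ K, IsWeightedHomogeneous w b 0 → ∀ α ∈ b.support, α = 0 := by
    intro b hb α hα
    have h := hb (mem_support_iff.mp hα)
    rw [Finsupp.weight_apply, Finsupp.sum, Finset.sum_eq_zero_iff] at h
    ext i
    by_contra hi
    have := h i (Finsupp.mem_support_iff.mpr hi)
    simp only [smul_eq_mul, mul_eq_zero] at this
    exact this.elim hi (hw i).ne'
  obtain ⟨a₀, a₁, rfl, ha₀, hsupp, hdvd⟩ := exists_split_range_expand p a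
  refine Subalgebra.add_mem _ ha₀ ?_
  have ha₁ : IsWeightedHomogeneous w a₁ n := fun α hα =>
    ha (mem_support_iff.mp (hsupp (mem_support_iff.mpr hα)))
  have hδ₁ : ∀ δ ∈ Δ, δ a₁ = 0 := fun δ h => by
    have := hδ δ h
    rwa [map_add, Derivation.eq_zero_of_mem_range_expand p δ ha₀, zero_add] at this
  have hΦ₁ : ∀ Φ ∈ S, Φ a₁ - a₁ ∈ (expand p : MvPolynomial σ K →ₐ[K] _).range := fun Φ h => by
    have h1 := Subalgebra.sub_mem _ (hΦ Φ h)
      (Subalgebra.sub_mem _ (AlgHom.mem_range_expand p Φ ha₀) ha₀)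
    rw [map_add] at h1
    convert h1 using 1
    ring
  clear hΦ hδ ha
  rcases a₁.vars.eq_empty_or_nonempty with hv | hv
  · rw [mem_range_expand_iff]
    intro α hα i
    have : i ∉ a₁.vars := by simp [hv]
    rw [mem_vars_iff_mem_support] at this
    push Not at this
    rw [Finsupp.notMem_support_iff.mp (this α hα)]
    exact dvd_zero p
  exfalso
  obtain ⟨x, hx, hmax⟩ := a₁.vars.exists_max_image w hv
  set s : Set σ := {e | e ≠ x ∧ w e ≤ w x} with hs
  have hxs : x ∉ s := fun h => h.1 rfl
  have hlt : ∀ e, w e ≤ w x → {e' | w e' < w e} ⊆ s := by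
    intro e he e' he'
    have : w e' < w e := he'
    refine ⟨?_, by omega⟩
    rintro rfl
    omega
  have ha₁s : a₁ ∈ supported K (insert x s) := by
    rw [mem_supported]
    intro e he
    by_cases h : e = x
    · exact Or.inl h
    · exact Or.inr ⟨h, hmax e he⟩
  have hsplitΦ : ∀ Φ ∈ S, splitVar x (Φ a₁) = Polynomial.taylor (Φ (X x) - X x)
      ((splitVar x a₁).map (Φ : _ →+* MvPolynomial σ K)) := fun Φ h =>
    splitVar_algHom hxs Φ (fun e he => by
      have := Subalgebra.add_mem _ (supported_mono (R := K) (hlt e he.2) (hS Φ h e))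
        (X_mem_supported (R := K).mpr he)
      simpa using this) (supported_mono (hlt x le_rfl) (hS Φ h x)) ha₁s
  have hsplitδ : ∀ δ ∈ Δ, splitVar x (δ a₁) = coeffDerivation δ (splitVar x a₁) +
      (splitVar x a₁).derivative * Polynomial.C (δ (X x)) := fun δ h =>
    splitVar_derivation hxs δ (fun e he => supported_mono (hlt e he.2) (hΔ δ h e))
      (supported_mono (hlt x le_rfl) (hΔ δ h x)) ha₁s
  set t := (splitVar x a₁).natDegree with ht
  set b := (splitVar x a₁).coeff t with hb
  have htop : ∀ c ∈ a₁.support, c x ≤ t := by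
    intro c hc
    refine Polynomial.le_natDegree_of_ne_zero fun h => ?_
    have h2 := coeff_coeff_splitVar x a₁ (c x) (c.erase x)
    rw [h, coeff_zero, if_pos (by simp), Finsupp.erase_add_single] at h2
    exact mem_support_iff.mp hc h2.symm
  obtain ⟨c, hc, hcx⟩ := mem_vars_iff_mem_support x |>.mp hx
  have ht1 : 1 ≤ t := (Nat.one_le_iff_ne_zero.mpr (Finsupp.mem_support_iff.mp hcx)).trans (htop c hc)
  have hb0 : b ≠ 0 := by
    intro h
    have h1 : splitVar x a₁ = 0 := Polynomial.leadingCoeff_eq_zero.mp h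
    rw [ht, h1] at ht1
    simp at ht1
  obtain ⟨β, hβ⟩ := ne_zero_iff.mp hb0
  have hβ' := hβ
  rw [hb, coeff_coeff_splitVar] at hβ'
  have hβx : β x = 0 := by
    by_contra h
    exact hβ' (if_neg h)
  rw [if_pos hβx] at hβ'
  have hβn := ha₁ hβ'
  rw [map_add, Finsupp.weight_single, smul_eq_mul] at hβn
  have hbhom : IsWeightedHomogeneous w b (Finsupp.weight w β) := isWeightedHomogeneous_coeff_splitVar ha₁ x hβn
  have hpos : 0 < t * w x := Nat.mul_pos ht1 (hw x)
  have hbδ : ∀ δ ∈ Δ, δ b = 0 := by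
    intro δ h
    have h1 := congrArg (fun q => Polynomial.coeff q t) (hsplitδ δ h)
    simp only [hδ₁ δ h, map_zero, Polynomial.coeff_zero, Polynomial.coeff_add,
      coeff_coeffDerivation, Polynomial.coeff_mul_C, Polynomial.coeff_derivative] at h1
    rw [Polynomial.coeff_eq_zero_of_natDegree_lt (show _ < t + 1 by omega)] at h1
    simpa using h1.symm
  have hbΦ : ∀ Φ ∈ S, (splitVar x (Φ a₁ - a₁)).coeff t = Φ b - b := by
    intro Φ h
    rw [map_sub, Polynomial.coeff_sub, hsplitΦ Φ h]
    congr 1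
    set q := (splitVar x a₁).map (Φ : _ →+* MvPolynomial σ K) with hq
    have hqt : q.coeff t = Φ b := by rw [hq, Polynomial.coeff_map]; rfl
    have hle : q.natDegree ≤ t := Polynomial.natDegree_map_le
    rcases hle.eq_or_lt with h | h
    · rw [← hqt, ← h, Polynomial.coeff_taylor_natDegree]; rfl
    · rw [← hqt, Polynomial.coeff_eq_zero_of_natDegree_lt h,
        Polynomial.coeff_eq_zero_of_natDegree_lt (by rwa [Polynomial.natDegree_taylor])]
  by_cases hpt : p ∣ t
  · have hbQ : b ∈ (expand p : MvPolynomial σ K →ₐ[K] _).range := by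
      refine ih _ (by omega) (by omega) hbhom hbδ fun Φ h => ?_
      rw [← hbΦ Φ h]
      exact coeff_splitVar_mem_range_expand p (hΦ₁ Φ h) x t
    rw [mem_range_expand_iff] at hbQ
    refine hdvd _ (mem_support_iff.mpr hβ') fun i => ?_
    rw [Finsupp.add_apply]
    refine dvd_add (hbQ β (mem_support_iff.mpr hβ) i) ?_
    by_cases hi : i = x
    · subst hi; simpa using hpt
    · simp [Finsupp.single_eq_of_ne hi]
  · have hbinv : ∀ Φ ∈ S, Φ b = b := by
      intro Φ h
      have := hbΦ Φ h
      rw [coeff_splitVar_eq_zero p (hΦ₁ Φ h) x hpt] at this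
      exact (sub_eq_zero.mp this.symm)
    rcases Nat.eq_zero_or_pos (Finsupp.weight w β) with h0 | h0
    swap
    · exact hb0 (hinv _ b h0 (by omega) hbhom hbinv)
    rw [h0] at hbhom hβn
    have hβ0 := hzero b hbhom β (mem_support_iff.mpr hβ)
    subst hβ0
    have hbC : b = C (coeff 0 b) := by
      ext γ
      rw [coeff_C]
      split_ifs with h
      · rw [h]
      · by_contra h'
        exact h (hzero b hbhom γ (mem_support_iff.mpr h')).symm
    obtain ⟨k, hk⟩ : ∃ k, t = k + 1 := ⟨t - 1, by omega⟩
    set v := (splitVar x a₁).coeff k + C ((t : K) * coeff 0 b) * X x with hv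
    have hk1 : w x + k * w x = n := by rw [← hβn, hk]; ring
    have hvhom : IsWeightedHomogeneous w v (w x) := by
      refine IsWeightedHomogeneous.add (isWeightedHomogeneous_coeff_splitVar ha₁ x hk1) ?_
      have := (isWeightedHomogeneous_C w ((t : K) * coeff 0 b)).mul
        (isWeightedHomogeneous_X K w x)
      rwa [zero_add] at this
    have hvδ : ∀ δ ∈ Δ, δ v = 0 := by
      intro δ h
      have h1 := congrArg (fun q => Polynomial.coeff q k) (hsplitδ δ h)
      simp only [hδ₁ δ h, map_zero, Polynomial.coeff_zero, Polynomial.coeff_add,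
        coeff_coeffDerivation, Polynomial.coeff_mul_C, Polynomial.coeff_derivative] at h1
      rw [← hk, ← hb, hbC] at h1
      rw [hv, map_add, h1, Derivation.leibniz, ← algebraMap_eq, Derivation.map_algebraMap,
        algebraMap_eq, hk]
      simp only [smul_eq_mul, map_mul, Nat.cast_add, Nat.cast_one, map_add, map_one,
        map_natCast]
      ring
    have := hlin (w x) v (by nlinarith) hvhom hvδ x rfl
    rw [hv, coeff_add, coeff_coeff_splitVar, if_neg (by simp), zero_add, coeff_C_mul,
      coeff_X, if_pos rfl, mul_one, mul_eq_zero, CharP.cast_eq_zero_iff K p] at this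
    exact this.elim hpt hβ

end SplitVariable

section WeightedDegree

variable {σ K : Type*} [CommRing K] {w : σ → ℕ}

theorem weight_le_of_mem_vars {a : MvPolynomial σ K} {n : ℕ} (ha : IsWeightedHomogeneous w a n)
    {e : σ} (he : e ∈ a.vars) : w e ≤ n := by
  classical
  obtain ⟨α, hα, h⟩ := mem_vars_iff_mem_support e |>.mp he
  rw [← ha (mem_support_iff.mp hα), Finsupp.weight_apply, Finsupp.sum]
  refine le_trans ?_ (Finset.single_le_sum (f := fun i => α i • w i) (fun _ _ => Nat.zero_le _) h)
  exact Nat.le_mul_of_pos_left _ (Nat.pos_of_ne_zero (Finsupp.mem_support_iff.mp h))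

theorem eq_zero_of_weight_eq_zero (hw : ∀ e, 0 < w e) {α : σ →₀ ℕ} (h : Finsupp.weight w α = 0) :
    α = 0 := by
  rw [Finsupp.weight_apply, Finsupp.sum, Finset.sum_eq_zero_iff] at h
  ext i
  by_contra hi
  have := h i (Finsupp.mem_support_iff.mpr hi)
  simp only [smul_eq_mul, mul_eq_zero] at this
  exact this.elim hi (hw i).ne'

theorem eq_C_of_isWeightedHomogeneous_zero (hw : ∀ e, 0 < w e) {b : MvPolynomial σ K}
    (hb : IsWeightedHomogeneous w b 0) : b = C (coeff 0 b) := by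
  classical
  ext γ
  rw [coeff_C]
  split_ifs with h
  · rw [h]
  · by_contra h'
    exact h (eq_zero_of_weight_eq_zero hw (hb h')).symm

/-- An endomorphism which changes each variable only in lower degrees changes each homogeneous
polynomial only in lower degrees. -/
theorem weight_lt_of_mem_support_sub {Φ : MvPolynomial σ K →ₐ[K] MvPolynomial σ K}
    (hΦ : ∀ e, ∀ α ∈ (Φ (X e) - X e).support, Finsupp.weight w α < w e)
    {f : MvPolynomial σ K} {n : ℕ} (hf : IsWeightedHomogeneous w f n) :
    ∀ α ∈ (Φ f - f).support, Finsupp.weight w α < n := by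
  classical
  have hmono : ∀ β : σ →₀ ℕ, ∀ α ∈ (Φ (monomial β 1) - monomial β 1).support,
      Finsupp.weight w α < Finsupp.weight w β := by
    intro β
    induction β using Finsupp.induction_linear with
    | zero => simp
    | add β γ hβ hγ =>
      intro α hα
      have h1 : Φ (monomial (β + γ) 1) - monomial (β + γ) 1 =
          Φ (monomial β 1) * (Φ (monomial γ 1) - monomial γ 1) +
            (Φ (monomial β 1) - monomial β 1) * monomial γ 1 := by
        rw [show (monomial (β + γ) (1 : K)) = monomial β 1 * monomial γ 1 by
          rw [monomial_mul, one_mul], map_mul]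
        ring
      have hle : ∀ α ∈ (Φ (monomial β 1)).support, Finsupp.weight w α ≤ Finsupp.weight w β := by
        intro α hα
        rw [show Φ (monomial β (1 : K)) = (Φ (monomial β 1) - monomial β 1) + monomial β 1 by
          ring] at hα
        rcases Finset.mem_union.mp (support_add hα) with h | h
        · exact (hβ α h).le
        · rw [Finset.mem_singleton.mp (support_monomial_subset h)]
      rw [h1] at hα
      rw [map_add]
      rcases Finset.mem_union.mp (support_add hα) with h | h
      · obtain ⟨a, ha, b, hb, rfl⟩ := Finset.mem_add.mp (support_mul _ _ h)
        rw [map_add]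
        exact add_lt_add_of_le_of_lt (hle a ha) (hγ b hb)
      · obtain ⟨a, ha, b, hb, rfl⟩ := Finset.mem_add.mp (support_mul _ _ h)
        rw [map_add, Finset.mem_singleton.mp (support_monomial_subset hb)]
        exact add_lt_add_left (hβ a ha) _
    | single e k =>
      induction k with
      | zero => simp
      | succ k ih =>
        intro α hα
        have h1 : Φ (monomial (Finsupp.single e (k + 1)) 1) - monomial (Finsupp.single e (k + 1)) 1 =
            Φ (X e) * (Φ (monomial (Finsupp.single e k) 1) - monomial (Finsupp.single e k) 1) +
              (Φ (X e) - X e) * monomial (Finsupp.single e k) 1 := by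
          rw [show monomial (Finsupp.single e (k + 1)) (1 : K) =
            monomial (Finsupp.single e k) 1 * X e by
            rw [← X_pow_eq_monomial, ← X_pow_eq_monomial, pow_succ], map_mul]
          ring
        have hle : ∀ α ∈ (Φ (X e)).support, Finsupp.weight w α ≤ w e := by
          intro α hα
          rw [show Φ (X e) = (Φ (X e) - X e) + X e by ring] at hα
          rcases Finset.mem_union.mp (support_add hα) with h | h
          · exact (hΦ e α h).le
          · rw [Finset.mem_singleton.mp (support_monomial_subset h), Finsupp.weight_single,
              one_smul]
        have hwt : Finsupp.weight w (Finsupp.single e (k + 1)) =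
            w e + Finsupp.weight w (Finsupp.single e k) := by
          rw [Finsupp.weight_single, Finsupp.weight_single, smul_eq_mul, smul_eq_mul]
          ring
        rw [h1] at hα
        rw [hwt]
        rcases Finset.mem_union.mp (support_add hα) with h | h
        · obtain ⟨a, ha, b, hb, rfl⟩ := Finset.mem_add.mp (support_mul _ _ h)
          rw [map_add]
          exact add_lt_add_of_le_of_lt (hle a ha) (ih b hb)
        · obtain ⟨a, ha, b, hb, rfl⟩ := Finset.mem_add.mp (support_mul _ _ h)
          rw [map_add, Finset.mem_singleton.mp (support_monomial_subset hb)]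
          exact add_lt_add_left (hΦ e a ha) _
  intro α hα
  rw [f.as_sum, map_sum, ← Finset.sum_sub_distrib] at hα
  obtain ⟨β, hβ, h⟩ := Finset.mem_biUnion.mp (support_sum hα)
  have h1 : monomial β (coeff β f) = coeff β f • monomial β (1 : K) := by
    rw [smul_monomial, smul_eq_mul, mul_one]
  rw [h1, map_smul, ← smul_sub] at h
  have := hmono β α (support_smul h)
  rwa [hf (mem_support_iff.mp hβ)] at this

theorem isWeightedHomogeneous_mkDerivation {q : σ → MvPolynomial σ K}
    (hq : ∀ e, ∃ k, w e = k + 1 ∧ IsWeightedHomogeneous w (q e) k)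
    {f : MvPolynomial σ K} {n : ℕ} (hf : IsWeightedHomogeneous w f n) :
    IsWeightedHomogeneous w (mkDerivation K q f) (n - 1) := by
  rw [f.as_sum, map_sum]
  refine IsWeightedHomogeneous.sum _ _ _ fun α hα => ?_
  rw [mkDerivation_monomial]
  refine (weightedHomogeneousSubmodule K w (n - 1)).smul_mem _
    (IsWeightedHomogeneous.sum _ _ _ fun e he => ?_)
  obtain ⟨k, hk, hqk⟩ := hq e
  have h1 : α = (α - Finsupp.single e 1) + Finsupp.single e 1 := by
    rw [tsub_add_cancel_of_le]
    rw [Finsupp.single_le_iff]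
    exact Nat.one_le_iff_ne_zero.mpr (Finsupp.mem_support_iff.mp he)
  have h2 : Finsupp.weight w (α - Finsupp.single e 1) + (k + 1) = n := by
    rw [← hf (mem_support_iff.mp hα), ← hk]
    conv_rhs => rw [h1]
    rw [map_add, Finsupp.weight_single, one_smul]
  change IsWeightedHomogeneous w (monomial _ _ * q e) _
  rw [show n - 1 = Finsupp.weight w (α - Finsupp.single e 1) + k by omega]
  exact (isWeightedHomogeneous_monomial w _ _ rfl).mul hqk

end WeightedDegree

section GradedPolynomial

universe v

variable {K : Type*} {T : Type v} [Field K] [CommRing T] [Algebra K T] (𝒜 : ℕ → Submodule K T)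

/-- The span of the products of elements of lower positive degree. -/
def decomposables (n : ℕ) : Submodule K T :=
  Submodule.span K {z | ∃ i j, 0 < i ∧ 0 < j ∧ i + j = n ∧ ∃ x ∈ 𝒜 i, ∃ y ∈ 𝒜 j, z = x * y}

theorem exists_indecomposable_basis (n : ℕ) :
    ∃ (ι : Type v) (b : ι → T) (l : ι → T →ₗ[K] K), (∀ i, b i ∈ 𝒜 n) ∧ (∀ i, l i (b i) = 1) ∧
      (∀ i j, i ≠ j → l i (b j) = 0) ∧ (∀ i, ∀ x ∈ decomposables 𝒜 n, l i x = 0) ∧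
      𝒜 n ≤ Submodule.span K (Set.range b) ⊔ decomposables 𝒜 n := by
  classical
  set Q := decomposables 𝒜 n
  set V := (𝒜 n).map Q.mkQ
  let B := Module.Basis.ofVectorSpace K V
  have h1 : ∀ i, ∃ b ∈ 𝒜 n, Q.mkQ b = (B i : T ⧸ Q) := fun i => (B i).2
  choose b hb hbB using h1
  have h2 : ∀ i, ∃ g : (T ⧸ Q) →ₗ[K] K, g ∘ₗ V.subtype = B.coord i := fun i =>
    LinearMap.exists_extend _
  choose g hg using h2
  have hl : ∀ i j, (g i ∘ₗ Q.mkQ) (b j) = B.coord i (B j) := by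
    intro i j
    rw [← hg, LinearMap.comp_apply, hbB]
    rfl
  refine ⟨_, b, fun i => g i ∘ₗ Q.mkQ, hb, ?_, ?_, ?_, ?_⟩
  · intro i; rw [hl]; simp
  · intro i j h; rw [hl]; simp [h.symm]
  · intro i x hx
    rw [LinearMap.comp_apply, Submodule.mkQ_apply, (Submodule.Quotient.mk_eq_zero Q).mpr hx, map_zero]
  · intro x hx
    have hv := B.mem_span (⟨Q.mkQ x, x, hx, rfl⟩ : V)
    have h3 : Q.mkQ x ∈ (Submodule.span K (Set.range b)).map Q.mkQ := by
      have := Submodule.mem_map_of_mem (f := V.subtype) hv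
      rw [Submodule.map_span, ← Set.range_comp] at this
      rw [Submodule.map_span, ← Set.range_comp]
      rw [show ⇑Q.mkQ ∘ b = V.subtype ∘ B from funext hbB]
      exact this
    obtain ⟨z, hz, hzx⟩ := h3
    rw [← sub_add_cancel x z, add_comm]
    refine Submodule.add_mem_sup hz ?_
    rw [← Submodule.Quotient.mk_eq_zero, Submodule.Quotient.mk_sub, sub_eq_zero]
    exact hzx.symm

end GradedPolynomial

section GradedPolynomial

universe v

variable {K : Type*} {T : Type v} [Field K] [CommRing T] [Algebra K T] {𝒜 : ℕ → Submodule K T}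

theorem aeval_mem_of_isWeightedHomogeneous [SetLike.GradedMonoid 𝒜] {E : Type*} {w : E → ℕ}
    {y : E → T} (hy : ∀ e, y e ∈ 𝒜 (w e)) {f : MvPolynomial E K} {n : ℕ}
    (hf : IsWeightedHomogeneous w f n) : aeval y f ∈ 𝒜 n := by
  have hmono : ∀ α : E →₀ ℕ, aeval y (monomial α (1 : K)) ∈ 𝒜 (Finsupp.weight w α) := by
    intro α
    induction α using Finsupp.induction_linear with
    | zero => simpa using SetLike.GradedOne.one_mem
    | add α β hα hβ =>
      rw [← one_mul (1 : K), ← monomial_mul, map_mul, map_add]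
      exact SetLike.GradedMul.mul_mem hα hβ
    | single e k =>
      rw [← X_pow_eq_monomial, map_pow, aeval_X, Finsupp.weight_single]
      exact SetLike.pow_mem_graded k (hy e)
  rw [f.as_sum, map_sum]
  refine Submodule.sum_mem _ fun α hα => ?_
  rw [← hf (mem_support_iff.mp hα), ← mul_one (coeff α f), ← smul_eq_mul, ← smul_monomial, map_smul]
  exact Submodule.smul_mem _ _ (hmono α)

theorem exists_aeval_eq_of_mem {E : Type*} {w : E → ℕ} {y : E → T}
    (h0 : ∀ x ∈ 𝒜 0, ∃ c : K, x = algebraMap K T c)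
    (hgen : ∀ n, 𝒜 (n + 1) ≤ Submodule.span K {z | ∃ e, w e = n + 1 ∧ y e = z} ⊔
      decomposables 𝒜 (n + 1)) {n : ℕ} {x : T} (hx : x ∈ 𝒜 n) :
    ∃ f : MvPolynomial E K, IsWeightedHomogeneous w f n ∧ aeval y f = x := by
  induction n using Nat.strong_induction_on generalizing x with
  | _ n ih =>
  obtain _ | n := n
  · obtain ⟨c, rfl⟩ := h0 x hx
    exact ⟨C c, isWeightedHomogeneous_C w c, by simp⟩
  · have : Submodule.span K {z | ∃ e, w e = n + 1 ∧ y e = z} ⊔ decomposables 𝒜 (n + 1) ≤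
        (weightedHomogeneousSubmodule K w (n + 1)).map (aeval y).toLinearMap := by
      refine sup_le (Submodule.span_le.mpr ?_) (Submodule.span_le.mpr ?_)
      · rintro _ ⟨e, he, rfl⟩
        exact ⟨X e, he ▸ isWeightedHomogeneous_X K w e, by simp⟩
      · rintro _ ⟨i, j, hi, hj, hij, a, ha, b, hb, rfl⟩
        obtain ⟨f, hf, rfl⟩ := ih i (by omega) ha
        obtain ⟨g, hg, rfl⟩ := ih j (by omega) hb
        exact ⟨f * g, hij ▸ hf.mul hg, by simp⟩
    obtain ⟨f, hf, h⟩ := this (hgen n hx)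
    exact ⟨f, hf, h⟩

theorem aeval_monomial_mem_decomposables [SetLike.GradedMonoid 𝒜] {E : Type*} {w : E → ℕ}
    (hw : ∀ e, 0 < w e) {y : E → T} (hy : ∀ e, y e ∈ 𝒜 (w e)) {α : E →₀ ℕ} (h0 : α ≠ 0)
    (h1 : ∀ e, α ≠ Finsupp.single e 1) :
    aeval y (monomial α (1 : K)) ∈ decomposables 𝒜 (Finsupp.weight w α) := by
  classical
  obtain ⟨e, he⟩ := Finsupp.support_nonempty_iff.mpr h0
  have hα : α = Finsupp.single e 1 + (α - Finsupp.single e 1) := by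
    rw [add_tsub_cancel_of_le]
    rw [Finsupp.single_le_iff]
    exact Nat.one_le_iff_ne_zero.mpr (Finsupp.mem_support_iff.mp he)
  set β := α - Finsupp.single e 1
  have hβ : β ≠ 0 := by
    intro h
    rw [h, add_zero] at hα
    exact h1 e hα
  refine Submodule.subset_span ⟨w e, Finsupp.weight w β, hw e, ?_, ?_, y e, hy e,
    aeval y (monomial β (1 : K)), ?_, ?_⟩
  · exact Nat.pos_of_ne_zero fun h => hβ (eq_zero_of_weight_eq_zero hw h)
  · conv_rhs => rw [hα]
    rw [map_add, Finsupp.weight_single, one_smul]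
  · exact aeval_mem_of_isWeightedHomogeneous hy (isWeightedHomogeneous_monomial w _ _ rfl)
  · conv_lhs => rw [hα]
    rw [show (monomial (Finsupp.single e 1 + β) (1 : K)) = X e * monomial β 1 by
      rw [X, monomial_mul, one_mul], map_mul, aeval_X]

/-- A graded algebra over a perfect field, with enough unipotent automorphisms and enough
derivations of degree `-1`, is a polynomial algebra on homogeneous generators. -/
theorem exists_polynomial_generators [IsDomain T] [SetLike.GradedMonoid 𝒜]
    (p : ℕ) [CharP K p] (hperf : p ≠ 0 → ∀ c : K, ∃ b, b ^ p = c)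
    (h0 : ∀ x ∈ 𝒜 0, ∃ c : K, x = algebraMap K T c)
    (comp : ℕ → T →ₗ[K] T) (hcomp : ∀ n, ∀ x ∈ 𝒜 n, comp n x = x)
    (hcomp' : ∀ n k, k ≠ n → ∀ x ∈ 𝒜 n, comp k x = 0)
    (S : Set (T →ₐ[K] T)) (hS : ∀ Φ ∈ S, ∀ n, ∀ x ∈ 𝒜 n, ∃ z : ℕ → T, (∀ k, z k ∈ 𝒜 k) ∧
      Φ x = x + ∑ k ∈ Finset.range n, z k)
    (hinv : ∀ n, 0 < n → ∀ x ∈ 𝒜 n, (∀ Φ ∈ S, Φ x = x) → x = 0)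
    (Δ : Set (Derivation K T T)) (hΔ : ∀ δ ∈ Δ, ∀ n, ∀ x ∈ 𝒜 (n + 1), δ x ∈ 𝒜 n)
    (hdec : ∀ n, 0 < n → ∀ x ∈ 𝒜 n, (∀ δ ∈ Δ, δ x = 0) → x ∈ decomposables 𝒜 n) :
    ∃ (E : Type v) (w : E → ℕ) (y : E → T), (∀ e, 0 < w e) ∧ (∀ e, y e ∈ 𝒜 (w e)) ∧
      (∀ n f, IsWeightedHomogeneous w f n → aeval y f = 0 → f = (0 : MvPolynomial E K)) ∧
      ∀ n, ∀ x ∈ 𝒜 n, ∃ f : MvPolynomial E K, IsWeightedHomogeneous w f n ∧ aeval y f = x := by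
  classical
  choose ι b l hb hl1 hl0 hldec hspan using exists_indecomposable_basis 𝒜
  set E := Σ n, ι (n + 1)
  set w : E → ℕ := fun e => e.1 + 1 with hwdef
  set y : E → T := fun e => b (e.1 + 1) e.2 with hydef
  have hw : ∀ e, 0 < w e := fun e => Nat.succ_pos _
  have hy : ∀ e, y e ∈ 𝒜 (w e) := fun e => hb _ _
  have hsurj : ∀ n, ∀ x ∈ 𝒜 n, ∃ f : MvPolynomial E K, IsWeightedHomogeneous w f n ∧
      aeval y f = x := by
    intro n x hx
    refine exists_aeval_eq_of_mem h0 (fun n => (hspan (n + 1)).trans ?_) hx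
    refine sup_le_sup_right (Submodule.span_mono ?_) _
    rintro _ ⟨i, rfl⟩
    exact ⟨⟨n, i⟩, rfl, rfl⟩
  refine ⟨E, w, y, hw, hy, ?_, hsurj⟩
  have hmem : ∀ {n} {f : MvPolynomial E K}, IsWeightedHomogeneous w f n → aeval y f ∈ 𝒜 n :=
    fun hf => aeval_mem_of_isWeightedHomogeneous hy hf
  have hliftS : ∀ Φ : S, ∃ Ψ : MvPolynomial E K →ₐ[K] MvPolynomial E K,
      (∀ e, Ψ (X e) - X e ∈ supported K {e' | w e' < w e} ∧
        ∀ α ∈ (Ψ (X e) - X e).support, Finsupp.weight w α < w e) ∧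
      ∀ a, aeval y (Ψ a) = Φ.1 (aeval y a) := by
    rintro ⟨Φ, hΦ⟩
    have h1 : ∀ e, ∃ q : ℕ → MvPolynomial E K, (∀ k, IsWeightedHomogeneous w (q k) k) ∧
        Φ (y e) = y e + ∑ k ∈ Finset.range (w e), aeval y (q k) := by
      intro e
      obtain ⟨z, hz, h⟩ := hS Φ hΦ (w e) (y e) (hy e)
      choose q hq hqz using fun k => hsurj k (z k) (hz k)
      exact ⟨q, hq, by simp only [h, hqz]⟩
    choose q hq hqy using h1
    refine ⟨aeval fun e => X e + ∑ k ∈ Finset.range (w e), q e k, fun e => ⟨?_, ?_⟩, fun a => ?_⟩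
    · rw [aeval_X, add_sub_cancel_left]
      refine Subalgebra.sum_mem _ fun k hk => ?_
      rw [mem_supported]
      intro e' he'
      exact (weight_le_of_mem_vars (hq e k) he').trans_lt (Finset.mem_range.mp hk)
    · rw [aeval_X, add_sub_cancel_left]
      intro α hα
      obtain ⟨k, hk, h⟩ := Finset.mem_biUnion.mp (support_sum hα)
      rw [hq e k (mem_support_iff.mp h)]
      exact Finset.mem_range.mp hk
    · induction a using MvPolynomial.induction_on with
      | C c =>
        rw [← algebraMap_eq, AlgHom.commutes, AlgHom.commutes, AlgHom.commutes]
      | add a b ha hb => simp only [map_add, ha, hb]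
      | mul_X a e ha =>
        rw [map_mul, map_mul, map_mul, map_mul, ha, aeval_X, aeval_X, hqy, map_add, map_sum,
          aeval_X]
  have hliftΔ : ∀ δ : Δ, ∃ q : E → MvPolynomial E K,
      (∀ e, ∃ k, w e = k + 1 ∧ IsWeightedHomogeneous w (q e) k) ∧
      ∀ a, aeval y (mkDerivation K q a) = δ.1 (aeval y a) := by
    rintro ⟨δ, hδ⟩
    choose q hq hqy using fun e : E => hsurj e.1 (δ (y e)) (hΔ δ hδ _ _ (hy e))
    refine ⟨q, fun e => ⟨e.1, rfl, hq e⟩, fun a => ?_⟩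
    induction a using MvPolynomial.induction_on with
    | C c =>
      rw [← algebraMap_eq, AlgHom.commutes, Derivation.map_algebraMap, Derivation.map_algebraMap,
        map_zero]
    | add a b ha hb => simp only [map_add, ha, hb]
    | mul_X a e ha =>
      rw [Derivation.leibniz, map_add, smul_eq_mul, smul_eq_mul, map_mul, map_mul, ha,
        mkDerivation_X, hqy, map_mul, Derivation.leibniz, aeval_X]
      rfl
  choose Ψ hΨ hΨy using hliftS
  choose q hq hqy using hliftΔ
  intro D
  induction D using Nat.strong_induction_on with
  | _ D ih =>
  intro f hf hfy
  rcases Nat.eq_zero_or_pos D with rfl | hD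
  · rw [eq_C_of_isWeightedHomogeneous_zero hw hf] at hfy ⊢
    rw [aeval_C, map_eq_zero_iff _ (algebraMap K T).injective] at hfy
    rw [hfy, C_0]
  have hΨf : ∀ Φ, Ψ Φ f = f := by
    intro Φ
    have hlt := weight_lt_of_mem_support_sub (fun e => (hΨ Φ e).2) hf
    rw [← sub_eq_zero]
    set g := Ψ Φ f - f with hg
    have hgy : aeval y g = 0 := by rw [hg, map_sub, hΨy, hfy, map_zero, sub_zero]
    have hsum : ∑ k ∈ Finset.range D, weightedHomogeneousComponent w k g = g := by
      conv_rhs => rw [← sum_weightedHomogeneousComponent w g]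
      refine (finsum_eq_sum_of_support_subset _ ?_).symm
      intro k hk
      rw [Function.mem_support] at hk
      by_contra hkD
      refine hk ?_
      ext α
      rw [coeff_weightedHomogeneousComponent, coeff_zero]
      split_ifs with h
      · by_contra h'
        have := hlt α (mem_support_iff.mpr h')
        simp at hkD
        omega
      · rfl
    rw [← hsum] at hgy ⊢
    refine Finset.sum_eq_zero fun k hk => ih k (Finset.mem_range.mp hk) _
      (weightedHomogeneousComponent_isWeightedHomogeneous k g) ?_
    have hcg : ∀ j, IsWeightedHomogeneous w (weightedHomogeneousComponent w j g) j := fun j =>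
      weightedHomogeneousComponent_isWeightedHomogeneous j g
    have := congrArg (comp k) hgy
    rw [map_sum, map_sum, map_zero, Finset.sum_eq_single k] at this
    · rwa [hcomp _ _ (hmem (hcg k))] at this
    · intro j _ hjk
      exact hcomp' j k hjk.symm _ (hmem (hcg j))
    · intro h; exact absurd hk h
  have hqf : ∀ δ, mkDerivation K (q δ) f = 0 := fun δ =>
    ih (D - 1) (by omega) _ (isWeightedHomogeneous_mkDerivation (hq δ) hf)
      (by rw [hqy, hfy, map_zero])
  have key : f ∈ (expand p : MvPolynomial E K →ₐ[K] _).range := by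
    refine mem_range_expand_of_invariant hw p (S := Set.range Ψ)
      (Δ := Set.range fun δ => mkDerivation K (q δ)) ?_ ?_ (D := D) ?_ ?_ le_rfl hf ?_ ?_
    · rintro _ ⟨Φ, rfl⟩ e
      exact (hΨ Φ e).1
    · rintro _ ⟨δ, rfl⟩ e
      obtain ⟨k, hk, h⟩ := hq δ e
      rw [mkDerivation_X, mem_supported]
      intro e' he'
      have := weight_le_of_mem_vars h he'
      change w e' < w e
      omega
    · intro n a hn hnD ha hinva
      refine ih n hnD a ha (hinv n hn _ (hmem ha) fun Φ hΦ => ?_)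
      rw [← hΨy ⟨Φ, hΦ⟩, hinva _ ⟨_, rfl⟩]
    · rintro n a - ha hδa ⟨m, i⟩ rfl
      have hx := hdec _ (Nat.succ_pos m) _ (hmem ha) fun δ hδ => by
        rw [← hqy ⟨δ, hδ⟩, hδa _ ⟨⟨δ, hδ⟩, rfl⟩, map_zero]
      have h1 := hldec (m + 1) i _ hx
      rw [a.as_sum, map_sum, map_sum] at h1
      by_contra hcoeff
      rw [Finset.sum_eq_single (Finsupp.single (⟨m, i⟩ : E) 1)] at h1
      · rw [show monomial (Finsupp.single (⟨m, i⟩ : E) 1) (coeff (Finsupp.single ⟨m, i⟩ 1) a) =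
          coeff (Finsupp.single ⟨m, i⟩ 1) a • X ⟨m, i⟩ by
            rw [X, smul_monomial, smul_eq_mul, mul_one], map_smul, map_smul, aeval_X] at h1
        change _ • l (m + 1) i (b (m + 1) i) = 0 at h1
        rw [hl1, smul_eq_mul, mul_one] at h1
        exact hcoeff h1
      · intro α hα hne
        have hαw := ha (mem_support_iff.mp hα)
        rw [← mul_one (coeff α a), ← smul_eq_mul, ← smul_monomial, map_smul, map_smul,
          smul_eq_mul, mul_eq_zero]
        right
        by_cases hs : ∃ e, α = Finsupp.single e 1
        · obtain ⟨⟨m', j⟩, rfl⟩ := hs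
          rw [Finsupp.weight_single, one_smul] at hαw
          obtain rfl : m' = m := by simpa [hwdef] using hαw
          change l _ _ (aeval y (X _)) = 0
          rw [aeval_X]
          refine hl0 _ _ _ ?_
          rintro rfl
          exact hne rfl
        · push Not at hs
          refine hldec (m + 1) i _ ?_
          rw [show m + 1 = Finsupp.weight w α from hαw.symm]
          refine aeval_monomial_mem_decomposables hw hy ?_ hs
          rintro rfl
          rw [map_zero] at hαw
          exact absurd hαw.symm (hw _).ne'
      · intro h
        exact absurd (mem_support_iff.mpr hcoeff) h
    · rintro _ ⟨δ, rfl⟩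
      exact hqf δ
    · rintro _ ⟨Φ, rfl⟩
      rw [hΨf, sub_self]
      exact Subalgebra.zero_mem _
  rcases CharP.char_is_prime_or_zero K p with hp | rfl
  · have := Fact.mk hp
    obtain ⟨g, rfl⟩ := key
    obtain ⟨F, rfl⟩ := map_surjective (frobenius K p) (hperf hp.ne_zero) g
    change expand p (map (frobenius K p) F) = 0
    change IsWeightedHomogeneous w (expand p (map (frobenius K p) F)) D at hf
    change aeval y (expand p (map (frobenius K p) F)) = 0 at hfy
    have hF : expand p (map (frobenius K p) F) = F ^ p := by
      rw [← map_frobenius_expand, map_expand]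
    have hFD : ∀ β, coeff β F ≠ 0 → p * Finsupp.weight w β = D := by
      intro β hβ
      have h1 : coeff (p • β) (expand p (map (frobenius K p) F)) ≠ 0 := by
        rw [coeff_expand_smul _ hp.ne_zero, coeff_map]
        simpa [frobenius_def, hp.ne_zero] using hβ
      have := hf h1
      rwa [map_nsmul, smul_eq_mul] at this
    rw [hF, map_pow] at hfy
    rw [hF, ih (D / p) (Nat.div_lt_self hD hp.one_lt) F ?_ (pow_eq_zero_iff hp.ne_zero |>.mp hfy),
      zero_pow hp.ne_zero]
    intro β hβ
    rw [← hFD β hβ, Nat.mul_div_cancel_left _ hp.pos]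
  · rw [mem_range_expand_iff] at key
    ext α
    by_contra hα
    have h1 : α = 0 := by
      ext i
      exact zero_dvd_iff.mp (key α (mem_support_iff.mpr hα) i)
    have h2 := hf hα
    rw [h1, map_zero] at h2
    omega

end GradedPolynomial

section Ultraproduct

variable (U : Ultrafilter ℕ)

/-- The ideal of the sequences which vanish almost everywhere. -/
def nullIdeal (R : ℕ → Type u) [∀ m, CommRing (R m)] : Ideal (∀ m, R m) where
  carrier := {a | ∀ᶠ m in U, a m = 0}
  add_mem' ha hb := by
    filter_upwards [ha, hb] with m h1 h2
    simp [h1, h2]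
  zero_mem' := by simp
  smul_mem' c a ha := by
    filter_upwards [ha] with m h
    simp [h]

/-- The ultraproduct of a sequence of commutative rings. -/
def UProd (R : ℕ → Type u) [∀ m, CommRing (R m)] : Type u := (∀ m, R m) ⧸ nullIdeal U R

namespace UProd

noncomputable instance (R : ℕ → Type u) [∀ m, CommRing (R m)] : CommRing (UProd U R) :=
  inferInstanceAs (CommRing ((∀ m, R m) ⧸ nullIdeal U R))

variable {R S : ℕ → Type u} [∀ m, CommRing (R m)] [∀ m, CommRing (S m)]

/-- The class of a sequence in the ultraproduct. -/
def mk : (∀ m, R m) →+* UProd U R := Ideal.Quotient.mk (nullIdeal U R)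

variable {U}

theorem mk_surjective : Function.Surjective (mk U : (∀ m, R m) →+* UProd U R) :=
  Ideal.Quotient.mk_surjective

theorem mk_eq_mk {a b : ∀ m, R m} : mk U a = mk U b ↔ ∀ᶠ m in U, a m = b m := by
  refine (Ideal.Quotient.eq (I := nullIdeal U R)).trans ?_
  change (∀ᶠ m in U, a m - b m = 0) ↔ _
  simp only [sub_eq_zero]

theorem mk_eq_zero {a : ∀ m, R m} : mk U a = 0 ↔ ∀ᶠ m in U, a m = 0 := by
  rw [← map_zero (mk U), mk_eq_mk]
  rfl

/-- A representing sequence. -/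
noncomputable def rep (x : UProd U R) : ∀ m, R m := (mk_surjective x).choose

theorem mk_rep (x : UProd U R) : mk U (rep x) = x := (mk_surjective x).choose_spec

/-- The map of ultraproducts induced by a sequence of maps. -/
noncomputable def lift (F : ∀ m, R m → S m) (x : UProd U R) : UProd U S :=
  mk U fun m => F m (rep x m)

theorem lift_mk (F : ∀ m, R m → S m) (a : ∀ m, R m) :
    lift F (mk U a) = mk U fun m => F m (a m) := by
  rw [lift, mk_eq_mk]
  filter_upwards [mk_eq_mk.mp (mk_rep (mk U a))] with m h
  rw [h]

/-- The ring homomorphism of ultraproducts induced by a sequence of ring homomorphisms. -/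
noncomputable def map (F : ∀ m, R m →+* S m) : UProd U R →+* UProd U S where
  toFun := lift fun m => F m
  map_one' := by
    rw [← map_one (mk U), lift_mk, ← map_one (mk U)]
    congr 1
    ext m
    simp
  map_zero' := by
    rw [← map_zero (mk U), lift_mk, ← map_zero (mk U)]
    congr 1
    ext m
    simp
  map_mul' x y := by
    obtain ⟨a, rfl⟩ := mk_surjective x
    obtain ⟨b, rfl⟩ := mk_surjective y
    rw [← map_mul, lift_mk, lift_mk, lift_mk, ← map_mul]
    congr 1
    ext m
    simp
  map_add' x y := by
    obtain ⟨a, rfl⟩ := mk_surjective x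
    obtain ⟨b, rfl⟩ := mk_surjective y
    rw [← map_add, lift_mk, lift_mk, lift_mk, ← map_add]
    congr 1
    ext m
    simp

theorem map_mk (F : ∀ m, R m →+* S m) (a : ∀ m, R m) :
    map F (mk U a) = mk U fun m => F m (a m) :=
  lift_mk _ _

instance [∀ m, IsDomain (R m)] : IsDomain (UProd U R) := by
  have : Nontrivial (UProd U R) := by
    refine ⟨⟨0, 1, fun h => ?_⟩⟩
    rw [← map_zero (mk U), ← map_one (mk U), mk_eq_mk] at h
    obtain ⟨m, hm⟩ := h.exists
    exact zero_ne_one hm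
  have : NoZeroDivisors (UProd U R) := by
    refine ⟨fun {x y} h => ?_⟩
    obtain ⟨a, rfl⟩ := mk_surjective x
    obtain ⟨b, rfl⟩ := mk_surjective y
    rw [← map_mul, mk_eq_zero] at h
    rw [mk_eq_zero, mk_eq_zero, ← Ultrafilter.eventually_or]
    filter_upwards [h] with m hm
    exact mul_eq_zero.mp hm
  exact NoZeroDivisors.to_isDomain _

theorem isField (K : ℕ → Type u) [∀ m, Field (K m)] : IsField (UProd U K) where
  exists_pair_ne := ⟨0, 1, zero_ne_one⟩
  mul_comm := mul_comm
  mul_inv_cancel := by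
    intro x hx
    obtain ⟨a, rfl⟩ := mk_surjective x
    refine ⟨mk U fun m => (a m)⁻¹, ?_⟩
    rw [← map_mul, ← map_one (mk U), mk_eq_mk]
    rw [Ne, mk_eq_zero, ← Ultrafilter.eventually_not] at hx
    filter_upwards [hx] with m hm
    exact mul_inv_cancel₀ hm

noncomputable instance (K : ℕ → Type u) [∀ m, Field (K m)] : Field (UProd U K) :=
  (isField K).toField

end UProd

end Ultraproduct

section Ultraproduct

namespace UProd

variable {U : Ultrafilter ℕ} (K : ℕ → Type u) [∀ m, Field (K m)] (N : ℕ → ℕ)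

/-- The sequence of polynomial rings in `N m` variables over `K m`. -/
abbrev Poly (m : ℕ) : Type u := MvPolynomial (Fin (N m)) (K m)

noncomputable instance : Algebra (UProd U K) (UProd U (Poly K N)) :=
  (map fun m => (C : K m →+* Poly K N m)).toAlgebra

variable {K N}

theorem algebraMap_mk (c : ∀ m, K m) :
    algebraMap (UProd U K) (UProd U (Poly K N)) (mk U c) = mk U fun m => C (c m) :=
  map_mk _ _

theorem mk_smul_mk (c : ∀ m, K m) (a : ∀ m, Poly K N m) :
    (mk U c : UProd U K) • (mk U a : UProd U (Poly K N)) = mk U fun m => c m • a m := by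
  rw [Algebra.smul_def, algebraMap_mk, ← map_mul]
  congr 1
  ext1 m
  exact (smul_eq_C_mul _ _).symm

variable (U K N) in
/-- The classes of the sequences of homogeneous polynomials of degree `n`. -/
noncomputable def homog (n : ℕ) : Submodule (UProd U K) (UProd U (Poly K N)) where
  carrier := {x | ∃ a : ∀ m, Poly K N m, (∀ m, IsHomogeneous (a m) n) ∧ mk U a = x}
  add_mem' := by
    rintro _ _ ⟨a, ha, rfl⟩ ⟨b, hb, rfl⟩
    exact ⟨a + b, fun m => (ha m).add (hb m), map_add _ _ _⟩
  zero_mem' := ⟨0, fun m => isHomogeneous_zero _ _ _, map_zero _⟩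
  smul_mem' := by
    rintro c _ ⟨a, ha, rfl⟩
    obtain ⟨c, rfl⟩ := mk_surjective c
    exact ⟨fun m => c m • a m, fun m => (homogeneousSubmodule _ _ n).smul_mem _ (ha m),
      (mk_smul_mk c a).symm⟩

theorem mk_mem_homog {a : ∀ m, Poly K N m} {n : ℕ} (ha : ∀ᶠ m in U, IsHomogeneous (a m) n) :
    mk U a ∈ homog U K N n := by
  refine ⟨fun m => homogeneousComponent n (a m), fun m => homogeneousComponent_isHomogeneous n _, ?_⟩
  rw [mk_eq_mk]
  filter_upwards [ha] with m hm
  rw [homogeneousComponent_of_mem hm, if_pos rfl]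

instance : SetLike.GradedMonoid (homog U K N) where
  one_mem := ⟨1, fun m => isHomogeneous_one _ _, map_one _⟩
  mul_mem := by
    rintro i j _ _ ⟨a, ha, rfl⟩ ⟨b, hb, rfl⟩
    exact ⟨a * b, fun m => (ha m).mul (hb m), map_mul _ _ _⟩

theorem exists_eq_algebraMap_of_mem_homog_zero {x : UProd U (Poly K N)} (hx : x ∈ homog U K N 0) :
    ∃ c, x = algebraMap (UProd U K) _ c := by
  obtain ⟨a, ha, rfl⟩ := hx
  refine ⟨mk U fun m => coeff 0 (a m), ?_⟩
  rw [algebraMap_mk]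
  congr 1
  ext1 m
  exact eq_C_of_isWeightedHomogeneous_zero (fun _ => Nat.one_pos) (ha m)

/-- Homogeneous components on the ultraproduct. -/
noncomputable def comp (n : ℕ) : UProd U (Poly K N) →ₗ[UProd U K] UProd U (Poly K N) where
  toFun := lift fun m => homogeneousComponent n
  map_add' x y := by
    obtain ⟨a, rfl⟩ := mk_surjective x
    obtain ⟨b, rfl⟩ := mk_surjective y
    rw [← map_add, lift_mk, lift_mk, lift_mk, ← map_add]
    congr 1
    ext1 m
    exact map_add _ _ _
  map_smul' c x := by
    obtain ⟨a, rfl⟩ := mk_surjective x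
    obtain ⟨c, rfl⟩ := mk_surjective c
    rw [mk_smul_mk, lift_mk, lift_mk, RingHom.id_apply, mk_smul_mk]
    congr 1
    ext1 m
    exact map_smul _ _ _

theorem comp_mk (n : ℕ) (a : ∀ m, Poly K N m) :
    comp n (mk U a) = mk U fun m => homogeneousComponent n (a m) :=
  lift_mk _ _

theorem comp_of_mem {n k : ℕ} {x : UProd U (Poly K N)} (hx : x ∈ homog U K N n) :
    comp k x = if k = n then x else 0 := by
  obtain ⟨a, ha, rfl⟩ := hx
  rw [comp_mk]
  split_ifs with h
  · congr 1
    ext1 m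
    rw [homogeneousComponent_of_mem (ha m), if_pos h]
  · rw [mk_eq_zero]
    refine .of_forall fun m => ?_
    rw [homogeneousComponent_of_mem (ha m), if_neg h]

/-- The translation by a sequence of vectors. -/
noncomputable def translate (v : ∀ m, Fin (N m) → K m) :
    UProd U (Poly K N) →ₐ[UProd U K] UProd U (Poly K N) where
  __ := map fun m => ((aeval fun i => X i + C (v m i) : Poly K N m →ₐ[K m] Poly K N m) :
    Poly K N m →+* Poly K N m)
  commutes' c := by
    obtain ⟨c, rfl⟩ := mk_surjective c
    change map _ _ = _
    rw [algebraMap_mk, map_mk]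
    congr 1
    ext1 m
    simp

theorem translate_mk (v : ∀ m, Fin (N m) → K m) (a : ∀ m, Poly K N m) :
    translate v (mk U a) = mk U fun m => aeval (fun i => X i + C (v m i)) (a m) :=
  map_mk _ _

/-- The directional derivative along a sequence of vectors. -/
noncomputable def directional (v : ∀ m, Fin (N m) → K m) :
    Derivation (UProd U K) (UProd U (Poly K N)) (UProd U (Poly K N)) :=
  Derivation.mk'
    { toFun := lift fun m => mkDerivation (K m) fun i => (C (v m i) : Poly K N m)
      map_add' := fun x y => by
        obtain ⟨a, rfl⟩ := mk_surjective x
        obtain ⟨b, rfl⟩ := mk_surjective y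
        rw [← map_add, lift_mk, lift_mk, lift_mk, ← map_add]
        congr 1
        ext1 m
        exact map_add _ _ _
      map_smul' := fun c x => by
        obtain ⟨a, rfl⟩ := mk_surjective x
        obtain ⟨c, rfl⟩ := mk_surjective c
        rw [mk_smul_mk, lift_mk, lift_mk, RingHom.id_apply, mk_smul_mk]
        congr 1
        ext1 m
        exact Derivation.map_smul _ _ _ } fun x y => by
    obtain ⟨a, rfl⟩ := mk_surjective x
    obtain ⟨b, rfl⟩ := mk_surjective y
    change lift _ _ = mk U a * lift _ _ + mk U b * lift _ _
    rw [← map_mul, lift_mk, lift_mk, lift_mk, ← map_mul, ← map_mul, ← map_add]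
    congr 1
    ext1 m
    exact Derivation.leibniz _ _ _

theorem directional_mk (v : ∀ m, Fin (N m) → K m) (a : ∀ m, Poly K N m) :
    directional v (mk U a) =
      mk U fun m => mkDerivation (K m) (fun i => (C (v m i) : Poly K N m)) (a m) :=
  lift_mk _ _

end UProd

end Ultraproduct

section

theorem sum_range_weightedHomogeneousComponent {σ R : Type*} [CommRing R] {w : σ → ℕ}
    {g : MvPolynomial σ R} {n : ℕ} (h : ∀ α ∈ g.support, Finsupp.weight w α < n) :
    ∑ k ∈ Finset.range n, weightedHomogeneousComponent w k g = g := by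
  classical
  ext α
  rw [coeff_sum]
  simp only [coeff_weightedHomogeneousComponent]
  rw [Finset.sum_ite_eq]
  split_ifs with hα
  · rfl
  · by_contra h'
    exact hα (Finset.mem_range.mpr (h α (mem_support_iff.mpr (Ne.symm h'))))

theorem eval_zero_aeval_X_add_C {σ R : Type*} [CommRing R] (v : σ → R) (a : MvPolynomial σ R) :
    eval 0 (aeval (fun i => X i + C (v i)) a : MvPolynomial σ R) = eval v a := by
  induction a using MvPolynomial.induction_on with
  | C c => simp
  | add p q hp hq => rw [map_add, map_add, map_add, hp, hq]
  | mul_X p i hp => rw [map_mul, map_mul, map_mul, hp, aeval_X, map_add, eval_X, eval_X, eval_C,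
      Pi.zero_apply, zero_add]

theorem charP_of_prime_of_cast_eq_zero {K : Type*} [Field K] {p : ℕ} (hp : p.Prime)
    (h : (p : K) = 0) : CharP K p := by
  obtain ⟨q, hq⟩ := CharP.exists K
  have hqp := (CharP.cast_eq_zero_iff K q p).mp h
  rcases (Nat.dvd_prime hp).mp hqp with rfl | rfl
  · exact absurd rfl (CharP.char_ne_one K 1)
  · exact hq

variable {σ K : Type*} [Field K]

theorem dvd_of_pderiv_eq_zero (p : ℕ) [CharP K p] {a : MvPolynomial σ K}
    (h : ∀ i, pderiv i a = 0) : ∀ α ∈ a.support, ∀ i, p ∣ α i := by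
  classical
  intro α hα i
  by_contra hp
  have hi : α i ≠ 0 := fun h0 => hp (h0 ▸ dvd_zero p)
  have h1 := congrArg (coeff (α - Finsupp.single i 1)) (h i)
  rw [a.as_sum, map_sum, coeff_sum, Finset.sum_eq_single α] at h1
  · rw [pderiv_monomial, coeff_monomial, if_pos rfl, coeff_zero, mul_eq_zero,
      CharP.cast_eq_zero_iff K p] at h1
    exact h1.elim (mem_support_iff.mp hα) hp
  · intro β _ hβ
    rw [pderiv_monomial, coeff_monomial]
    split_ifs with h2
    · by_cases hβi : β i = 0
      · simp [hβi]
      · exfalso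
        apply hβ
        have h3 : ∀ γ : σ →₀ ℕ, γ i ≠ 0 → γ = (γ - Finsupp.single i 1) + Finsupp.single i 1 := by
          intro γ hγ
          rw [tsub_add_cancel_of_le]
          rw [Finsupp.single_le_iff]
          exact Nat.one_le_iff_ne_zero.mpr hγ
        rw [h3 β hβi, h3 α hi, h2]
    · rfl
  · intro h; exact absurd hα h

theorem exists_pow_eq_of_pderiv_eq_zero {p : ℕ} (hp : p.Prime) [CharP K p]
    (hperf : ∀ c : K, ∃ b, b ^ p = c) {a : MvPolynomial σ K} {n : ℕ} (ha : a.IsHomogeneous n)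
    (h : ∀ i, pderiv i a = 0) : ∃ b, IsHomogeneous b (n / p) ∧ b ^ p = a := by
  have := Fact.mk hp
  obtain ⟨g, rfl⟩ := (mem_range_expand_iff p a).mpr (dvd_of_pderiv_eq_zero p h)
  obtain ⟨F, rfl⟩ := map_surjective (frobenius K p) hperf g
  change IsHomogeneous (expand p (map (frobenius K p) F)) n at ha
  refine ⟨F, ?_, ?_⟩
  · intro β hβ
    have h1 : coeff (p • β) (expand p (map (frobenius K p) F)) ≠ 0 := by
      rw [coeff_expand_smul _ hp.ne_zero, coeff_map]
      simpa [frobenius_def, hp.ne_zero] using hβ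
    have := ha h1
    rw [map_nsmul, smul_eq_mul] at this
    rw [← this, Nat.mul_div_cancel_left _ hp.pos]
  · change _ = expand p (map (frobenius K p) F)
    rw [← map_frobenius_expand, map_expand]

theorem exists_eval_ne_zero [Infinite K] {a : MvPolynomial σ K} (ha : a ≠ 0) :
    ∃ v, eval v a ≠ 0 := by
  by_contra h
  push Not at h
  exact ha (MvPolynomial.funext fun v => by rw [h v, map_zero])

theorem eval_zero_of_isHomogeneous {a : MvPolynomial σ K} {n : ℕ} (hn : 0 < n)
    (ha : a.IsHomogeneous n) : eval 0 a = 0 := by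
  have h1 := ha.coeff_eq_zero (d := 0) (by simpa using hn.ne)
  rwa [← constantCoeff_eq, ← eval_zero] at h1

end

section Ultraproduct

namespace UProd

variable {U : Ultrafilter ℕ} {K : ℕ → Type u} [∀ m, Field (K m)] {N : ℕ → ℕ}

theorem translate_of_mem_homog (v : ∀ m, Fin (N m) → K m) (n : ℕ) {x : UProd U (Poly K N)}
    (hx : x ∈ homog U K N n) : ∃ z : ℕ → UProd U (Poly K N), (∀ k, z k ∈ homog U K N k) ∧
      translate v x = x + ∑ k ∈ Finset.range n, z k := by
  obtain ⟨a, ha, rfl⟩ := hx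
  set b : ∀ m, Poly K N m := fun m => aeval (fun i => X i + C (v m i)) (a m) - a m with hb
  refine ⟨fun k => mk U fun m => homogeneousComponent k (b m), fun k => mk_mem_homog <|
    .of_forall fun m => homogeneousComponent_isHomogeneous k _, ?_⟩
  rw [translate_mk, ← map_sum, ← map_add]
  congr 1
  ext1 m
  rw [Pi.add_apply, Finset.sum_apply]
  have := sum_range_weightedHomogeneousComponent (g := b m) (n := n) <|
    weight_lt_of_mem_support_sub (w := 1) (Φ := aeval (fun i => X i + C (v m i))) (fun e α hα => by
      rw [aeval_X, add_sub_cancel_left] at hα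
      rw [Finset.mem_singleton.mp (support_monomial_subset hα)]
      simp) (ha m)
  change _ = a m + ∑ k ∈ Finset.range n, weightedHomogeneousComponent 1 k (b m)
  rw [this, hb]
  ring

theorem eq_zero_of_translate_eq [∀ m, Infinite (K m)] {n : ℕ} (hn : 0 < n)
    {x : UProd U (Poly K N)} (hx : x ∈ homog U K N n) (h : ∀ v, translate v x = x) : x = 0 := by
  classical
  obtain ⟨a, ha, rfl⟩ := hx
  have h1 : ∀ m, ∃ v, a m ≠ 0 → eval v (a m) ≠ 0 := by
    intro m
    by_cases h : a m = 0
    · exact ⟨0, fun h' => absurd h h'⟩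
    · obtain ⟨v, hv⟩ := exists_eval_ne_zero h
      exact ⟨v, fun _ => hv⟩
  choose v hv using h1
  have h2 := h v
  rw [translate_mk, mk_eq_mk] at h2
  rw [mk_eq_zero]
  filter_upwards [h2] with m hm
  by_contra h0
  apply hv m h0
  have h3 := congrArg (eval 0) hm
  rw [eval_zero_of_isHomogeneous hn (ha m)] at h3
  rw [← h3]
  exact (eval_zero_aeval_X_add_C _ _).symm

theorem directional_mem_homog (v : ∀ m, Fin (N m) → K m) {n : ℕ} {x : UProd U (Poly K N)}
    (hx : x ∈ homog U K N (n + 1)) : directional v x ∈ homog U K N n := by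
  obtain ⟨a, ha, rfl⟩ := hx
  rw [directional_mk]
  exact mk_mem_homog <| .of_forall fun m => isWeightedHomogeneous_mkDerivation (w := 1)
    (fun e => ⟨0, rfl, isHomogeneous_C _ _⟩) (ha m)

theorem eventually_pderiv_eq_zero {x : ∀ m, Poly K N m} (h : ∀ v, directional v (mk U x) = 0) :
    ∀ᶠ m in U, ∀ i, pderiv i (x m) = 0 := by
  classical
  have h1 : ∀ m, ∃ v : Fin (N m) → K m, mkDerivation (K m) (fun i => (C (v i) : Poly K N m)) (x m) = 0 →
      ∀ i, pderiv i (x m) = 0 := by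
    intro m
    by_cases hm : ∀ i, pderiv i (x m) = 0
    · exact ⟨0, fun _ => hm⟩
    · push Not at hm
      obtain ⟨i, hi⟩ := hm
      refine ⟨Pi.single i 1, fun h => absurd ?_ hi⟩
      rw [← h, pderiv]
      congr 2
      ext1 j
      by_cases hj : j = i
      · subst hj; simp
      · simp [hj]
  choose v hv using h1
  have h2 := h v
  rw [directional_mk, mk_eq_zero] at h2
  filter_upwards [h2] with m hm
  exact hv m hm

theorem natCast_eq_zero_iff {n : ℕ} : (n : UProd U K) = 0 ↔ ∀ᶠ m in U, (n : K m) = 0 := by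
  rw [← map_natCast (mk U), mk_eq_zero]
  rfl

theorem mem_decomposables_of_directional_eq_zero [∀ m, IsAlgClosed (K m)] {n : ℕ} (hn : 0 < n)
    {x : UProd U (Poly K N)} (hx : x ∈ homog U K N n) (h : ∀ v, directional v x = 0) :
    x ∈ decomposables (homog U K N) n := by
  classical
  obtain ⟨a, ha, rfl⟩ := hx
  have h1 := eventually_pderiv_eq_zero h
  obtain ⟨p, hp⟩ := CharP.exists (UProd U K)
  by_cases hpn : p ∣ n
  swap
  · have h2 : (n : UProd U K) ≠ 0 := by rwa [Ne, CharP.cast_eq_zero_iff (UProd U K) p]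
    rw [Ne, natCast_eq_zero_iff, ← Ultrafilter.eventually_not] at h2
    convert Submodule.zero_mem _
    rw [mk_eq_zero]
    filter_upwards [h1, h2] with m h1 h2
    have h3 := (ha m).sum_X_mul_pderiv
    simp only [h1, mul_zero, Finset.sum_const_zero] at h3
    rw [← Nat.cast_smul_eq_nsmul (K m)] at h3
    exact (smul_eq_zero.mp h3.symm).resolve_left h2
  rcases CharP.char_is_prime_or_zero (UProd U K) p with hp' | rfl
  swap
  · rw [zero_dvd_iff] at hpn; omega
  obtain ⟨k, rfl⟩ := hpn
  have h2 : ∀ᶠ m in U, (p : K m) = 0 := natCast_eq_zero_iff.mp (CharP.cast_eq_zero _ p)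
  have h3 : ∀ m, ∃ b : Poly K N m, ((p : K m) = 0 → (∀ i, pderiv i (a m) = 0) →
      b.IsHomogeneous k ∧ b ^ p = a m) := by
    intro m
    by_cases hm : (p : K m) = 0 ∧ ∀ i, pderiv i (a m) = 0
    · have : CharP (K m) p := charP_of_prime_of_cast_eq_zero hp' hm.1
      obtain ⟨b, hb⟩ := exists_pow_eq_of_pderiv_eq_zero hp'
        (fun c => IsAlgClosed.exists_pow_nat_eq c hp'.pos) (ha m) hm.2
      rw [Nat.mul_div_cancel_left _ hp'.pos] at hb
      exact ⟨b, fun _ _ => hb⟩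
    · exact ⟨0, fun h h' => absurd ⟨h, h'⟩ hm⟩
  choose b hb using h3
  have hbk : mk U b ∈ homog U K N k := mk_mem_homog <| by
    filter_upwards [h1, h2] with m h1 h2
    exact (hb m h2 h1).1
  obtain ⟨q, rfl⟩ : ∃ q, p = q + 1 := ⟨p - 1, by have := hp'.pos; omega⟩
  have hq : 0 < q := by have := hp'.two_le; omega
  have hk : 0 < k := Nat.pos_of_mul_pos_left hn
  refine Submodule.subset_span ⟨k, q * k, hk, Nat.mul_pos hq hk, by ring, mk U b, hbk,
    mk U b ^ q, by simpa using SetLike.pow_mem_graded q hbk, ?_⟩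
  rw [← pow_succ', ← map_pow, mk_eq_mk]
  filter_upwards [h1, h2] with m h1 h2
  exact (hb m h2 h1).2.symm

theorem exists_polynomial_generators [∀ m, IsAlgClosed (K m)] :
    ∃ (E : Type u) (w : E → ℕ) (y : E → UProd U (Poly K N)), (∀ e, 0 < w e) ∧
      (∀ e, y e ∈ homog U K N (w e)) ∧
      (∀ n f, IsWeightedHomogeneous w f n → aeval y f = 0 → f = (0 : MvPolynomial E (UProd U K))) ∧
      ∀ n, ∀ x ∈ homog U K N n, ∃ f : MvPolynomial E (UProd U K),
        IsWeightedHomogeneous w f n ∧ aeval y f = x := by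
  obtain ⟨p, hp⟩ := CharP.exists (UProd U K)
  have : ∀ m, Infinite (K m) := fun m => IsAlgClosed.instInfinite
  refine _root_.exists_polynomial_generators p ?_ (fun x => exists_eq_algebraMap_of_mem_homog_zero)
    comp (fun n x hx => by rw [comp_of_mem hx, if_pos rfl])
    (fun n k hk x hx => by rw [comp_of_mem hx, if_neg hk])
    (Set.range translate) ?_ ?_ (Set.range directional) ?_ ?_
  · intro h c
    obtain ⟨c, rfl⟩ := mk_surjective c
    choose b hb using fun m => IsAlgClosed.exists_pow_nat_eq (c m) (Nat.pos_of_ne_zero h)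
    refine ⟨mk U b, ?_⟩
    rw [← map_pow]
    congr 1
    ext1 m
    exact hb m
  · rintro _ ⟨v, rfl⟩ n x hx
    exact translate_of_mem_homog v n hx
  · intro n hn x hx h
    exact eq_zero_of_translate_eq hn hx fun v => h _ ⟨v, rfl⟩
  · rintro _ ⟨v, rfl⟩ n x hx
    exact directional_mem_homog v hx
  · intro n hn x hx h
    exact mem_decomposables_of_directional_eq_zero hn hx fun v => h _ ⟨v, rfl⟩

end UProd

end Ultraproduct

section

variable {σ R : Type*} [CommRing R]

theorem weightedHomogeneousComponent_mul_eq {w : σ → ℕ} {a : MvPolynomial σ R} {k : ℕ}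
    (ha : IsWeightedHomogeneous w a k) (b : MvPolynomial σ R) (n : ℕ) :
    weightedHomogeneousComponent w n (a * b) =
      if k ≤ n then a * weightedHomogeneousComponent w (n - k) b else 0 := by
  classical
  obtain ⟨M, hM⟩ : ∃ M, ∀ α ∈ b.support, Finsupp.weight w α < M := by
    refine ⟨b.support.sup (Finsupp.weight w) + 1, fun α hα => Nat.lt_succ_of_le ?_⟩
    exact Finset.le_sup (f := Finsupp.weight w) hα
  have h1 : ∀ i, weightedHomogeneousComponent w n (a * weightedHomogeneousComponent w i b) =
      if k + i = n then a * weightedHomogeneousComponent w i b else 0 := by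
    intro i
    have := ha.mul (weightedHomogeneousComponent_isWeightedHomogeneous (w := w) i b)
    split_ifs with h
    · rw [h] at this
      exact this.weightedHomogeneousComponent_same
    · exact this.weightedHomogeneousComponent_ne _ (fun h' => h h'.symm)
  conv_lhs => rw [← sum_range_weightedHomogeneousComponent hM, Finset.mul_sum, map_sum]
  simp only [h1]
  split_ifs with h
  · have h2 : ∀ i, (k + i = n) ↔ (i = n - k) := fun i => by omega
    simp only [h2]
    rw [Finset.sum_ite_eq']
    split_ifs with h3
    · rfl
    · rw [eq_comm]
      convert mul_zero a using 2
      ext α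
      rw [coeff_weightedHomogeneousComponent, coeff_zero]
      split_ifs with h4
      · by_contra h5
        exact h3 (h4 ▸ Finset.mem_range.mpr (hM α (mem_support_iff.mpr h5)))
      · rfl
  · exact Finset.sum_eq_zero fun i _ => if_neg (by omega)

theorem exists_homogeneous_coeffs {ι : Type*} {w : σ → ℕ} {s : Finset ι}
    {v : ι → MvPolynomial σ R} {u : ι → ℕ} (hv : ∀ i, IsWeightedHomogeneous w (v i) (u i))
    {x : MvPolynomial σ R} {n : ℕ} (hx : IsWeightedHomogeneous w x n)
    (h : x ∈ Ideal.span (v '' s)) :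
    ∃ g : ι → MvPolynomial σ R, x = ∑ i ∈ s, v i * g i ∧
      ∀ i, g i = 0 ∨ ∃ k, u i + k = n ∧ IsWeightedHomogeneous w (g i) k := by
  obtain ⟨c, hc⟩ := (Submodule.mem_span_image_finset_iff_exists_fun' _).mp h
  refine ⟨fun i => if u i ≤ n then weightedHomogeneousComponent w (n - u i) (c i) else 0, ?_, ?_⟩
  · rw [← hx.weightedHomogeneousComponent_same, ← hc, map_sum]
    refine Finset.sum_congr rfl fun i _ => ?_
    rw [smul_eq_mul, mul_comm, weightedHomogeneousComponent_mul_eq (hv i)]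
    dsimp only
    split_ifs with h
    · rfl
    · rw [mul_zero]
  · intro i
    dsimp only
    split_ifs with h
    · exact Or.inr ⟨n - u i, by omega, weightedHomogeneousComponent_isWeightedHomogeneous _ _⟩
    · exact Or.inl rfl

/-- `y k` is a nonzerodivisor modulo the previous `y i`, as far as homogeneous polynomials of
degree at most `D` are concerned. -/
def RegUpTo {r : ℕ} (D : ℕ) (y : Fin r → MvPolynomial σ R) : Prop :=
  ∀ k, ∀ n ≤ D, ∀ h, IsHomogeneous h n →
    y k * h ∈ Ideal.span (y '' (Finset.Iio k : Finset (Fin r))) →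
    h ∈ Ideal.span (y '' (Finset.Iio k : Finset (Fin r)))

end

section Ultraproduct

namespace UProd

variable {U : Ultrafilter ℕ} {K : ℕ → Type u} [∀ m, Field (K m)] {N : ℕ → ℕ}

theorem eventually_regUpTo {E : Type u} {w : E → ℕ} {y : E → UProd U (Poly K N)}
    (hinj : ∀ n f, IsWeightedHomogeneous w f n → aeval y f = 0 →
      f = (0 : MvPolynomial E (UProd U K)))
    (hsurj : ∀ n, ∀ x ∈ homog U K N n, ∃ f : MvPolynomial E (UProd U K),
        IsWeightedHomogeneous w f n ∧ aeval y f = x)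
    {r : ℕ} {e : Fin r → E} (he : Function.Injective e) {v : ∀ m, Fin r → Poly K N m}
    (hv : ∀ m i, IsHomogeneous (v m i) (w (e i))) (hvy : ∀ i, (mk U fun m => v m i) = y (e i))
    (D : ℕ) : ∀ᶠ m in U, RegUpTo D (v m) := by
  classical
  have key : ∀ (k : Fin r) (n : ℕ), ∀ᶠ m in U, ∀ h, IsHomogeneous h n →
      v m k * h ∈ Ideal.span (v m '' (Finset.Iio k : Finset (Fin r))) →
      h ∈ Ideal.span (v m '' (Finset.Iio k : Finset (Fin r))) := by
    intro k n
    have h1 : ∀ m, ∃ h : Poly K N m, IsHomogeneous h n ∧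
        v m k * h ∈ Ideal.span (v m '' (Finset.Iio k : Finset (Fin r))) ∧
        (h ∈ Ideal.span (v m '' (Finset.Iio k : Finset (Fin r))) → ∀ h, IsHomogeneous h n →
          v m k * h ∈ Ideal.span (v m '' (Finset.Iio k : Finset (Fin r))) →
          h ∈ Ideal.span (v m '' (Finset.Iio k : Finset (Fin r)))) := by
      intro m
      by_cases h : ∀ h, IsHomogeneous h n →
          v m k * h ∈ Ideal.span (v m '' (Finset.Iio k : Finset (Fin r))) →
          h ∈ Ideal.span (v m '' (Finset.Iio k : Finset (Fin r)))
      · exact ⟨0, isHomogeneous_zero _ _ _, by simp, fun _ => h⟩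
      · push Not at h
        obtain ⟨h, ha, hb, hc⟩ := h
        exact ⟨h, ha, hb, fun h' => absurd h' hc⟩
    choose h hhom hmem hin using h1
    obtain ⟨H, hH, hHh⟩ := hsurj n (mk U h) ⟨h, hhom, rfl⟩
    have h2 := fun m => exists_homogeneous_coeffs (hv m) ((hv m k).mul (hhom m)) (hmem m)
    choose g hg hg' using h2
    have h3 : ∀ i, ∃ G : MvPolynomial E (UProd U K), aeval y G = mk U (fun m => g m i) ∧
        IsWeightedHomogeneous w (X (e i) * G) (w (e k) + n) := by
      intro i
      by_cases hi : w (e i) ≤ w (e k) + n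
      · obtain ⟨G, hG, hGg⟩ := hsurj (w (e k) + n - w (e i)) (mk U fun m => g m i) <| by
          refine mk_mem_homog <| .of_forall fun m => ?_
          rcases hg' m i with h0 | ⟨k', hk', h0⟩
          · rw [h0]; exact isHomogeneous_zero _ _ _
          · rwa [← hk', Nat.add_sub_cancel_left]
        refine ⟨G, hGg, ?_⟩
        have := (isWeightedHomogeneous_X (UProd U K) w (e i)).mul hG
        rwa [Nat.add_sub_cancel' hi] at this
      · refine ⟨0, ?_, ?_⟩
        · rw [map_zero, eq_comm, mk_eq_zero]
          refine .of_forall fun m => ?_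
          rcases hg' m i with h0 | ⟨k', hk', h0⟩
          · exact h0
          · omega
        · rw [mul_zero]; exact isWeightedHomogeneous_zero _ _ _
    choose G hG hGhom using h3
    have h4 : X (e k) * H - ∑ i ∈ Finset.Iio k, X (e i) * G i = 0 := by
      refine hinj (w (e k) + n) _ (((isWeightedHomogeneous_X _ w (e k)).mul hH).sub
        (IsWeightedHomogeneous.sum _ _ _ fun i _ => hGhom i)) ?_
      rw [map_sub, map_mul, map_sum, aeval_X, hHh, ← hvy, ← map_mul, sub_eq_zero]
      simp only [map_mul, aeval_X, hG, ← hvy]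
      simp only [← map_mul, ← map_sum]
      congr 1
      ext1 m
      rw [Finset.sum_apply]
      exact hg m
    have h5 : H ∈ Ideal.span (X '' (e '' (Finset.Iio k : Finset (Fin r))) :
        Set (MvPolynomial E (UProd U K))) := by
      rw [mem_ideal_span_X_image]
      intro α hα
      have h6 : X (e k) * H ∈ Ideal.span (X '' (e '' (Finset.Iio k : Finset (Fin r))) :
          Set (MvPolynomial E (UProd U K))) := by
        rw [sub_eq_zero.mp h4]
        exact Ideal.sum_mem _ fun i hi => Ideal.mul_mem_right _ _ <|
          Ideal.subset_span ⟨_, ⟨i, hi, rfl⟩, rfl⟩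
      rw [mem_ideal_span_X_image] at h6
      obtain ⟨_, ⟨i, hi, rfl⟩, hne⟩ := h6 (Finsupp.single (e k) 1 + α) <| by
        rw [mem_support_iff, coeff_X_mul]
        exact mem_support_iff.mp hα
      refine ⟨e i, ⟨i, hi, rfl⟩, ?_⟩
      rw [Finsupp.add_apply, Finsupp.single_apply, if_neg, zero_add] at hne
      · exact hne
      · intro h
        exact (Finset.mem_Iio.mp hi).ne (he h).symm
    rw [← Set.image_comp] at h5
    obtain ⟨c, hc⟩ := (Submodule.mem_span_image_finset_iff_exists_fun' _).mp h5
    have h6 : mk U h = mk U fun m => ∑ i ∈ Finset.Iio k, rep (aeval y (c i)) m * v m i := by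
      rw [← hHh, ← hc, map_sum]
      have : (fun m => ∑ i ∈ Finset.Iio k, rep (aeval y (c i)) m * v m i) =
          ∑ i ∈ Finset.Iio k, rep (aeval y (c i)) * fun m => v m i := by
        ext1 m
        rw [Finset.sum_apply]
        rfl
      rw [this, map_sum]
      refine Finset.sum_congr rfl fun i _ => ?_
      rw [map_mul, mk_rep, hvy, smul_eq_mul, map_mul, Function.comp_apply, aeval_X]
    rw [mk_eq_mk] at h6
    filter_upwards [h6] with m hm
    refine hin m ?_
    rw [hm]
    exact Ideal.sum_mem _ fun i hi => Ideal.mul_mem_left _ _ (Ideal.subset_span ⟨i, hi, rfl⟩)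
  have h2 : ∀ᶠ m in U, ∀ (k : Fin r) (n : Fin (D + 1)), ∀ h, IsHomogeneous h n →
      v m k * h ∈ Ideal.span (v m '' (Finset.Iio k : Finset (Fin r))) →
      h ∈ Ideal.span (v m '' (Finset.Iio k : Finset (Fin r))) :=
    Filter.eventually_all.mpr fun k => Filter.eventually_all.mpr fun n => key k n
  filter_upwards [h2] with m hm k n hn
  exact hm k ⟨n, Nat.lt_succ_of_le hn⟩

theorem exists_regUpTo [∀ m, IsAlgClosed (K m)] {n d : ℕ} (f : ∀ m, Fin n → Poly K N m)
    (hf : ∀ m i, (f m i).totalDegree ≤ d) :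
    ∃ (r : ℕ) (w : Fin r → ℕ) (y : ∀ m, Fin r → Poly K N m)
      (F : Fin n → MvPolynomial (Fin r) (UProd U K)), (∀ i, 0 < w i) ∧
      (∀ m i, IsHomogeneous (y m i) (w i)) ∧ (∀ D, ∀ᶠ m in U, RegUpTo D (y m)) ∧
      ∀ i, aeval (fun j => mk U fun m => y m j) (F i) = mk U fun m => f m i := by
  classical
  obtain ⟨E, w, y, hw, hy, hinj, hsurj⟩ := exists_polynomial_generators (U := U) (K := K) (N := N)
  have h1 : ∀ i, ∃ G : MvPolynomial E (UProd U K), aeval y G = mk U fun m => f m i := by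
    intro i
    have h2 : ∀ k, ∃ G : MvPolynomial E (UProd U K), aeval y G =
        mk U fun m => homogeneousComponent k (f m i) := fun k => by
      obtain ⟨G, -, hG⟩ := hsurj k _ (mk_mem_homog (U := U) (.of_forall fun m =>
        homogeneousComponent_isHomogeneous k (f m i)))
      exact ⟨G, hG⟩
    choose G hG using h2
    refine ⟨∑ k ∈ Finset.range (d + 1), G k, ?_⟩
    rw [map_sum]
    simp only [hG]
    rw [← map_sum]
    congr 1
    ext1 m
    rw [Finset.sum_apply]
    refine sum_range_weightedHomogeneousComponent fun α hα => Nat.lt_succ_of_le ?_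
    refine le_trans ?_ (hf m i)
    have := le_totalDegree hα
    rw [Pi.one_def, ← Finsupp.degree_eq_weight_one]
    exact this
  choose G hG using h1
  set s : Finset E := Finset.univ.biUnion fun i => (G i).vars
  set e : Fin s.card → E := fun j => s.equivFin.symm j with he
  have heinj : Function.Injective e := Subtype.val_injective.comp s.equivFin.symm.injective
  have h2 : ∀ i, ∃ F : MvPolynomial (Fin s.card) (UProd U K), rename e F = G i := by
    intro i
    refine exists_rename_eq_of_vars_subset_range _ _ heinj fun x hx => ?_
    have : x ∈ s := Finset.mem_biUnion.mpr ⟨i, Finset.mem_univ _, hx⟩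
    exact ⟨s.equivFin ⟨x, this⟩, by simp [he]⟩
  choose F hF using h2
  choose v hv hvy using fun j => hy (e j)
  refine ⟨s.card, w ∘ e, fun m j => v j m, F, fun i => hw _, fun m i => hv i m,
    eventually_regUpTo hinj hsurj heinj (fun m i => hv i m) hvy, fun i => ?_⟩
  rw [← hG, ← hF, aeval_rename]
  congr 2
  ext1 j
  exact hvy j

end UProd

end Ultraproduct

section FreeBasis

variable (K : Type*) {R : Type*} [Field K] [CommRing R] [Algebra K R] {ι ι' κ : Type*}

/-- The monomial with exponent `α` in the elements `v i`. -/
noncomputable def mpow (v : ι → R) (α : ι →₀ ℕ) : R := α.prod fun i n => v i ^ n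

theorem mpow_zero (v : ι → R) : mpow v 0 = 1 := Finsupp.prod_zero_index

theorem mpow_add (v : ι → R) (α β : ι →₀ ℕ) : mpow v (α + β) = mpow v α * mpow v β :=
  Finsupp.prod_add_index' (fun _ => pow_zero _) fun _ _ _ => pow_add _ _ _

theorem mpow_single (v : ι → R) (i : ι) (n : ℕ) : mpow v (Finsupp.single i n) = v i ^ n :=
  Finsupp.prod_single_index (pow_zero _)

theorem mpow_sumElim (v : ι → R) (u : ι' → R) (α : (ι →₀ ℕ) × (ι' →₀ ℕ)) :
    mpow (Sum.elim v u) (Finsupp.sumFinsuppEquivProdFinsupp.symm α) =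
      mpow v α.1 * mpow u α.2 :=
  Finsupp.prod_sumElim _ _ _

theorem mpow_mem_span {v : ι → R} {α : ι →₀ ℕ} (h : α ≠ 0) :
    mpow v α ∈ Ideal.span (Set.range v) := by
  classical
  obtain ⟨i, hi⟩ := Finsupp.ne_iff.mp h
  have : α = Finsupp.single i 1 + (α - Finsupp.single i 1) := by
    rw [add_tsub_cancel_of_le]
    rw [Finsupp.single_le_iff]
    exact Nat.one_le_iff_ne_zero.mpr hi
  rw [this, mpow_add, mpow_single, pow_one]
  exact Ideal.mul_mem_right _ _ (Ideal.subset_span ⟨i, rfl⟩)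

/-- The products of the monomials in `v` with the elements of the family `b`. -/
noncomputable def monomialFamily (v : ι → R) (b : κ → R) (p : (ι →₀ ℕ) × κ) : R :=
  mpow v p.1 * b p.2

theorem monomialFamily_sumElim_comp (v : ι → R) (u : ι' → R) (b : κ → R) :
    monomialFamily (Sum.elim v u) b ∘ ((Equiv.prodAssoc _ _ _).symm.trans
      (Finsupp.sumFinsuppEquivProdFinsupp.symm.prodCongr (Equiv.refl κ))) =
      monomialFamily v (monomialFamily u b) := by
  ext ⟨α, β, k⟩
  simp only [Function.comp_apply, monomialFamily]
  rw [← mul_assoc, ← mpow_sumElim v u (α, β)]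
  rfl

/-- The products of the monomials in `v` with the elements of `b` form a basis. -/
structure IsFreeBasis (v : ι → R) (b : κ → R) : Prop where
  linearIndependent : LinearIndependent K (monomialFamily v b)
  span_eq_top : Submodule.span K (Set.range (monomialFamily v b)) = ⊤

/-- Linear independence modulo an ideal. -/
def LinIndepMod (J : Ideal R) (b : κ → R) : Prop :=
  ∀ (s : Finset κ) (g : κ → K), ∑ k ∈ s, g k • b k ∈ J → ∀ k ∈ s, g k = 0

/-- Families which are linearly independent modulo `v` remain independent over the monomials
in `v`. -/
def IsQuasiRegular (v : ι → R) : Prop :=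
  ∀ (κ : Type) (b : κ → R), LinIndepMod K (Ideal.span (Set.range v)) b →
    LinearIndependent K (monomialFamily v b)

variable {K}

theorem IsFreeBasis.mem_span_of_mem {v : ι → R} {b : κ → R} (h : IsFreeBasis K v b) {x : R}
    (hx : x ∈ Ideal.span (Set.range v)) :
    x ∈ Submodule.span K (monomialFamily v b '' {p | p.1 ≠ 0}) := by
  classical
  obtain ⟨c, rfl⟩ := Finsupp.mem_ideal_span_range_iff_exists_finsupp.mp hx
  refine Submodule.sum_mem _ fun i _ => ?_
  dsimp only
  generalize c i = r
  have hr : r ∈ Submodule.span K (Set.range (monomialFamily v b)) := by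
    rw [h.span_eq_top]; trivial
  induction hr using Submodule.span_induction with
  | mem r hr =>
    obtain ⟨⟨α, k⟩, rfl⟩ := hr
    refine Submodule.subset_span ⟨(Finsupp.single i 1 + α, k), ?_, ?_⟩
    · intro h0
      have := DFunLike.congr_fun h0 i
      simp at this
    · simp only [monomialFamily, mpow_add, mpow_single]
      ring
  | zero => simp
  | add a b _ _ ha hb => rw [add_mul]; exact Submodule.add_mem _ ha hb
  | smul c a _ ha => rw [smul_mul_assoc]; exact Submodule.smul_mem _ _ ha

theorem IsFreeBasis.linIndepMod {v : ι → R} {b : κ → R} (h : IsFreeBasis K v b) :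
    LinIndepMod K (Ideal.span (Set.range v)) b := by
  classical
  intro s g hg
  have h1 := h.mem_span_of_mem hg
  have h2 : ∑ k ∈ s, g k • b k ∈ Submodule.span K (monomialFamily v b '' {p | p.1 = 0}) :=
    Submodule.sum_mem _ fun k _ => Submodule.smul_mem _ _ <| Submodule.subset_span
      ⟨(0, k), rfl, by simp [monomialFamily, mpow_zero]⟩
  have h3 := Submodule.disjoint_def.mp (h.linearIndependent.disjoint_span_image
    (s := {p | p.1 = 0}) (t := {p | p.1 ≠ 0})
    (Set.disjoint_left.mpr fun p hp hp' => hp' hp)) _ h2 h1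
  have h4 : LinearIndependent K b := by
    have := h.linearIndependent.comp (fun k : κ => ((0 : ι →₀ ℕ), k))
      (fun _ _ h => (Prod.ext_iff.mp h).2)
    convert this using 1
    ext k
    simp [monomialFamily, mpow_zero]
  exact linearIndependent_iff'.mp h4 s g h3

theorem IsFreeBasis.exists_sub_mem {v : ι → R} {b : κ → R} (h : IsFreeBasis K v b) (x : R) :
    ∃ y ∈ Submodule.span K (Set.range b), x - y ∈ Ideal.span (Set.range v) := by
  have hr : x ∈ Submodule.span K (Set.range (monomialFamily v b)) := by
    rw [h.span_eq_top]; trivial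
  induction hr using Submodule.span_induction with
  | mem r hr =>
    obtain ⟨⟨α, k⟩, rfl⟩ := hr
    by_cases hα : α = 0
    · exact ⟨b k, Submodule.subset_span ⟨k, rfl⟩, by simp [monomialFamily, hα, mpow_zero]⟩
    · exact ⟨0, Submodule.zero_mem _, by
        rw [sub_zero]; exact Ideal.mul_mem_right _ _ (mpow_mem_span hα)⟩
  | zero => exact ⟨0, Submodule.zero_mem _, by simp⟩
  | add a b _ _ ha hb =>
    obtain ⟨y, hy, ha⟩ := ha
    obtain ⟨z, hz, hb⟩ := hb
    exact ⟨y + z, Submodule.add_mem _ hy hz, by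
      rw [add_sub_add_comm]; exact Ideal.add_mem _ ha hb⟩
  | smul c a _ ha =>
    obtain ⟨y, hy, ha⟩ := ha
    exact ⟨c • y, Submodule.smul_mem _ _ hy, by
      rw [← smul_sub]; exact Submodule.smul_of_tower_mem _ c ha⟩

theorem IsFreeBasis.sumElim_left {v : ι → R} {u : ι' → R} {b : κ → R}
    (h : IsFreeBasis K (Sum.elim v u) b) : IsFreeBasis K v (monomialFamily u b) := by
  have h1 := monomialFamily_sumElim_comp v u b
  refine ⟨(linearIndependent_equiv' _ h1).mpr h.linearIndependent, ?_⟩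
  rw [← h1, EquivLike.range_comp, h.span_eq_top]

theorem IsFreeBasis.mem_of_mul_mem {v : ι → R} {z : R} {b : κ → R}
    (h : IsFreeBasis K (Sum.elim v fun _ : Unit => z) b) {x : R}
    (hx : z * x ∈ Ideal.span (Set.range v)) : x ∈ Ideal.span (Set.range v) := by
  obtain ⟨y, hy, hxy⟩ := h.sumElim_left.exists_sub_mem x
  suffices y = 0 by rwa [this, sub_zero] at hxy
  have hzy : z * y ∈ Ideal.span (Set.range v) := by
    have := Ideal.sub_mem _ hx (Ideal.mul_mem_left _ z hxy)
    rwa [← mul_sub, sub_sub_cancel] at this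
  obtain ⟨c, rfl⟩ := (Finsupp.mem_span_range_iff_exists_finsupp).mp hy
  rw [Finsupp.sum, Finset.mul_sum] at hzy
  have hinj : Function.Injective fun p : (Unit →₀ ℕ) × κ => (Finsupp.single () 1 + p.1, p.2) := by
    rintro ⟨α, k⟩ ⟨β, l⟩ hp
    simp only [Prod.mk.injEq, add_right_inj] at hp
    exact Prod.ext hp.1 hp.2
  have h1 : LinIndepMod K (Ideal.span (Set.range v))
      (fun p => z * monomialFamily (fun _ : Unit => z) b p) := by
    classical
    intro s g hg p hp
    have := h.sumElim_left.linIndepMod (s.map ⟨_, hinj⟩)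
      (Function.extend (fun p : (Unit →₀ ℕ) × κ => (Finsupp.single () 1 + p.1, p.2)) g 0) (by
        rw [Finset.sum_map]
        convert hg using 3 with p
        · exact hinj.extend_apply _ _ _
        · simp only [monomialFamily, Function.Embedding.coeFn_mk, mpow_add, mpow_single]
          ring) _ (Finset.mem_map_of_mem _ hp)
    rwa [Function.Embedding.coeFn_mk, hinj.extend_apply] at this
  have h2 := h1 c.support c (by simpa only [mul_smul_comm] using hzy)
  refine Finset.sum_eq_zero fun p hp => ?_
  dsimp only
  rw [h2 p hp, zero_smul]

end FreeBasis

section FreeBasis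

variable {K : Type*} {R : Type*} [Field K] [CommRing R] [Algebra K R] {ι ι' κ : Type*}

theorem IsQuasiRegular.sumElim {v : ι → R} {z : R} (hv : IsQuasiRegular K v)
    (hz : ∀ x, z * x ∈ Ideal.span (Set.range v) → x ∈ Ideal.span (Set.range v)) :
    IsQuasiRegular K (Sum.elim v fun _ : Unit => z) := by
  classical
  intro κ b hb
  rw [← linearIndependent_equiv' _ (monomialFamily_sumElim_comp v (fun _ : Unit => z) b)]
  refine hv _ _ ?_
  have hle : ∀ x, ∀ y, z * y + x ∈ Ideal.span (Set.range v) →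
      x ∈ Ideal.span (Set.range (Sum.elim v fun _ : Unit => z)) := by
    intro x y h
    have h1 : Ideal.span (Set.range v) ≤ Ideal.span (Set.range (Sum.elim v fun _ : Unit => z)) :=
      Ideal.span_mono (by rw [Set.Sum.elim_range]; exact Set.subset_union_left)
    have h2 : z ∈ Ideal.span (Set.range (Sum.elim v fun _ : Unit => z)) :=
      Ideal.subset_span ⟨Sum.inr (), rfl⟩
    have := Ideal.sub_mem _ (h1 h) (Ideal.mul_mem_right y _ h2)
    rwa [add_sub_cancel_left] at this
  have key : ∀ (n : ℕ) (t : Finset κ) (g : ℕ → κ → K),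
      ∑ i ∈ Finset.range n, ∑ j ∈ t, g i j • (z ^ i * b j) ∈ Ideal.span (Set.range v) →
      ∀ i < n, ∀ j ∈ t, g i j = 0 := by
    intro n t
    induction n with
    | zero => intro g _ i hi; omega
    | succ n ih =>
      intro g h
      have h1 : ∑ i ∈ Finset.range (n + 1), ∑ j ∈ t, g i j • (z ^ i * b j) =
          z * (∑ i ∈ Finset.range n, ∑ j ∈ t, g (i + 1) j • (z ^ i * b j)) +
            ∑ j ∈ t, g 0 j • b j := by
        rw [Finset.sum_range_succ', Finset.mul_sum]
        simp only [pow_zero, one_mul, Finset.mul_sum, mul_smul_comm, pow_succ', mul_assoc]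
      rw [h1] at h
      have h0 := hb t (g 0) (hle _ _ h)
      have h2 : ∑ j ∈ t, g 0 j • b j = 0 :=
        Finset.sum_eq_zero fun j hj => by rw [h0 j hj, zero_smul]
      rw [h2, add_zero] at h
      have h3 := ih _ (hz _ h)
      intro i hi j hj
      rcases i with _ | i
      · exact h0 j hj
      · exact h3 i (by omega) j hj
  intro s g hg p hp
  have h1 := key (s.sup (fun p => p.1 ()) + 1) (s.image Prod.snd)
    (fun i j => if (Finsupp.single () i, j) ∈ s then g (Finsupp.single () i, j) else 0) (by
      convert hg using 1
      rw [← Finset.sum_product']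
      symm
      refine Finset.sum_bij_ne_zero (fun p _ _ => (p.1 (), p.2)) ?_ ?_ ?_ ?_
      · intro p hp _
        exact Finset.mem_product.mpr ⟨Finset.mem_range.mpr (Nat.lt_succ_of_le
          (Finset.le_sup (f := fun p : (Unit →₀ ℕ) × κ => p.1 ()) hp)),
            Finset.mem_image_of_mem _ hp⟩
      · rintro ⟨α, j⟩ _ _ ⟨β, k⟩ _ _ h
        simp only [Prod.mk.injEq] at h
        exact Prod.ext (Finsupp.ext fun _ => h.1) h.2
      · rintro ⟨i, j⟩ _ h
        dsimp only at h
        split_ifs at h with h'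
        · refine ⟨_, h', ?_, by simp⟩
          simpa only [monomialFamily, mpow_single] using h
        · simp at h
      · rintro ⟨α, j⟩ hp _
        have : Finsupp.single () (α ()) = α := Finsupp.ext fun _ => by simp
        simp only [this, hp, if_true, monomialFamily]
        congr 2
        conv_lhs => rw [← this, mpow_single]) (p.1 ())
    (Nat.lt_succ_of_le (Finset.le_sup (f := fun p : (Unit →₀ ℕ) × κ => p.1 ()) hp)) p.2
    (Finset.mem_image_of_mem _ hp)
  have : Finsupp.single () (p.1 ()) = p.1 := Finsupp.ext fun _ => by simp
  simpa only [this, hp, if_true] using h1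

theorem aeval_eq_sum_mpow (v : ι → R) {p : MvPolynomial ι K} {A : Finset (ι →₀ ℕ)}
    (hA : p.support ⊆ A) : aeval v p = ∑ α ∈ A, coeff α p • mpow v α := by
  conv_lhs => rw [p.as_sum, map_sum]
  simp only [aeval_monomial, Algebra.smul_def]
  refine Finset.sum_subset hA fun α _ hα => ?_
  rw [notMem_support_iff.mp hα, map_zero, zero_mul]

theorem linearIndependent_monomialFamily_iff {v : ι → R} {b : κ → R} :
    LinearIndependent K (monomialFamily v b) ↔ ∀ (s : Finset κ) (P : κ → MvPolynomial ι K),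
      ∑ k ∈ s, aeval v (P k) * b k = 0 → ∀ k ∈ s, P k = 0 := by
  classical
  rw [linearIndependent_iff']
  constructor
  · intro h s P hP k hk
    set A := s.biUnion fun k => (P k).support
    have hA : ∀ k ∈ s, (P k).support ⊆ A := fun k hk => Finset.subset_biUnion_of_mem
      (fun k => (P k).support) hk
    have h1 := h (A ×ˢ s) (fun p => coeff p.1 (P p.2)) (by
      rw [← hP, Finset.sum_product_right]
      refine Finset.sum_congr rfl fun k hk => ?_
      rw [aeval_eq_sum_mpow v (hA k hk), Finset.sum_mul]
      exact Finset.sum_congr rfl fun α _ => (smul_mul_assoc _ _ _).symm)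
    ext α
    by_contra h0
    exact h0 (h1 (α, k) (Finset.mem_product.mpr ⟨hA k hk (mem_support_iff.mpr h0), hk⟩))
  · intro h s g hg p hp
    have h1 := h (s.image Prod.snd) (fun k => ∑ q ∈ s with q.2 = k, monomial q.1 (g q)) (by
      rw [← hg, ← Finset.sum_fiberwise_of_maps_to (g := Prod.snd) (t := s.image Prod.snd)
        (fun q hq => Finset.mem_image_of_mem _ hq)]
      refine Finset.sum_congr rfl fun k _ => ?_
      rw [map_sum, Finset.sum_mul]
      refine Finset.sum_congr rfl fun q hq => ?_
      rw [aeval_monomial, ← (Finset.mem_filter.mp hq).2, mul_assoc, ← Algebra.smul_def]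
      rfl) p.2 (Finset.mem_image_of_mem _ hp)
    have h2 := congrArg (coeff p.1) h1
    rw [coeff_sum, coeff_zero, Finset.sum_eq_single p] at h2
    · simpa using h2
    · intro q hq hqp
      rw [coeff_monomial, if_neg]
      exact fun h' => hqp (Prod.ext h' (Finset.mem_filter.mp hq).2)
    · intro h'
      exact (h' (Finset.mem_filter.mpr ⟨hp, rfl⟩)).elim

theorem IsQuasiRegular.of_algHom {v : ι → R} {v' : ι' → R} (h : IsQuasiRegular K v)
    (σ : MvPolynomial ι' K →ₐ[K] MvPolynomial ι K) (hσ : Function.Injective σ)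
    (hv : ∀ i, aeval v (σ (X i)) = v' i)
    (hle : ∀ i, v i ∈ Ideal.span (Set.range v')) : IsQuasiRegular K v' := by
  intro κ b hb
  have h1 : Ideal.span (Set.range v) ≤ Ideal.span (Set.range v') := by
    rw [Ideal.span_le]
    rintro _ ⟨i, rfl⟩
    exact hle i
  have h2 := linearIndependent_monomialFamily_iff.mp (h κ b fun s g hg => hb s g (h1 hg))
  have h3 : ∀ p, aeval v' p = aeval v (σ p) := by
    intro p
    have : (aeval v').comp (AlgHom.id K _) = (aeval v).comp σ := by
      ext i
      simpa using (hv i).symm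
    exact DFunLike.congr_fun this p
  rw [linearIndependent_monomialFamily_iff]
  intro s P hP k hk
  simp only [h3] at hP
  exact hσ (by rw [h2 s (fun k => σ (P k)) hP k hk, map_zero])

theorem IsQuasiRegular.of_equiv {v : ι → R} (e : ι' ≃ ι) (h : IsQuasiRegular K v) :
    IsQuasiRegular K (v ∘ e) :=
  h.of_algHom (rename e) (rename_injective _ e.injective) (fun i => by simp)
    fun i => Ideal.subset_span ⟨e.symm i, by simp⟩

theorem mpow_comp_equiv (v : ι → R) (e : ι' ≃ ι) (α : ι' →₀ ℕ) :
    mpow v (Finsupp.equivMapDomain e α) = mpow (v ∘ e) α := by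
  rw [mpow, Finsupp.prod_equivMapDomain]
  rfl

theorem IsFreeBasis.of_equiv {v : ι → R} {b : κ → R} (e : ι' ≃ ι) (h : IsFreeBasis K v b) :
    IsFreeBasis K (v ∘ e) b := by
  have h1 : monomialFamily v b ∘ ((Finsupp.domCongr e : (ι' →₀ ℕ) ≃+ (ι →₀ ℕ)).toEquiv.prodCongr
      (Equiv.refl κ)) = monomialFamily (v ∘ e) b := by
    ext ⟨α, k⟩
    simp only [Function.comp_apply, monomialFamily]
    rw [← mpow_comp_equiv]
    rfl
  refine ⟨(linearIndependent_equiv' _ h1).mpr h.linearIndependent, ?_⟩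
  rw [← h1, EquivLike.range_comp, h.span_eq_top]

theorem isQuasiRegular_of_isEmpty [IsEmpty ι] (v : ι → R) : IsQuasiRegular K v := by
  intro κ b hb
  have h1 : LinearIndependent K b := linearIndependent_iff'.mpr fun s g hg =>
    hb s g (by rw [hg]; exact Ideal.zero_mem _)
  have := h1.comp (Prod.snd : (ι →₀ ℕ) × κ → κ)
    fun p q hpq => Prod.ext (Subsingleton.elim _ _) hpq
  convert this using 1
  ext p
  rw [monomialFamily, Subsingleton.elim p.1 0, mpow_zero, one_mul, Function.comp_apply]

theorem IsFreeBasis.isQuasiRegular {ι : Type} [Finite ι] {κ : Type} {v : ι → R} {b : κ → R}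
    (h : IsFreeBasis K v b) : IsQuasiRegular K v := by
  suffices H : ∀ (κ : Type) (v : ι → R) (b : κ → R), IsFreeBasis K v b → IsQuasiRegular K v from
    H κ v b h
  clear h b v
  induction ι using Finite.induction_empty_option with
  | @of_equiv ι ι' e ih =>
    intro κ v b h
    have := (ih κ (v ∘ e) b (h.of_equiv e)).of_equiv e.symm
    rwa [Function.comp_assoc, e.self_comp_symm, Function.comp_id] at this
  | h_empty => exact fun κ v b _ => isQuasiRegular_of_isEmpty v
  | @h_option ι _ ih =>
    intro κ v b h
    have h1 : v ∘ (Equiv.optionEquivSumPUnit ι).symm =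
        Sum.elim (v ∘ some) (fun _ : Unit => v none) := by
      ext (i | i) <;> rfl
    have h2 := h.of_equiv (Equiv.optionEquivSumPUnit ι).symm
    rw [h1] at h2
    have h3 := (ih _ _ _ h2.sumElim_left).sumElim fun x hx => h2.mem_of_mul_mem hx
    rw [← h1] at h3
    have := h3.of_equiv (Equiv.optionEquivSumPUnit ι)
    rwa [Function.comp_assoc, Equiv.symm_comp_self, Function.comp_id] at this

end FreeBasis

section FreeBasis

variable {K : Type*} [Field K] {σ ι : Type*}

theorem mul_mem_span_monomialFamily {R κ : Type*} [CommRing R] [Algebra K R] {v : ι → R}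
    {b : κ → R} (i : ι) {x : R} (hx : x ∈ Submodule.span K (Set.range (monomialFamily v b))) :
    v i * x ∈ Submodule.span K (Set.range (monomialFamily v b)) := by
  induction hx using Submodule.span_induction with
  | mem r hr =>
    obtain ⟨⟨α, k⟩, rfl⟩ := hr
    refine Submodule.subset_span ⟨(Finsupp.single i 1 + α, k), ?_⟩
    simp only [monomialFamily, mpow_add, mpow_single]
    ring
  | zero => simp
  | add a b _ _ ha hb => rw [mul_add]; exact Submodule.add_mem _ ha hb
  | smul c a _ ha => rw [mul_smul_comm]; exact Submodule.smul_mem _ _ ha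

theorem homogeneousComponent_mem_span_range {v : ι → MvPolynomial σ K} {w : ι → ℕ}
    (hv : ∀ i, IsHomogeneous (v i) (w i)) {x : MvPolynomial σ K}
    (hx : x ∈ Ideal.span (Set.range v)) (n : ℕ) :
    homogeneousComponent n x ∈ Ideal.span (Set.range v) := by
  let := MvPolynomial.gradedAlgebra (σ := σ) (R := K)
  refine homogeneousComponent_mem_of_mem (Ideal.homogeneous_span _ _ ?_) hx n
  rintro _ ⟨i, rfl⟩
  exact ⟨w i, hv i⟩

theorem IsQuasiRegular.exists_isFreeBasis [Fintype ι] {v : ι → MvPolynomial σ K} {w : ι → ℕ}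
    (hw : ∀ i, 0 < w i) (hv : ∀ i, IsHomogeneous (v i) (w i)) (hq : IsQuasiRegular K v)
    {τ : Type} {c : τ → MvPolynomial σ K} (hc : ∀ k, ∃ n, IsHomogeneous (c k) n)
    (hspan : ∀ x, ∃ y ∈ Submodule.span K (Set.range c), x - y ∈ Ideal.span (Set.range v)) :
    ∃ (κ : Type) (a : κ → τ), Function.Injective a ∧ IsFreeBasis K v (c ∘ a) := by
  classical
  set J := Ideal.span (Set.range v) with hJ
  obtain ⟨κ, a, ha, hsp, hli⟩ := exists_linearIndependent' K
    ((Ideal.Quotient.mkₐ K J).toLinearMap ∘ c)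
  have hmod : LinIndepMod K J (c ∘ a) := by
    intro s g hg
    refine linearIndependent_iff'.mp hli s g ?_
    have := (Ideal.Quotient.mkₐ_eq_mk K J) ▸ (Ideal.Quotient.eq_zero_iff_mem.mpr hg)
    rw [← Ideal.Quotient.mkₐ_eq_mk K, map_sum] at this
    simp only [map_smul] at this
    exact this
  have hspan' : ∀ x, ∃ y ∈ Submodule.span K (Set.range (c ∘ a)), x - y ∈ J := by
    intro x
    obtain ⟨y, hy, hxy⟩ := hspan x
    have h1 : (Ideal.Quotient.mkₐ K J).toLinearMap y ∈
        Submodule.map (Ideal.Quotient.mkₐ K J).toLinearMap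
          (Submodule.span K (Set.range (c ∘ a))) := by
      rw [Submodule.map_span, ← Set.range_comp, ← Function.comp_assoc, hsp, Set.range_comp,
        ← Submodule.map_span]
      exact Submodule.mem_map_of_mem hy
    obtain ⟨z, hz, hzy⟩ := h1
    refine ⟨z, hz, ?_⟩
    have h2 : y - z ∈ J := by
      rw [← Ideal.Quotient.eq_zero_iff_mem, map_sub, sub_eq_zero]
      exact hzy.symm
    rw [← sub_add_sub_cancel x y z]
    exact Ideal.add_mem _ hxy h2
  refine ⟨κ, a, ha, hq _ _ hmod, ?_⟩
  have hb : Submodule.span K (Set.range (c ∘ a)) ≤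
      Submodule.span K (Set.range (monomialFamily v (c ∘ a))) := by
    refine Submodule.span_mono ?_
    rintro _ ⟨k, rfl⟩
    exact ⟨(0, k), by simp [monomialFamily, mpow_zero]⟩
  have hcomp : ∀ n, ∀ y ∈ Submodule.span K (Set.range (c ∘ a)),
      homogeneousComponent n y ∈ Submodule.span K (Set.range (c ∘ a)) := by
    intro n y hy
    induction hy using Submodule.span_induction with
    | mem r hr =>
      obtain ⟨k, rfl⟩ := hr
      obtain ⟨m, hm⟩ := hc (a k)
      rw [Function.comp_apply, homogeneousComponent_of_mem hm]
      split_ifs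
      · exact Submodule.subset_span ⟨k, rfl⟩
      · exact Submodule.zero_mem _
    | zero => simp
    | add a b _ _ ha hb => rw [map_add]; exact Submodule.add_mem _ ha hb
    | smul c a _ ha => rw [map_smul]; exact Submodule.smul_mem _ _ ha
  have hrange : Set.range v = v '' ((Finset.univ : Finset ι) : Set ι) := by simp
  have key : ∀ n, ∀ x, IsHomogeneous x n →
      x ∈ Submodule.span K (Set.range (monomialFamily v (c ∘ a))) := by
    intro n
    induction n using Nat.strong_induction_on with
    | _ n ih =>
      intro x hx
      obtain ⟨y, hy, hxy⟩ := hspan' x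
      have h1 : x - homogeneousComponent n y ∈ J := by
        have := homogeneousComponent_mem_span_range hv hxy n
        rwa [map_sub, homogeneousComponent_of_mem hx, if_pos rfl] at this
      rw [hJ, hrange] at h1
      obtain ⟨g, hg, hg'⟩ := exists_homogeneous_coeffs hv
        (hx.sub (homogeneousComponent_isHomogeneous n y)) h1
      rw [← sub_add_cancel x (homogeneousComponent n y), hg]
      refine Submodule.add_mem _ (Submodule.sum_mem _ fun i _ => ?_) (hb (hcomp n y hy))
      refine mul_mem_span_monomialFamily i ?_
      rcases hg' i with h0 | ⟨k, hk, h0⟩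
      · rw [h0]; exact Submodule.zero_mem _
      · exact ih k (by have := hw i; omega) _ h0
  rw [eq_top_iff]
  intro x _
  rw [← sum_homogeneousComponent x]
  exact Submodule.sum_mem _ fun n _ => key n _ (homogeneousComponent_isHomogeneous n x)

end FreeBasis

theorem charpoly_eval₂_mem {A R : Type*} [CommRing A] [CommRing R] {m : ℕ} (φ : A →+* R)
    {J : Ideal R} {b : Fin m → R} {z : R} {B : Matrix (Fin m) (Fin m) A}
    (hz : ∀ j, z * b j - ∑ i, φ (B j i) * b i ∈ J) {P : Fin m → A}
    (h1 : 1 - ∑ i, φ (P i) * b i ∈ J) : B.charpoly.eval₂ φ z ∈ J := by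
  classical
  set π := Ideal.Quotient.mk J
  set N : Matrix (Fin m) (Fin m) (R ⧸ J) := Matrix.scalar _ (π z) - B.map (π.comp φ)
  have hN : N.mulVec (fun i => π (b i)) = 0 := by
    ext j
    have := Ideal.Quotient.eq_zero_iff_mem.mpr (hz j)
    rw [map_sub, map_mul, map_sum] at this
    rw [Matrix.sub_mulVec, Pi.sub_apply, Pi.zero_apply, ← this, Matrix.scalar_apply,
      Matrix.mulVec_diagonal]
    simp [Matrix.mulVec, dotProduct, π]
  have hdet : ∀ i, N.det * π (b i) = 0 := by
    intro i
    have := congrArg (fun x => N.adjugate.mulVec x i) hN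
    simpa [Matrix.mulVec_mulVec, Matrix.adjugate_mul, Matrix.smul_mulVec] using this
  have hev : N.det = π (B.charpoly.eval₂ φ z) := by
    rw [← Matrix.eval_charpoly, Matrix.charpoly_map, Polynomial.eval_map,
      Polynomial.hom_eval₂]
  rw [← Ideal.Quotient.eq_zero_iff_mem, ← hev]
  have h1' : (1 : R ⧸ J) = ∑ i, π (φ (P i)) * π (b i) := by
    have := Ideal.Quotient.eq_zero_iff_mem.mpr h1
    rw [map_sub, sub_eq_zero] at this
    simpa using this
  rw [← mul_one N.det, h1', Finset.mul_sum]
  exact Finset.sum_eq_zero fun i _ => by rw [mul_left_comm, hdet, mul_zero]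

section FreeBasis

variable {K : Type*} [Field K]

theorem IsFreeBasis.exists_sub_sum_aeval_mem {R ι μ κ : Type*} [CommRing R] [Algebra K R]
    [Fintype κ] {y : ι → R} {l : μ → R} {b : κ → R} (h : IsFreeBasis K (Sum.elim y l) b) (x : R) :
    ∃ P : κ → MvPolynomial μ K,
      x - ∑ i, aeval l (P i) * b i ∈ Ideal.span (Set.range y) := by
  classical
  have hx : x ∈ Submodule.span K (Set.range (monomialFamily y (monomialFamily l b))) := by
    rw [h.sumElim_left.span_eq_top]; trivial
  induction hx using Submodule.span_induction with
  | mem r hr =>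
    obtain ⟨⟨α, β, k⟩, rfl⟩ := hr
    by_cases hα : α = 0
    · refine ⟨Pi.single k (monomial β 1), ?_⟩
      rw [Finset.sum_eq_single k]
      · simp [monomialFamily, hα, mpow, aeval_monomial]
      · intro i _ hi
        simp [Pi.single_eq_of_ne hi]
      · simp
    · refine ⟨0, ?_⟩
      simpa [monomialFamily] using Ideal.mul_mem_right (mpow l β * b k) _ (mpow_mem_span (v := y) hα)
  | zero => exact ⟨0, by simp⟩
  | add a c _ _ ha hc =>
    obtain ⟨P, hP⟩ := ha
    obtain ⟨Q, hQ⟩ := hc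
    refine ⟨P + Q, ?_⟩
    convert Ideal.add_mem _ hP hQ using 1
    simp only [Pi.add_apply, map_add, add_mul, Finset.sum_add_distrib]
    ring
  | smul r a _ ha =>
    obtain ⟨P, hP⟩ := ha
    refine ⟨r • P, ?_⟩
    convert Submodule.smul_of_tower_mem _ r hP using 1
    simp only [Pi.smul_apply, map_smul, smul_sub, Finset.smul_sum, smul_mul_assoc]

theorem homogeneousComponent_aeval {σ μ : Type*} {l : μ → MvPolynomial σ K}
    (hl : ∀ j, IsHomogeneous (l j) 1) (p : MvPolynomial μ K) (n : ℕ) :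
    homogeneousComponent n (aeval l p) = aeval l (homogeneousComponent n p) := by
  have key : ∀ k (q : MvPolynomial μ K), IsHomogeneous q k → IsHomogeneous (aeval l q) k := by
    intro k q hq
    simpa using hq.aeval l (n := 1) hl
  conv_lhs => rw [← sum_homogeneousComponent p, map_sum, map_sum]
  have : ∀ i, homogeneousComponent n (aeval l (homogeneousComponent i p)) =
      if i = n then aeval l (homogeneousComponent n p) else 0 := by
    intro i
    rw [homogeneousComponent_of_mem (key i _ (homogeneousComponent_isHomogeneous i p))]
    split_ifs <;> simp_all
  simp only [this, Finset.sum_ite_eq']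
  split_ifs with h
  · rfl
  · rw [homogeneousComponent_eq_zero, map_zero]
    simpa using h

theorem IsFreeBasis.exists_homogeneous_aeval_mem {σ ι μ : Type*} {m : ℕ}
    {y : ι → MvPolynomial σ K} {d : ι → ℕ} (hy : ∀ i, IsHomogeneous (y i) (d i))
    {l : μ → MvPolynomial σ K} (hl : ∀ j, IsHomogeneous (l j) 1)
    {b : Fin m → MvPolynomial σ K} (h : IsFreeBasis K (Sum.elim y l) b)
    {z : MvPolynomial σ K} {w : ℕ} (hz : IsHomogeneous z w)
    (hreg : ∀ n ≤ m * w, ∀ x, IsHomogeneous x n → z * x ∈ Ideal.span (Set.range y) →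
      x ∈ Ideal.span (Set.range y)) :
    ∃ (q : ℕ) (c : MvPolynomial μ K), q ≤ m * w ∧ c ≠ 0 ∧ IsHomogeneous c q ∧
      aeval l c ∈ Ideal.span (Set.range y) ⊔ Ideal.span {z} := by
  classical
  set J := Ideal.span (Set.range y)
  choose B hB using fun j => h.exists_sub_sum_aeval_mem (z * b j)
  obtain ⟨P, hP⟩ := h.exists_sub_sum_aeval_mem 1
  have hχ := charpoly_eval₂_mem (aeval l : MvPolynomial μ K →ₐ[K] MvPolynomial σ K).toRingHom
    (B := Matrix.of B) hB hP
  set χ := (Matrix.of B).charpoly with hχdef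
  have hdeg : χ.natDegree = m := by simp [χ, Matrix.charpoly_natDegree_eq_dim]
  rw [Polynomial.eval₂_eq_sum_range, hdeg] at hχ
  set c : ℕ → MvPolynomial μ K := fun i => homogeneousComponent ((m - i) * w) (χ.coeff i)
  have hc : ∀ i, IsHomogeneous (c i) ((m - i) * w) := fun i => homogeneousComponent_isHomogeneous _ _
  have hcm : c m = 1 := by
    have : χ.coeff m = 1 := by
      rw [← hdeg]; exact (Matrix.charpoly_monic _)
    simp [c, this, homogeneousComponent_of_mem (isHomogeneous_one μ K)]
  have hsum : ∑ i ∈ Finset.range (m + 1), aeval l (c i) * z ^ i ∈ J := by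
    have := homogeneousComponent_mem_span_range hy hχ (m * w)
    rw [map_sum] at this
    convert this using 1
    refine Finset.sum_congr rfl fun i hi => ?_
    have hi' : i ≤ m := by simpa [Nat.lt_succ_iff] using hi
    have hzi : IsHomogeneous (z ^ i) (i * w) := by rw [mul_comm]; exact hz.pow i
    have := weightedHomogeneousComponent_mul_eq hzi (aeval l (χ.coeff i)) (m * w)
    rw [if_pos (Nat.mul_le_mul_right w hi'), ← Nat.sub_mul] at this
    rw [mul_comm, ← homogeneousComponent_aeval hl]
    exact this.symm.trans (congrArg (weightedHomogeneousComponent 1 (m * w)) (mul_comm _ _))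
  have hex : ∃ i, c i ≠ 0 := ⟨m, by rw [hcm]; exact one_ne_zero⟩
  set i₀ := Nat.find hex
  have hi₀ : c i₀ ≠ 0 := Nat.find_spec hex
  have hi₀m : i₀ ≤ m := Nat.find_min' hex (by rw [hcm]; exact one_ne_zero)
  set x := ∑ i ∈ Finset.range (m + 1 - i₀), aeval l (c (i₀ + i)) * z ^ i
  have hx : z ^ i₀ * x ∈ J := by
    convert hsum using 1
    rw [← Finset.sum_range_add_sum_Ico _ (show i₀ ≤ m + 1 by omega), Finset.sum_eq_zero, zero_add,
      Finset.sum_Ico_eq_sum_range, Finset.mul_sum]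
    · refine Finset.sum_congr rfl fun i _ => by rw [pow_add]; ring
    · intro i hi
      have : c i = 0 := by
        by_contra hne
        exact Nat.find_min hex (Finset.mem_range.mp hi) hne
      rw [this, map_zero, zero_mul]
  have hxh : IsHomogeneous x ((m - i₀) * w) := by
    refine IsHomogeneous.sum _ _ _ fun i hi => ?_
    have hi' : i₀ + i ≤ m := by have := Finset.mem_range.mp hi; omega
    have h1 : IsHomogeneous (aeval l (c (i₀ + i))) ((m - (i₀ + i)) * w) := by
      simpa using (hc (i₀ + i)).aeval l (n := 1) hl
    convert h1.mul (hz.pow i) using 1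
    rw [mul_comm w i, ← add_mul]
    congr 1
    omega
  have hxJ : ∀ s ≤ i₀, z ^ s * x ∈ J → x ∈ J := by
    intro s
    induction s with
    | zero => simp
    | succ s ih =>
      intro hs hsx
      refine ih (by omega) (hreg (s * w + (m - i₀) * w) ?_ _ ?_ ?_)
      · rw [← add_mul]; exact Nat.mul_le_mul_right _ (by omega)
      · convert (hz.pow s).mul hxh using 1
        rw [mul_comm s]
      · rwa [← mul_assoc, ← pow_succ']
  have hxJ := hxJ i₀ le_rfl hx
  refine ⟨(m - i₀) * w, c i₀, Nat.mul_le_mul_right _ (Nat.sub_le _ _), hi₀, hc i₀, ?_⟩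
  have hxe : x = ∑ i ∈ Finset.range (m - i₀), aeval l (c (i₀ + (i + 1))) * z ^ (i + 1) +
      aeval l (c i₀) := by
    simp only [x]
    rw [show m + 1 - i₀ = m - i₀ + 1 by omega, Finset.sum_range_succ']
    simp
  rw [eq_sub_iff_add_eq'.mpr hxe.symm]
  refine Submodule.sub_mem _ (Submodule.mem_sup_left hxJ) (Submodule.mem_sup_right ?_)
  refine Ideal.sum_mem _ fun i _ => ?_
  rw [pow_succ, ← mul_assoc]
  exact Ideal.mul_mem_left _ _ (Ideal.mem_span_singleton_self z)

end FreeBasis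

section FreeBasis

variable {K : Type*} [Field K]

theorem aeval_smul_of_isHomogeneous {R μ : Type*} [CommRing R] [Algebra K R] [Fintype μ]
    {c : MvPolynomial μ K} {q : ℕ} (hc : IsHomogeneous c q) (a : μ → K) (t : R) :
    aeval (fun k => a k • t) c = eval a c • t ^ q := by
  rw [aeval_def, eval₂_eq', eval_eq', Finset.sum_smul]
  refine Finset.sum_congr rfl fun d hd => ?_
  have h1 : ∑ i, d i = q := by
    have := hc (mem_support_iff.mp hd)
    rwa [Pi.one_def, ← Finsupp.degree_eq_weight_one, Finsupp.degree_eq_sum] at this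
  simp only [Algebra.smul_def, mul_pow, Finset.prod_mul_distrib, Finset.prod_pow_eq_pow_sum, h1,
    map_mul, map_prod, map_pow, mul_assoc]

theorem IsQuasiRegular.exists_linear_change [Infinite K] {σ ι : Type*} {M : ℕ}
    {y : ι → MvPolynomial σ K} {l : Fin M → MvPolynomial σ K} (hl : ∀ j, IsHomogeneous (l j) 1)
    (h : IsQuasiRegular K (Sum.elim y l)) {c : MvPolynomial (Fin M) K} (hc0 : c ≠ 0) {q : ℕ}
    (hq : 0 < q) (hc : IsHomogeneous c q) {J : Ideal (MvPolynomial σ K)} (hJ : aeval l c ∈ J) :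
    ∃ (M' : ℕ) (l' : Fin M' → MvPolynomial σ K) (t : MvPolynomial σ K),
      (∀ j, IsHomogeneous (l' j) 1) ∧ IsHomogeneous t 1 ∧
      IsQuasiRegular K (Sum.elim (Sum.elim y l') fun _ : Unit => t) ∧
      t ^ q ∈ J ⊔ Ideal.span (Set.range l') ∧
      Ideal.span (Set.range (Sum.elim y l)) ≤
        Ideal.span (Set.range (Sum.elim (Sum.elim y l') fun _ : Unit => t)) := by
  classical
  obtain ⟨a, ha⟩ := exists_eval_ne_zero hc0
  obtain ⟨j, hj⟩ : ∃ j, a j ≠ 0 := by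
    by_contra! hcon
    refine ha ?_
    rw [show a = 0 from funext hcon]
    exact eval_zero_of_isHomogeneous hq hc
  obtain _ | M' := M
  · exact j.elim0
  set t : MvPolynomial σ K := (a j)⁻¹ • l j
  set l' : Fin M' → MvPolynomial σ K := fun i => l (j.succAbove i) - a (j.succAbove i) • t
  have hlt : ∀ k, l k - a k • t ∈ Ideal.span (Set.range l') := by
    intro k
    rcases Fin.eq_self_or_eq_succAbove j k with rfl | ⟨i, rfl⟩
    · simp [t, smul_smul, hj]
    · exact Ideal.subset_span ⟨i, rfl⟩
  have ht : IsHomogeneous t 1 := (homogeneousSubmodule σ K 1).smul_mem _ (hl j)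
  have hle : ∀ i, Sum.elim y l i ∈
      Ideal.span (Set.range (Sum.elim (Sum.elim y l') fun _ : Unit => t)) := by
    have htm : t ∈ Ideal.span (Set.range (Sum.elim (Sum.elim y l') fun _ : Unit => t)) :=
      Ideal.subset_span ⟨Sum.inr (), rfl⟩
    rintro (i | k)
    · exact Ideal.subset_span ⟨Sum.inl (Sum.inl i), rfl⟩
    · rw [Sum.elim_inr, ← sub_add_cancel (l k) (a k • t)]
      refine Ideal.add_mem _ (Ideal.span_mono ?_ (hlt k)) (Submodule.smul_of_tower_mem _ _ htm)
      rintro _ ⟨i, rfl⟩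
      exact ⟨Sum.inl (Sum.inr i), rfl⟩
  refine ⟨M', l', t, fun i => (hl _).sub ((homogeneousSubmodule σ K 1).smul_mem _ ht), ht, ?_, ?_,
    Ideal.span_le.mpr (Set.range_subset_iff.mpr hle)⟩
  · let f : (ι ⊕ Fin M') ⊕ Unit → MvPolynomial (ι ⊕ Fin (M' + 1)) K :=
      Sum.elim (Sum.elim (fun i => X (Sum.inl i)) fun i => X (Sum.inr (j.succAbove i)) -
        a (j.succAbove i) • (a j)⁻¹ • X (Sum.inr j)) fun _ => (a j)⁻¹ • X (Sum.inr j)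
    let g : ι ⊕ Fin (M' + 1) → MvPolynomial ((ι ⊕ Fin M') ⊕ Unit) K :=
      Sum.elim (fun i => X (Sum.inl (Sum.inl i))) fun k =>
        j.insertNth (α := fun _ => MvPolynomial ((ι ⊕ Fin M') ⊕ Unit) K) 0
          (fun i => X (Sum.inl (Sum.inr i))) k + a k • X (Sum.inr ())
    have hgf : (aeval g).comp (aeval f) = AlgHom.id K _ := by
      ext i : 1
      rcases i with (i | i) | i <;> simp [f, g, smul_smul, hj]
    refine h.of_algHom (aeval f) ?_ ?_ hle
    · exact Function.LeftInverse.injective (g := aeval g) (DFunLike.congr_fun hgf)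
    · rintro ((i | i) | i) <;> simp [f, l', t]
  · have h1 : aeval l c - eval a c • t ^ q ∈ Ideal.span (Set.range l') := by
      rw [← Ideal.Quotient.eq_zero_iff_mem, map_sub, sub_eq_zero,
        ← aeval_smul_of_isHomogeneous hc]
      change Ideal.Quotient.mkₐ K _ _ = Ideal.Quotient.mkₐ K _ _
      rw [← AlgHom.comp_apply, ← AlgHom.comp_apply, comp_aeval, comp_aeval]
      congr 2
      ext k
      refine Ideal.Quotient.eq.mpr (hlt k)
    have h2 : eval a c • t ^ q ∈ J ⊔ Ideal.span (Set.range l') := by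
      rw [← sub_sub_cancel (aeval l c) (eval a c • t ^ q)]
      exact Submodule.sub_mem _ (Submodule.mem_sup_left hJ) (Submodule.mem_sup_right h1)
    have := Submodule.smul_of_tower_mem _ (eval a c)⁻¹ h2
    rwa [smul_smul, inv_mul_cancel₀ ha, one_smul] at this

end FreeBasis

section FreeBasis

variable {K : Type*} [Field K]

theorem IsFreeBasis.comp_equiv {R ι κ κ' : Type*} [CommRing R] [Algebra K R] {v : ι → R}
    {b : κ → R} (h : IsFreeBasis K v b) (e : κ' ≃ κ) : IsFreeBasis K v (b ∘ e) := by
  have h1 : monomialFamily v b ∘ ((Equiv.refl _).prodCongr e) = monomialFamily v (b ∘ e) := rfl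
  refine ⟨(linearIndependent_equiv' _ h1).mpr h.linearIndependent, ?_⟩
  rw [← h1, EquivLike.range_comp, h.span_eq_top]

theorem one_notMem_of_isHomogeneous {σ ι : Type*} {y : ι → MvPolynomial σ K} {d : ι → ℕ}
    (hd : ∀ i, 0 < d i) (hy : ∀ i, IsHomogeneous (y i) (d i)) {z : MvPolynomial σ K} {w : ℕ}
    (hw : 0 < w) (hz : IsHomogeneous z w) :
    (1 : MvPolynomial σ K) ∉ Ideal.span (Set.range y) ⊔ Ideal.span {z} := by
  have h0 : ∀ (x : MvPolynomial σ K) (n : ℕ), 0 < n → IsHomogeneous x n →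
      x ∈ RingHom.ker (constantCoeff : MvPolynomial σ K →+* K) := fun x n hn hx =>
    hx.coeff_eq_zero (d := 0) (by simpa using hn.ne)
  have hle : Ideal.span (Set.range y) ⊔ Ideal.span {z} ≤
      RingHom.ker (constantCoeff : MvPolynomial σ K →+* K) := by
    refine sup_le (Ideal.span_le.mpr ?_) ((Ideal.span_singleton_le_iff_mem _).mpr (h0 z w hw hz))
    rintro _ ⟨i, rfl⟩
    exact h0 _ _ (hd i) (hy i)
  intro h
  simpa using hle h

theorem IsFreeBasis.exists_sumElim [Infinite K] {σ : Type*} {ι : Type} [Fintype ι] {m M : ℕ}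
    {y : ι → MvPolynomial σ K} {d : ι → ℕ} (hd : ∀ i, 0 < d i)
    (hy : ∀ i, IsHomogeneous (y i) (d i))
    {l : Fin M → MvPolynomial σ K} (hl : ∀ j, IsHomogeneous (l j) 1)
    {b : Fin m → MvPolynomial σ K} (hb : ∀ i, ∃ n, IsHomogeneous (b i) n)
    (h : IsFreeBasis K (Sum.elim y l) b)
    {z : MvPolynomial σ K} {w : ℕ} (hw : 0 < w) (hz : IsHomogeneous z w)
    (hreg : ∀ n ≤ m * w, ∀ x, IsHomogeneous x n → z * x ∈ Ideal.span (Set.range y) →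
      x ∈ Ideal.span (Set.range y)) :
    ∃ (m' M' : ℕ) (l' : Fin M' → MvPolynomial σ K) (b' : Fin m' → MvPolynomial σ K),
      m' ≤ m * (m * w) ∧ (∀ j, IsHomogeneous (l' j) 1) ∧ (∀ i, ∃ n, IsHomogeneous (b' i) n) ∧
      IsFreeBasis K (Sum.elim (Sum.elim y l') fun _ : Unit => z) b' := by
  classical
  obtain ⟨q, c, hq, hc0, hc, hcJ⟩ := h.exists_homogeneous_aeval_mem hy hl hz hreg
  have hq0 : 0 < q := by
    by_contra hq0
    obtain rfl : q = 0 := by omega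
    obtain ⟨a, rfl⟩ : ∃ a, c = C a := ⟨_, totalDegree_eq_zero_iff_eq_C.mp (Nat.le_zero.mp hc.totalDegree_le)⟩
    rw [← algebraMap_eq, AlgHom.commutes, Algebra.algebraMap_eq_smul_one] at hcJ
    have ha : a ≠ 0 := by rintro rfl; exact hc0 (map_zero _)
    refine one_notMem_of_isHomogeneous hd hy hw hz ?_
    have := Submodule.smul_of_tower_mem _ a⁻¹ hcJ
    rwa [smul_smul, inv_mul_cancel₀ ha, one_smul] at this
  obtain ⟨M', l', t, hl', ht, hqt, htq, hle⟩ := h.isQuasiRegular.exists_linear_change hl hc0 hq0 hc hcJ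
  obtain ⟨κ₀, a₀, ha₀, hb₀⟩ := hqt.exists_isFreeBasis (τ := Fin m) (c := b)
    (w := Sum.elim (Sum.elim d fun _ => 1) fun _ => 1)
    (by rintro ((i | i) | i) <;> simp [hd]) (by rintro ((i | i) | i) <;> simp [hy, hl', ht]) hb
    (fun x => by
      obtain ⟨x', hx', hxx'⟩ := h.exists_sub_mem x
      exact ⟨x', hx', hle hxx'⟩)
  set V := Ideal.span (Set.range (Sum.elim y l')) with hV
  have htV : ∀ x, t * x ∈ V → x ∈ V := fun x hx => hb₀.mem_of_mul_mem hx
  have htV' : ∀ n x, t ^ n * x ∈ V → x ∈ V := by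
    intro n
    induction n with
    | zero => simp
    | succ n ih =>
      intro x hx
      refine ih x (htV _ ?_)
      rwa [← mul_assoc, ← pow_succ']
  have hyV : Ideal.span (Set.range y) ≤ V := Ideal.span_mono (by
    rintro _ ⟨i, rfl⟩
    exact ⟨Sum.inl i, rfl⟩)
  have hlV : Ideal.span (Set.range l') ≤ V := Ideal.span_mono (by
    rintro _ ⟨i, rfl⟩
    exact ⟨Sum.inr i, rfl⟩)
  have htqV : t ^ q ∈ V ⊔ Ideal.span {z} := by
    refine (sup_le (sup_le ?_ le_sup_right) ?_ : _ ≤ V ⊔ Ideal.span {z}) htq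
    · exact hyV.trans le_sup_left
    · exact hlV.trans le_sup_left
  have hzV : ∀ x, z * x ∈ V → x ∈ V := by
    intro x hx
    refine htV' q x ?_
    obtain ⟨v, hv, u, hu, hvu⟩ := Submodule.mem_sup.mp htqV
    obtain ⟨u, rfl⟩ := Ideal.mem_span_singleton'.mp hu
    rw [← hvu, add_mul, mul_assoc]
    exact Ideal.add_mem _ (Ideal.mul_mem_right _ _ hv) (Ideal.mul_mem_left _ _ hx)
  have hVbasis := hb₀.sumElim_left
  have hqz := hVbasis.isQuasiRegular.sumElim hzV
  set W := Ideal.span (Set.range (Sum.elim (Sum.elim y l') fun _ : Unit => z))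
  have hVW : V ≤ W := Ideal.span_mono (by
    rintro _ ⟨i, rfl⟩
    exact ⟨Sum.inl i, rfl⟩)
  have htqW : t ^ q ∈ W := by
    refine (sup_le hVW ?_ : V ⊔ Ideal.span {z} ≤ W) htqV
    exact (Ideal.span_singleton_le_iff_mem _).mpr (Ideal.subset_span ⟨Sum.inr (), rfl⟩)
  obtain ⟨κ, a, ha, hbasis⟩ := hqz.exists_isFreeBasis (τ := Fin m × Fin q)
    (c := fun p => t ^ (p.2 : ℕ) * b p.1)
    (w := Sum.elim (Sum.elim d fun _ => 1) fun _ => w)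
    (by rintro ((i | i) | i) <;> simp [hd, hw]) (by rintro ((i | i) | i) <;> simp [hy, hl', hz])
    (fun p => by
      obtain ⟨n, hn⟩ := hb p.1
      exact ⟨_, (ht.pow _).mul hn⟩)
    (fun x => by
      obtain ⟨x', hx', hxx'⟩ := hVbasis.exists_sub_mem x
      suffices ∃ y ∈ Submodule.span K (Set.range fun p : Fin m × Fin q => t ^ (p.2 : ℕ) * b p.1),
          x' - y ∈ W by
        obtain ⟨u, hu, hxu⟩ := this
        refine ⟨u, hu, ?_⟩
        rw [← sub_add_sub_cancel x x' u]
        exact Ideal.add_mem _ (hVW hxx') hxu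
      clear hxx'
      induction hx' using Submodule.span_induction with
      | mem r hr =>
        obtain ⟨⟨α, k⟩, rfl⟩ := hr
        have hα : monomialFamily (fun _ : Unit => t) (b ∘ a₀) (α, k) = t ^ α () * b (a₀ k) := by
          rw [monomialFamily, mpow, Finsupp.prod_fintype _ _ (by simp)]
          simp
        rw [hα]
        by_cases hlt : α () < q
        · exact ⟨_, Submodule.subset_span ⟨(a₀ k, ⟨α (), hlt⟩), rfl⟩, by simp⟩
        · refine ⟨0, Submodule.zero_mem _, ?_⟩
          rw [sub_zero]
          exact Ideal.mul_mem_right _ _ (Ideal.mem_of_dvd _ (pow_dvd_pow t (not_lt.mp hlt)) htqW)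
      | zero => exact ⟨0, Submodule.zero_mem _, by simp⟩
      | add x₁ x₂ _ _ h₁ h₂ =>
        obtain ⟨u₁, hu₁, hxu₁⟩ := h₁
        obtain ⟨u₂, hu₂, hxu₂⟩ := h₂
        refine ⟨u₁ + u₂, Submodule.add_mem _ hu₁ hu₂, ?_⟩
        rw [add_sub_add_comm]
        exact Ideal.add_mem _ hxu₁ hxu₂
      | smul s x₁ _ h₁ =>
        obtain ⟨u₁, hu₁, hxu₁⟩ := h₁
        refine ⟨s • u₁, Submodule.smul_mem _ _ hu₁, ?_⟩
        rw [← smul_sub]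
        exact Submodule.smul_of_tower_mem _ _ hxu₁)
  have : Finite κ := Finite.of_injective a ha
  let e := Finite.equivFin κ
  refine ⟨Nat.card κ, M', l', _, ?_, hl', ?_, hbasis.comp_equiv e.symm⟩
  · refine (Nat.card_le_card_of_injective a ha).trans ?_
    simpa using Nat.mul_le_mul_left m hq
  · intro i
    obtain ⟨n, hn⟩ := hb (a (e.symm i)).1
    exact ⟨_, (ht.pow _).mul hn⟩

/-- A homogeneous sequence which is regular up to a large degree, depending only on the degrees of
its members, is part of a system of parameters whose other members are linear forms. -/
theorem exists_isFreeBasis_of_regUpTo (r : ℕ) (w : Fin r → ℕ) (hw : ∀ i, 0 < w i) :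
    ∃ D e : ℕ, ∀ {K : Type u} [Field K] [Infinite K] {N : ℕ} (y : Fin r → MvPolynomial (Fin N) K),
      (∀ i, IsHomogeneous (y i) (w i)) → RegUpTo D y →
      ∃ (m M : ℕ) (l : Fin M → MvPolynomial (Fin N) K) (b : Fin m → MvPolynomial (Fin N) K),
        m ≤ e ∧ (∀ j, IsHomogeneous (l j) 1) ∧ (∀ i, ∃ n, IsHomogeneous (b i) n) ∧
        IsFreeBasis K (Sum.elim y l) b := by
  induction r with
  | zero =>
    refine ⟨0, 1, fun {K} _ _ {N} y _ _ => ⟨1, N, X, fun _ => 1, le_rfl, isHomogeneous_X K,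
      fun _ => ⟨0, isHomogeneous_one _ _⟩, ?_⟩⟩
    have h : IsFreeBasis K (X : Fin N → MvPolynomial (Fin N) K) (fun _ : Fin 1 => 1) := by
      have h1 : (basisMonomials (Fin N) K : (Fin N →₀ ℕ) → MvPolynomial (Fin N) K) ∘
          (Equiv.prodUnique (Fin N →₀ ℕ) (Fin 1)) =
          monomialFamily (X : Fin N → MvPolynomial (Fin N) K) (fun _ : Fin 1 => 1) := by
        ext1 ⟨α, k⟩
        simp [monomialFamily, mpow, monomial_eq]
      refine ⟨(linearIndependent_equiv' _ h1).mpr (basisMonomials (Fin N) K).linearIndependent, ?_⟩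
      rw [← h1, EquivLike.range_comp, (basisMonomials (Fin N) K).span_eq]
    convert h.of_equiv (Equiv.emptySum (Fin 0) (Fin N)) using 1
    ext1 (i | i)
    · exact i.elim0
    · simp
  | succ r ih =>
    obtain ⟨D, e, hD⟩ := ih (fun i => w i.castSucc) fun i => hw _
    refine ⟨max D (e * w (Fin.last r)), e * (e * w (Fin.last r)), fun {K} _ _ {N} y hy hreg => ?_⟩
    have himg : ∀ k : Fin r, y '' (Finset.Iio k.castSucc : Finset (Fin (r + 1))) =
        (fun i => y (Fin.castSucc i)) '' (Finset.Iio k : Finset (Fin r)) := by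
      intro k
      ext x
      constructor
      · rintro ⟨i, hi, rfl⟩
        have hi' : i < k.castSucc := by simpa using hi
        exact ⟨i.castPred (by rintro rfl; exact absurd hi' (Fin.le_last _).not_gt), by
          simpa [Fin.lt_def] using hi', by simp⟩
      · rintro ⟨i, hi, rfl⟩
        exact ⟨i.castSucc, by simpa using hi, rfl⟩
    have himg' : y '' (Finset.Iio (Fin.last r) : Finset (Fin (r + 1))) =
        Set.range fun i : Fin r => y i.castSucc := by
      ext x
      constructor
      · rintro ⟨i, hi, rfl⟩
        have hi' : i < Fin.last r := Finset.mem_Iio.mp hi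
        exact ⟨i.castPred hi'.ne, by simp⟩
      · rintro ⟨i, rfl⟩
        exact ⟨i.castSucc, by simp, rfl⟩
    obtain ⟨m, M, l, b, hm, hl, hb, hbasis⟩ := hD (fun i => y i.castSucc) (fun i => hy _) (by
      intro k n hn x hx hkx
      rw [← himg] at hkx ⊢
      exact hreg k.castSucc n (hn.trans (le_max_left _ _)) x hx hkx)
    obtain ⟨m', M', l', b', hm', hl', hb', hbasis'⟩ := hbasis.exists_sumElim (fun i => hw _)
      (fun i => hy _) hl hb (hw (Fin.last r)) (hy (Fin.last r)) (by
        intro n hn x hx hzx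
        rw [← himg'] at hzx ⊢
        exact hreg (Fin.last r) n ((hn.trans (Nat.mul_le_mul_right _ hm)).trans (le_max_right _ _))
          x hx hzx)
    refine ⟨m', M', l', b', hm'.trans (Nat.mul_le_mul hm (Nat.mul_le_mul_right _ hm)), hl', hb', ?_⟩
    let e₀ : Fin (r + 1) ≃ Fin r ⊕ Unit := finSuccEquivLast.trans (Equiv.optionEquivSumPUnit _)
    convert hbasis'.of_equiv ((((e₀.sumCongr (Equiv.refl (Fin M'))).trans
      (Equiv.sumAssoc _ _ _)).trans ((Equiv.refl _).sumCongr (Equiv.sumComm _ _))).trans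
      (Equiv.sumAssoc _ _ _).symm) using 1
    ext1 (i | i)
    · refine Fin.lastCases ?_ (fun i => ?_) i <;> simp [e₀]
    · simp

end FreeBasis

section StandardBasis

open scoped MonomialOrder

/-- There is a monomial order which compares weighted degrees first. -/
theorem exists_monomialOrder_weight {r : ℕ} (w : Fin r → ℕ) :
    ∃ o : MonomialOrder.{0, 0} (Fin r), ∀ a b, a ≼[o] b → Finsupp.weight w a ≤ Finsupp.weight w b := by
  let f : (Fin r →₀ ℕ) →+ ℕ ×ₗ Lex (Fin r →₀ ℕ) :=
    { toFun := fun a => toLex (Finsupp.weight w a, toLex a)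
      map_zero' := by simp
      map_add' := fun a b => by simp; rfl }
  let g : ℕ ×ₗ Lex (Fin r →₀ ℕ) → (Fin r →₀ ℕ) := fun x => ofLex (ofLex x).2
  have hgf : Function.LeftInverse g f := fun a => rfl
  have hle : ∀ a b, f a ≤ f b → Finsupp.weight w a ≤ Finsupp.weight w b := by
    intro a b h
    rcases Prod.Lex.le_iff.mp h with h | h
    · exact h.le
    · exact h.1.le
  have hmono : Monotone f := by
    intro a b h
    refine Prod.Lex.le_iff.mpr ?_
    have h1 : Finsupp.weight w a ≤ Finsupp.weight w b := by
      rw [← add_tsub_cancel_of_le h, map_add]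
      exact Nat.le_add_right _ _
    rcases h1.lt_or_eq with h1 | h1
    · exact Or.inl h1
    · exact Or.inr ⟨h1, Finsupp.toLex_monotone h⟩
  exact ⟨{ syn := AddMonoidHom.mrange f
           toSyn := AddEquiv.ofLeftInverse' f hgf
           toSyn_monotone := fun a b h => hmono h }, fun a b h => hle a b h⟩

theorem degree_map_of_monic {σ A k : Type*} [CommRing A] [CommRing k] [Nontrivial k]
    {o : MonomialOrder σ} (φ : A →+* k) {g : MvPolynomial σ A} (hg : o.Monic g) :
    o.degree (map φ g) = o.degree g := by
  refine o.toSyn.injective (le_antisymm ?_ ?_)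
  · exact MonomialOrder.degree_le_iff.mpr fun d hd =>
      MonomialOrder.le_degree (support_map_subset φ _ hd)
  · refine MonomialOrder.le_degree (mem_support_iff.mpr ?_)
    rw [coeff_map, hg.coeff_degree, map_one]
    exact one_ne_zero

theorem monic_map {σ A k : Type*} [CommRing A] [CommRing k] [Nontrivial k]
    {o : MonomialOrder σ} (φ : A →+* k) {g : MvPolynomial σ A} (hg : o.Monic g) :
    o.Monic (map φ g) := by
  rw [MonomialOrder.Monic, MonomialOrder.leadingCoeff, degree_map_of_monic φ hg, coeff_map,
    hg.coeff_degree, map_one]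

theorem exists_sum_eq_of_map {σ A k : Type*} [CommRing A] [CommRing k] [Nontrivial k] {L : ℕ}
    (o : MonomialOrder σ) (φ : A →+* k) {g : Fin L → MvPolynomial σ A} (hg : ∀ μ, o.Monic (g μ))
    (hker : ∀ p ∈ Ideal.span (Set.range g),
      (∀ β ∈ p.support, ∀ μ, ¬ o.degree (g μ) ≤ β) → map φ p = 0)
    {q : MvPolynomial σ k} (hq : q ∈ Ideal.span (Set.range fun μ => map φ (g μ))) :
    ∃ a : Fin L → MvPolynomial σ k, q = ∑ μ, a μ * map φ (g μ) ∧
      ∀ μ, o.degree (map φ (g μ) * a μ) ≼[o] o.degree q := by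
  classical
  have hdeg : ∀ μ, o.degree (map φ (g μ)) = o.degree (g μ) := fun μ => degree_map_of_monic φ (hg μ)
  have hmonic : ∀ μ, o.Monic (map φ (g μ)) := fun μ => monic_map φ (hg μ)
  have hdivC : ∀ p : MvPolynomial σ A, ∃ s, p - s ∈ Ideal.span (Set.range g) ∧
      ∀ β ∈ s.support, ∀ μ, ¬ o.degree (g μ) ≤ β := by
    intro p
    obtain ⟨a, s, h, -, hs⟩ := o.div (b := g) (fun μ => by rw [(hg μ).leadingCoeff_eq_one]; exact isUnit_one) p
    refine ⟨s, ?_, hs⟩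
    rw [h, add_sub_cancel_right]
    exact Finsupp.mem_ideal_span_range_iff_exists_finsupp.mpr ⟨a, by simp [Finsupp.linearCombination_apply]⟩
  choose s hs hs' using fun β => hdivC (monomial β 1)
  let ρ : MvPolynomial σ k →ₗ[k] MvPolynomial σ k :=
    (basisMonomials σ k).constr k fun β => map φ (s β)
  have hρ : ∀ β, ρ (monomial β 1) = map φ (s β) := by
    intro β
    have := (basisMonomials σ k).constr_basis k (fun β => map φ (s β)) β
    rwa [coe_basisMonomials] at this
  let ρC : MvPolynomial σ A →ₗ[A] MvPolynomial σ A := (basisMonomials σ A).constr A s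
  have hρC' : ∀ β, ρC (monomial β 1) = s β := by
    intro β
    have := (basisMonomials σ A).constr_basis A s β
    rwa [coe_basisMonomials] at this
  have hρC : ∀ p, p - ρC p ∈ Ideal.span (Set.range g) ∧
      ∀ β ∈ (ρC p).support, ∀ μ, ¬ o.degree (g μ) ≤ β := by
    intro p
    induction p using MvPolynomial.induction_on' with
    | monomial u a =>
      have hm : monomial u a = a • monomial u (1 : A) := by simp [smul_monomial]
      rw [hm, map_smul, hρC', ← smul_sub]
      exact ⟨Submodule.smul_of_tower_mem _ _ (hs u), fun β hβ => hs' u β (support_smul hβ)⟩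
    | add p q hp hq =>
      rw [map_add, add_sub_add_comm]
      refine ⟨Ideal.add_mem _ hp.1 hq.1, fun β hβ => ?_⟩
      rcases Finset.mem_union.mp (support_add hβ) with h | h
      exacts [hp.2 β h, hq.2 β h]
  have hρφ : ∀ p, ρ (map φ p) = map φ (ρC p) := by
    intro p
    induction p using MvPolynomial.induction_on' with
    | monomial u a =>
      have hm : monomial u a = C a * monomial u (1 : A) := by simp [C_mul_monomial]
      have hm' : map φ (monomial u a) = φ a • monomial u (1 : k) := by simp [smul_monomial]
      rw [hm', map_smul, hρ, hm, ← smul_eq_C_mul, map_smul, hρC', smul_eq_C_mul, smul_eq_C_mul,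
        map_mul, map_C]
    | add p q hp hq => simp only [map_add, hp, hq]
  have hρg : ∀ q ∈ Ideal.span (Set.range fun μ => map φ (g μ)), ρ q = 0 := by
    intro q hq
    obtain ⟨c, rfl⟩ := Finsupp.mem_ideal_span_range_iff_exists_finsupp.mp hq
    rw [Finsupp.sum, map_sum]
    refine Finset.sum_eq_zero fun μ _ => ?_
    induction c μ using MvPolynomial.induction_on' with
    | monomial u a =>
      have hm : monomial u a * map φ (g μ) = a • map φ (monomial u 1 * g μ) := by
        rw [map_mul, map_monomial, map_one, ← smul_mul_assoc, smul_monomial, smul_eq_mul, mul_one]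
      rw [hm, map_smul, hρφ, hker, smul_zero]
      · rw [← sub_sub_cancel (monomial u 1 * g μ) (ρC _)]
        exact Ideal.sub_mem _ (Ideal.mul_mem_left _ _ (Ideal.subset_span ⟨μ, rfl⟩)) (hρC _).1
      · exact (hρC _).2
    | add p q hp hq => rw [add_mul, map_add, hp, hq, add_zero]
  have hρid : ∀ q : MvPolynomial σ k, (∀ β ∈ q.support, ∀ μ, ¬ o.degree (g μ) ≤ β) → ρ q = q := by
    intro q hq
    have h1 : ∀ β ∈ q.support, ρ (monomial β 1) = monomial β 1 := by
      intro β hβ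
      rw [hρ, ← map_one φ, ← map_monomial, ← sub_eq_zero, ← map_sub]
      refine hker _ (neg_sub (monomial β 1) (s β) ▸ neg_mem (hs β)) fun γ hγ => ?_
      rcases Finset.mem_union.mp (support_sub _ _ _ hγ) with h | h
      · exact hs' β γ h
      · rw [Finset.mem_singleton.mp (support_monomial_subset h)]
        exact hq β hβ
    conv_rhs => rw [← support_sum_monomial_coeff q]
    conv_lhs => rw [← support_sum_monomial_coeff q]
    rw [map_sum]
    refine Finset.sum_congr rfl fun β hβ => ?_
    have hm : monomial β (coeff β q) = coeff β q • monomial β (1 : k) := by simp [smul_monomial]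
    rw [hm, map_smul, h1 β hβ]
  obtain ⟨a, t, h, ha, ht⟩ := o.div (b := fun μ => map φ (g μ))
    (fun μ => by rw [(hmonic μ).leadingCoeff_eq_one]; exact isUnit_one) q
  have hlin : Finsupp.linearCombination _ (fun μ => map φ (g μ)) a = ∑ μ, a μ * map φ (g μ) := by
    rw [Finsupp.linearCombination_apply, Finsupp.sum_fintype _ _ (by simp)]
    rfl
  rw [hlin] at h
  have ht0 : t = 0 := by
    rw [← hρid t fun β hβ μ => hdeg μ ▸ ht β hβ μ]
    refine hρg t ?_
    rw [← sub_eq_iff_eq_add'.mpr h]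
    exact Ideal.sub_mem _ hq (Ideal.sum_mem _ fun μ _ =>
      Ideal.mul_mem_left _ _ (Ideal.subset_span ⟨μ, rfl⟩))
  exact ⟨a, by rw [h, ht0, add_zero], ha⟩

end StandardBasis

section StandardBasis

open scoped MonomialOrder

/-- Every ideal of a polynomial ring in finitely many variables over a field has a Gröbner basis. -/
theorem exists_groebnerBasis {r : ℕ} {k : Type*} [Field k] (o : MonomialOrder (Fin r))
    (I : Ideal (MvPolynomial (Fin r) k)) :
    ∃ (L : ℕ) (g : Fin L → MvPolynomial (Fin r) k), (∀ μ, o.Monic (g μ)) ∧ (∀ μ, g μ ∈ I) ∧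
      ∀ p ∈ I, (∀ β ∈ p.support, ∀ μ, ¬ o.degree (g μ) ≤ β) → p = 0 := by
  let P : (Fin r →₀ ℕ) → Prop := fun α => ∃ p ∈ I, o.Monic p ∧ o.degree p = α
  have hP : ∀ p ∈ I, p ≠ 0 → P (o.degree p) := by
    intro p hp h0
    have hu : (o.leadingCoeff p)⁻¹ ≠ 0 := inv_ne_zero (o.leadingCoeff_ne_zero_iff.mpr h0)
    refine ⟨(o.leadingCoeff p)⁻¹ • p, Submodule.smul_of_tower_mem _ _ hp, ?_,
      o.degree_smul_of_isRegular (IsRegular.of_ne_zero hu)⟩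
    rw [MonomialOrder.Monic, MonomialOrder.leadingCoeff,
      o.degree_smul_of_isRegular (IsRegular.of_ne_zero hu), coeff_smul, smul_eq_mul]
    exact inv_mul_cancel₀ (o.leadingCoeff_ne_zero_iff.mpr h0)
  have hfin : {α | Minimal P α}.Finite :=
    WellQuasiOrderedLE.finite_of_isAntichain (setOfPred_minimal_antichain P)
  obtain ⟨L, ⟨e⟩⟩ : ∃ L, Nonempty (Fin L ≃ {α | Minimal P α}) := by
    have := hfin.fintype
    exact ⟨_, ⟨(Fintype.equivFin _).symm⟩⟩
  choose g hgI hg hdeg using fun μ => (e μ).2.prop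
  refine ⟨L, g, hg, hgI, fun p hp hoff => ?_⟩
  by_contra h0
  obtain ⟨α, hα, hmin⟩ := exists_minimal_le_of_wellFoundedLT P _ (hP p hp h0)
  refine hoff _ (o.degree_mem_support h0) (e.symm ⟨α, hmin⟩) ?_
  rw [hdeg, Equiv.apply_symm_apply]
  exact hα

theorem span_range_eq_of_groebnerBasis {r L : ℕ} {k : Type*} [Field k] (o : MonomialOrder (Fin r))
    {I : Ideal (MvPolynomial (Fin r) k)} {g : Fin L → MvPolynomial (Fin r) k}
    (hg : ∀ μ, o.Monic (g μ)) (hgI : ∀ μ, g μ ∈ I)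
    (H : ∀ p ∈ I, (∀ β ∈ p.support, ∀ μ, ¬ o.degree (g μ) ≤ β) → p = 0) :
    Ideal.span (Set.range g) = I := by
  have hle : Ideal.span (Set.range g) ≤ I := Ideal.span_le.mpr (Set.range_subset_iff.mpr hgI)
  refine le_antisymm hle fun p hp => ?_
  obtain ⟨a, s, h, -, hs⟩ := o.div (b := g)
    (fun μ => by rw [(hg μ).leadingCoeff_eq_one]; exact isUnit_one) p
  have hmem : Finsupp.linearCombination _ g a ∈ Ideal.span (Set.range g) :=
    Finsupp.mem_ideal_span_range_iff_exists_finsupp.mpr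
      ⟨a, by simp [Finsupp.linearCombination_apply]⟩
  have hs0 : s = 0 := by
    refine H s ?_ hs
    rw [← sub_eq_iff_eq_add'.mpr h]
    exact I.sub_mem hp (hle hmem)
  rwa [h, hs0, add_zero]

end StandardBasis

section Ultraproduct

namespace UProd

variable {U : Ultrafilter ℕ}

/-- A finitely generated subring of an ultraproduct of fields maps to almost all factors. -/
theorem exists_ringHom {K : ℕ → Type u} [∀ m, Field (K m)] (S : Finset (UProd U K)) :
    ∃ F : ∀ m, Algebra.adjoin ℤ (S : Set (UProd U K)) → K m,
      (∀ a, mk U (fun m => F m a) = (a : UProd U K)) ∧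
      ∀ᶠ m in U, ∃ φ : Algebra.adjoin ℤ (S : Set (UProd U K)) →+* K m, ∀ a, φ a = F m a := by
  let π : MvPolynomial S ℤ →ₐ[ℤ] UProd U K := aeval fun s => (s : UProd U K)
  let ψ : ∀ m, MvPolynomial S ℤ →ₐ[ℤ] K m := fun m => aeval fun s => rep (s : UProd U K) m
  have hπ : ∀ p, mk U (fun m => ψ m p) = π p := by
    intro p
    have : (mk U).comp (RingHom.pi fun m => (ψ m : MvPolynomial S ℤ →+* K m)) = π := by
      refine MvPolynomial.ringHom_ext' (Subsingleton.elim _ _) fun s => ?_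
      simp only [RingHom.comp_apply, π, RingHom.coe_coe, aeval_X]
      rw [← mk_rep (s : UProd U K)]
      congr 1
      ext1 m
      exact aeval_X _ s
    exact congrArg (fun f => f p) this
  have hrange : ∀ a : Algebra.adjoin ℤ (S : Set (UProd U K)), ∃ p, π p = a := by
    rintro ⟨a, ha⟩
    rw [Algebra.adjoin_eq_range] at ha
    exact ha
  choose p hp using hrange
  refine ⟨fun m a => ψ m (p a), fun a => by rw [hπ, hp], ?_⟩
  obtain ⟨T, hT⟩ := (isNoetherianRing_iff_ideal_fg _).mp inferInstance (RingHom.ker π)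
  have hTm : ∀ᶠ m in U, ∀ t ∈ T, ψ m t = 0 := by
    rw [Filter.eventually_all_finset]
    intro t ht
    rw [← mk_eq_zero (a := fun m => ψ m t), hπ]
    exact (RingHom.mem_ker).mp (hT ▸ Ideal.subset_span ht)
  filter_upwards [hTm] with m hm
  have hker : ∀ x, π x = 0 → ψ m x = 0 := by
    have : RingHom.ker π ≤ RingHom.ker (ψ m) := by
      rw [← hT]
      exact Ideal.span_le.mpr hm
    exact fun x hx => this hx
  have hcongr : ∀ x y, π x = π y → ψ m x = ψ m y := by
    intro x y h
    rw [← sub_eq_zero, ← map_sub]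
    exact hker _ (by rw [map_sub, h, sub_self])
  exact ⟨{ toFun := fun a => ψ m (p a)
           map_one' := by rw [← map_one (ψ m)]; exact hcongr _ _ (by rw [hp, map_one]; rfl)
           map_zero' := by rw [← map_zero (ψ m)]; exact hcongr _ _ (by rw [hp, map_zero]; rfl)
           map_mul' := fun a b => by
             rw [← map_mul]
             exact hcongr _ _ (by rw [hp, map_mul, hp, hp]; rfl)
           map_add' := fun a b => by
             rw [← map_add]
             exact hcongr _ _ (by rw [hp, map_add, hp, hp]; rfl) }, fun a => rfl⟩

end UProd

end Ultraproduct

section Ultraproduct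

open scoped MonomialOrder

namespace UProd

variable {U : Ultrafilter ℕ} {K : ℕ → Type u} [∀ m, Field (K m)]

/-- The polynomial obtained by applying a function to the nonzero coefficients. -/
noncomputable def mapCoeff {σ A k : Type*} [CommSemiring A] [CommSemiring k] (φ : A → k)
    (p : MvPolynomial σ A) : MvPolynomial σ k :=
  ∑ α ∈ p.support, monomial α (φ (coeff α p))

theorem map_eq_mapCoeff {σ A k : Type*} [CommSemiring A] [CommSemiring k] (φ : A →+* k)
    (p : MvPolynomial σ A) : MvPolynomial.map φ p = mapCoeff φ p := by
  conv_lhs => rw [← support_sum_monomial_coeff p]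
  simp only [map_sum, map_monomial, mapCoeff]

theorem aeval_mapCoeff {r : ℕ} {A : Subalgebra ℤ (UProd U K)} {φ : ∀ m, A → K m}
    (hφ : ∀ a, mk U (fun m => φ m a) = (a : UProd U K)) {N : ℕ → ℕ} (y : ∀ m, Fin r → Poly K N m)
    (p : MvPolynomial (Fin r) A) :
    aeval (fun j => mk U fun m => y m j) (MvPolynomial.map (algebraMap A (UProd U K)) p) =
      mk U fun m => aeval (y m) (mapCoeff (φ m) p) := by
  rw [map_eq_mapCoeff, mapCoeff, map_sum]
  have h : (fun m => aeval (y m) (mapCoeff (φ m) p)) = ∑ α ∈ p.support,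
      (fun m => (C (φ m (coeff α p)) : Poly K N m)) * ∏ j ∈ α.support, (fun m => y m j) ^ α j := by
    ext1 m
    simp only [mapCoeff, map_sum, aeval_monomial, Finsupp.prod, algebraMap_eq, Finset.sum_apply,
      Pi.mul_apply, Finset.prod_apply, Pi.pow_apply]
  rw [h, map_sum]
  refine Finset.sum_congr rfl fun α _ => ?_
  rw [aeval_monomial, map_mul, ← algebraMap_mk, hφ, map_prod, Finsupp.prod]
  simp only [map_pow]
  rfl

theorem exists_standardBasis {r n : ℕ} (w : Fin r → ℕ)
    (F : Fin n → MvPolynomial (Fin r) (UProd U K)) :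
    ∃ (L : ℕ) (G : ∀ m, Fin n → MvPolynomial (Fin r) (K m))
      (g : ∀ m, Fin L → MvPolynomial (Fin r) (K m)) (e : Fin L → ℕ),
      (∀ (N : ℕ → ℕ) (y : ∀ m, Fin r → Poly K N m) (i : Fin n),
        aeval (fun j => mk U fun m => y m j) (F i) = mk U fun m => aeval (y m) (G m i)) ∧
      ∀ᶠ m in U, (∀ μ, g m μ ∈ Ideal.span (Set.range (G m))) ∧
        (∀ μ, ∀ α ∈ (g m μ).support, Finsupp.weight w α ≤ e μ) ∧
        ∀ q ∈ Ideal.span (Set.range (G m)), ∀ D, (∀ α ∈ q.support, Finsupp.weight w α ≤ D) →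
          ∃ a : Fin L → MvPolynomial (Fin r) (K m), q = ∑ μ, a μ * g m μ ∧
            ∀ μ, ∀ α ∈ (a μ).support, Finsupp.weight w α + e μ ≤ D := by
  classical
  obtain ⟨o, ho⟩ := exists_monomialOrder_weight w
  obtain ⟨L, g, hg, hgI, H⟩ := exists_groebnerBasis o (Ideal.span (Set.range F))
  have hspan := span_range_eq_of_groebnerBasis o hg hgI H
  choose a ha using fun μ => Ideal.mem_span_range_iff_exists_fun.mp (hgI μ)
  choose b hb using fun i => Ideal.mem_span_range_iff_exists_fun.mp
    (hspan.symm ▸ Ideal.subset_span ⟨i, rfl⟩ : F i ∈ Ideal.span (Set.range g))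
  let S : Finset (UProd U K) := (Finset.univ.biUnion fun i => (F i).coeffs) ∪
    (Finset.univ.biUnion fun μ => (g μ).coeffs) ∪
    (Finset.univ.biUnion fun μ => Finset.univ.biUnion fun i => (a μ i).coeffs) ∪
    (Finset.univ.biUnion fun i => Finset.univ.biUnion fun μ => (b i μ).coeffs)
  let A := Algebra.adjoin ℤ (S : Set (UProd U K))
  have hinj : Function.Injective (MvPolynomial.map (σ := Fin r) (algebraMap A (UProd U K))) :=
    map_injective _ Subtype.val_injective
  have hlift : ∀ p : MvPolynomial (Fin r) (UProd U K), p.coeffs ⊆ S →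
      ∃ p', MvPolynomial.map (algebraMap A (UProd U K)) p' = p := by
    intro p hp
    refine mem_range_map_iff_coeffs_subset.mpr fun c hc => ?_
    exact ⟨⟨c, Algebra.subset_adjoin (hp hc)⟩, rfl⟩
  choose F' hF' using fun i => hlift (F i) fun c hc => by
    simp only [S, Finset.mem_union, Finset.mem_biUnion, Finset.mem_univ, true_and]
    exact Or.inl (Or.inl (Or.inl ⟨i, hc⟩))
  choose g' hg' using fun μ => hlift (g μ) fun c hc => by
    simp only [S, Finset.mem_union, Finset.mem_biUnion, Finset.mem_univ, true_and]
    exact Or.inl (Or.inl (Or.inr ⟨μ, hc⟩))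
  choose a' ha' using fun μ i => hlift (a μ i) fun c hc => by
    simp only [S, Finset.mem_union, Finset.mem_biUnion, Finset.mem_univ, true_and]
    exact Or.inl (Or.inr ⟨μ, i, hc⟩)
  choose b' hb' using fun i μ => hlift (b i μ) fun c hc => by
    simp only [S, Finset.mem_union, Finset.mem_biUnion, Finset.mem_univ, true_and]
    exact Or.inr ⟨i, μ, hc⟩
  have hga : ∀ μ, ∑ i, a' μ i * F' i = g' μ := fun μ => hinj (by simp [hF', hg', ha', ha])
  have hFb : ∀ i, ∑ μ, b' i μ * g' μ = F' i := fun i => hinj (by simp [hF', hg', hb', hb])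
  have hsupp : ∀ p : MvPolynomial (Fin r) A,
      (MvPolynomial.map (algebraMap A (UProd U K)) p).support = p.support := fun p =>
    support_map_of_injective p Subtype.val_injective
  have hdeg : ∀ μ, o.degree (g' μ) = o.degree (g μ) := by
    intro μ
    rw [MonomialOrder.degree, MonomialOrder.degree, ← hg', hsupp]
  have hmonic : ∀ μ, o.Monic (g' μ) := by
    intro μ
    apply Subtype.val_injective
    have h := (hg μ).leadingCoeff_eq_one
    rw [MonomialOrder.leadingCoeff, ← hg', coeff_map, hg', ← hdeg] at h
    exact h
  have hker : ∀ p ∈ Ideal.span (Set.range g'),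
      (∀ β ∈ p.support, ∀ μ, ¬ o.degree (g' μ) ≤ β) → p = 0 := by
    intro p hp hoff
    apply hinj
    rw [map_zero]
    refine H _ ?_ fun β hβ μ => ?_
    · rw [← hspan]
      have := Ideal.mem_map_of_mem (MvPolynomial.map (algebraMap A (UProd U K))) hp
      rwa [Ideal.map_span, ← Set.range_comp, Function.comp_def, funext hg'] at this
    · rw [← hdeg]
      exact hoff β (hsupp p ▸ hβ) μ
  obtain ⟨φ, hφ, hφ'⟩ := exists_ringHom S
  refine ⟨L, fun m i => mapCoeff (φ m) (F' i), fun m μ => mapCoeff (φ m) (g' μ),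
    fun μ => Finsupp.weight w (o.degree (g' μ)), fun N y i => ?_, ?_⟩
  · rw [← hF', aeval_mapCoeff hφ]
  filter_upwards [hφ'] with m ⟨θ, hθ⟩
  have hθ' : φ m = θ := funext fun x => (hθ x).symm
  simp only [hθ', ← map_eq_mapCoeff]
  have hGg : Ideal.span (Set.range fun i => MvPolynomial.map θ (F' i)) =
      Ideal.span (Set.range fun μ => MvPolynomial.map θ (g' μ)) := by
    refine le_antisymm ?_ ?_
    · refine Ideal.span_le.mpr (Set.range_subset_iff.mpr fun i => ?_)
      exact Ideal.mem_span_range_iff_exists_fun.mpr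
        ⟨fun μ => MvPolynomial.map θ (b' i μ), by rw [← hFb]; simp⟩
    · refine Ideal.span_le.mpr (Set.range_subset_iff.mpr fun i => ?_)
      exact Ideal.mem_span_range_iff_exists_fun.mpr
        ⟨fun μ => MvPolynomial.map θ (a' i μ), by rw [← hga]; simp⟩
  refine ⟨fun μ => hGg ▸ Ideal.subset_span ⟨μ, rfl⟩, fun μ α hα => ?_, fun q hq D hD => ?_⟩
  · exact ho _ _ (MonomialOrder.le_degree (support_map_subset θ _ hα))
  · obtain ⟨c, hqc, hc⟩ := exists_sum_eq_of_map o θ hmonic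
      (fun p hp hoff => by rw [hker p hp hoff, map_zero]) (hGg ▸ hq)
    refine ⟨c, hqc, fun μ α hα => ?_⟩
    have hc0 : c μ ≠ 0 := by
      rintro h
      simp [h] at hα
    have hcμ := ho _ _ (hc μ)
    rw [o.degree_mul (monic_map θ (hmonic μ)).ne_zero hc0, degree_map_of_monic θ (hmonic μ),
      map_add] at hcμ
    have h1 := ho _ _ (MonomialOrder.le_degree (m := o) hα)
    have h2 : Finsupp.weight w (o.degree q) ≤ D := by
      by_cases hq0 : q = 0
      · simp [hq0]
      · exact hD _ (o.degree_mem_support hq0)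
    omega

end UProd

end Ultraproduct

section LeadingForms

variable {σ ι κ K : Type*} [Field K]

theorem weightedHomogeneousComponent_mul_of_le {w : σ → ℕ} {a g : MvPolynomial σ K} {s t : ℕ}
    (ha : ∀ α ∈ a.support, Finsupp.weight w α ≤ s)
    (hg : ∀ α ∈ g.support, Finsupp.weight w α ≤ t) :
    weightedHomogeneousComponent w (s + t) (a * g) =
      weightedHomogeneousComponent w s a * weightedHomogeneousComponent w t g := by
  conv_lhs => rw [← sum_range_weightedHomogeneousComponent fun α hα => Nat.lt_succ_of_le (ha α hα),
    Finset.sum_mul, map_sum]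
  rw [Finset.sum_eq_single_of_mem s (Finset.self_mem_range_succ s)]
  · rw [weightedHomogeneousComponent_mul_eq (weightedHomogeneousComponent_isWeightedHomogeneous s a),
      if_pos (Nat.le_add_right s t), add_tsub_cancel_left]
  · intro i hi his
    have hi' := Finset.mem_range_succ_iff.mp hi
    rw [weightedHomogeneousComponent_mul_eq (weightedHomogeneousComponent_isWeightedHomogeneous i a),
      if_pos (by omega), weightedHomogeneousComponent_eq_zero' _ g, mul_zero]
    intro α hα
    have := hg α hα
    omega

theorem isHomogeneous_aeval_of_isWeightedHomogeneous {w : ι → ℕ} {y : ι → MvPolynomial σ K}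
    (hy : ∀ i, IsHomogeneous (y i) (w i)) {P : MvPolynomial ι K} {n : ℕ}
    (hP : IsWeightedHomogeneous w P n) : IsHomogeneous (aeval y P) n :=
  aeval_mem_of_isWeightedHomogeneous (𝒜 := homogeneousSubmodule σ K) hy hP

theorem homogeneousComponent_aeval_eq {w : ι → ℕ} {y : ι → MvPolynomial σ K}
    (hy : ∀ i, IsHomogeneous (y i) (w i)) (P : MvPolynomial ι K) (n : ℕ) :
    homogeneousComponent n (aeval y P) = aeval y (weightedHomogeneousComponent w n P) := by
  obtain ⟨M, hM, hnM⟩ : ∃ M, (∀ α ∈ P.support, Finsupp.weight w α < M) ∧ n < M := by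
    refine ⟨max (P.support.sup (Finsupp.weight w)) n + 1, fun α hα => ?_, by omega⟩
    have := Finset.le_sup (f := Finsupp.weight w) hα
    omega
  conv_lhs => rw [← sum_range_weightedHomogeneousComponent hM, map_sum, map_sum]
  rw [Finset.sum_eq_single_of_mem n (Finset.mem_range.mpr hnM)]
  · rw [homogeneousComponent_of_mem (isHomogeneous_aeval_of_isWeightedHomogeneous hy
      (weightedHomogeneousComponent_isWeightedHomogeneous n P)), if_pos rfl]
  · intro i _ hin
    rw [homogeneousComponent_of_mem (isHomogeneous_aeval_of_isWeightedHomogeneous hy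
      (weightedHomogeneousComponent_isWeightedHomogeneous i P)), if_neg hin.symm]

theorem IsFreeBasis.exists_eq_sum {R : Type*} [CommRing R] [Algebra K R] {v : ι → R} {b : κ → R}
    (h : IsFreeBasis K v b) (x : R) :
    ∃ c : κ →₀ MvPolynomial ι K, x = c.sum fun k P => aeval v P * b k := by
  have hr : x ∈ Submodule.span K (Set.range (monomialFamily v b)) := by
    rw [h.span_eq_top]; trivial
  induction hr using Submodule.span_induction with
  | mem r hr =>
    obtain ⟨⟨α, k⟩, rfl⟩ := hr
    refine ⟨Finsupp.single k (monomial α 1), ?_⟩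
    rw [Finsupp.sum_single_index (by simp), aeval_monomial, map_one, one_mul]
    rfl
  | zero => exact ⟨0, by simp⟩
  | add x y _ _ hx hy =>
    obtain ⟨c, rfl⟩ := hx
    obtain ⟨d, rfl⟩ := hy
    exact ⟨c + d, by classical rw [Finsupp.sum_add_index' (by simp) (by simp [add_mul])]⟩
  | smul a x _ hx =>
    obtain ⟨c, rfl⟩ := hx
    exact ⟨a • c, by
      rw [Finsupp.sum_smul_index' (by simp), Finsupp.smul_sum]; simp⟩

theorem IsFreeBasis.exists_eq_sum_of_mem {R : Type*} [CommRing R] [Algebra K R] {n : ℕ}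
    {v : ι → R} {b : κ → R}
    (h : IsFreeBasis K v b) {F : Fin n → MvPolynomial ι K} {x : R}
    (hx : x ∈ Ideal.span (Set.range fun i => aeval v (F i))) :
    ∃ (s : Finset κ) (P : κ → MvPolynomial ι K), (∀ k, P k ∈ Ideal.span (Set.range F)) ∧
      x = ∑ k ∈ s, aeval v (P k) * b k := by
  classical
  obtain ⟨c, rfl⟩ := Ideal.mem_span_range_iff_exists_fun.mp hx
  choose C hC using fun i => h.exists_eq_sum (c i)
  refine ⟨Finset.univ.biUnion fun i => (C i).support, fun k => ∑ i, C i k * F i, fun k =>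
    Ideal.sum_mem _ fun i _ => Ideal.mul_mem_left _ _ (Ideal.subset_span ⟨i, rfl⟩), ?_⟩
  simp only [map_sum, map_mul, Finset.sum_mul]
  rw [Finset.sum_comm]
  refine Finset.sum_congr rfl fun i _ => ?_
  rw [hC i, Finsupp.sum_of_support_subset _
    (Finset.subset_biUnion_of_mem (fun i => (C i).support) (Finset.mem_univ i)) _ (by simp),
    Finset.sum_mul]
  exact Finset.sum_congr rfl fun k _ => by ring

theorem IsFreeBasis.span_leadingForms {w : ι → ℕ} {y : ι → MvPolynomial σ K}
    (hy : ∀ i, IsHomogeneous (y i) (w i)) {b : κ → MvPolynomial σ K} (h : IsFreeBasis K y b)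
    {δ : κ → ℕ} (hb : ∀ k, IsHomogeneous (b k) (δ k)) {n L : ℕ} {F : Fin n → MvPolynomial ι K}
    {g : Fin L → MvPolynomial ι K} {e : Fin L → ℕ} (hgF : ∀ μ, g μ ∈ Ideal.span (Set.range F))
    (hge : ∀ μ, ∀ α ∈ (g μ).support, Finsupp.weight w α ≤ e μ)
    (hF : ∀ q ∈ Ideal.span (Set.range F), ∀ D, (∀ α ∈ q.support, Finsupp.weight w α ≤ D) →
      ∃ a : Fin L → MvPolynomial ι K, q = ∑ μ, a μ * g μ ∧
        ∀ μ, ∀ α ∈ (a μ).support, Finsupp.weight w α + e μ ≤ D) :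
    Ideal.span (Set.range fun μ => aeval y (weightedHomogeneousComponent w (e μ) (g μ))) =
      Ideal.span {G | ∃ p ∈ Ideal.span (Set.range fun i => aeval y (F i)), p ≠ 0 ∧
        G = homogeneousComponent p.totalDegree p} := by
  classical
  refine le_antisymm (Ideal.span_le.mpr ?_) (Ideal.span_le.mpr ?_)
  · rintro _ ⟨μ, rfl⟩
    by_cases h0 : aeval y (weightedHomogeneousComponent w (e μ) (g μ)) = 0
    · dsimp only
      rw [h0]
      exact Ideal.zero_mem _
    refine Ideal.subset_span ⟨aeval y (g μ), ?_, ?_, ?_⟩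
    · have := Ideal.mem_map_of_mem (aeval y) (hgF μ)
      rwa [Ideal.map_span, ← Set.range_comp] at this
    · rintro h1
      rw [← homogeneousComponent_aeval_eq hy, h1, map_zero] at h0
      exact h0 rfl
    · have hle : (aeval y (g μ)).totalDegree = e μ := by
        refine le_antisymm ?_ ?_
        · refine Finset.sup_le fun β hβ => ?_
          by_contra! hlt
          have h1 : homogeneousComponent β.degree (aeval y (g μ)) = 0 := by
            rw [homogeneousComponent_aeval_eq hy, weightedHomogeneousComponent_eq_zero' _ (g μ),
              map_zero]
            exact fun α hα => ((hge μ α hα).trans_lt hlt).ne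
          have h2 := congrArg (coeff β) h1
          rw [coeff_homogeneousComponent, if_pos rfl, coeff_zero] at h2
          exact mem_support_iff.mp hβ h2
        · by_contra! hlt
          exact h0 (by rw [← homogeneousComponent_aeval_eq hy, homogeneousComponent_eq_zero _ _ hlt])
      rw [hle, homogeneousComponent_aeval_eq hy]
  · rintro _ ⟨p, hp, hp0, rfl⟩
    obtain ⟨s, P, hPF, hpP⟩ := h.exists_eq_sum_of_mem hp
    let Q : ℕ → κ → MvPolynomial ι K := fun D k =>
      if δ k ≤ D then weightedHomogeneousComponent w (D - δ k) (P k) else 0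
    have hcomp : ∀ D, homogeneousComponent D p = ∑ k ∈ s, aeval y (Q D k) * b k := by
      intro D
      conv_lhs => rw [hpP, map_sum]
      refine Finset.sum_congr rfl fun k _ => ?_
      rw [mul_comm]
      refine (weightedHomogeneousComponent_mul_eq (hb k) _ D).trans ?_
      simp only [Q]
      split_ifs with hD
      · rw [mul_comm, ← homogeneousComponent_aeval_eq hy]
        rfl
      · simp
    have hQ0 : ∀ D, p.totalDegree < D → ∀ k ∈ s, Q D k = 0 := fun D hD =>
      linearIndependent_monomialFamily_iff.mp h.linearIndependent s (Q D)
        (by rw [← hcomp, homogeneousComponent_eq_zero _ _ hD])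
    have hweight : ∀ k ∈ s, ∀ α ∈ (P k).support, Finsupp.weight w α + δ k ≤ p.totalDegree := by
      intro k hk α hα
      by_contra! hlt
      have h1 := congrArg (coeff α) (hQ0 _ hlt k hk)
      simp only [Q] at h1
      rw [if_pos (Nat.le_add_left _ _), add_tsub_cancel_right, coeff_weightedHomogeneousComponent,
        if_pos rfl, coeff_zero] at h1
      exact mem_support_iff.mp hα h1
    change homogeneousComponent p.totalDegree p ∈ _
    rw [hcomp]
    refine Ideal.sum_mem _ fun k hk => Ideal.mul_mem_right _ _ ?_
    simp only [Q]
    split_ifs with hD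
    · obtain ⟨a, hPa, ha⟩ := hF (P k) (hPF k) (p.totalDegree - δ k)
        fun α hα => Nat.le_sub_of_add_le (hweight k hk α hα)
      rw [hPa, map_sum, map_sum]
      refine Ideal.sum_mem _ fun μ _ => ?_
      by_cases hle : e μ ≤ p.totalDegree - δ k
      · obtain ⟨t, ht⟩ := Nat.exists_eq_add_of_le' hle
        rw [ht, weightedHomogeneousComponent_mul_of_le (fun α hα => ?_) (hge μ), map_mul]
        · exact Ideal.mul_mem_left _ _ (Ideal.subset_span ⟨μ, rfl⟩)
        · have := ha μ α hα
          omega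
      · have : a μ = 0 := by
          rw [← support_eq_empty, Finset.eq_empty_iff_forall_notMem]
          intro α hα
          have := ha μ α hα
          omega
        simp [this]
    · simp

end LeadingForms

section LeadingForms

theorem UProd.exists_eventually_generators (U : Ultrafilter ℕ) {K : ℕ → Type u} [∀ m, Field (K m)]
    [∀ m, IsAlgClosed (K m)] {N : ℕ → ℕ} {n d : ℕ} (f : ∀ m, Fin n → Poly K N m)
    (hf : ∀ m i, (f m i).totalDegree ≤ d) :
    ∃ L : ℕ, ∀ᶠ m in U, ∃ g : Fin L → Poly K N m, Ideal.span (Set.range g) =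
      Ideal.span {F | ∃ p ∈ Ideal.span (Set.range (f m)), p ≠ 0 ∧
        F = homogeneousComponent p.totalDegree p} := by
  obtain ⟨r, w, y, F, hw, hy, hreg, hF⟩ := UProd.exists_regUpTo (U := U) f hf
  obtain ⟨L, G, g, e, hFG, hg⟩ := UProd.exists_standardBasis w F
  obtain ⟨D, _, hD⟩ := exists_isFreeBasis_of_regUpTo.{u} r w hw
  have hfG : ∀ᶠ m in U, ∀ i, aeval (y m) (G m i) = f m i := by
    rw [Filter.eventually_all]
    intro i
    rw [← UProd.mk_eq_mk, ← hFG, hF]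
  refine ⟨L, ?_⟩
  filter_upwards [hfG, hg, hreg D] with m hm ⟨hg1, hg2, hg3⟩ hregm
  have : Infinite (K m) := IsAlgClosed.instInfinite
  obtain ⟨q, M, l, b, -, hl, hb, hbasis⟩ := hD (y m) (hy m) hregm
  choose δ hδ using hb
  have hhom : ∀ p : (Fin M →₀ ℕ) × Fin q,
      IsHomogeneous (monomialFamily l b p) (Finsupp.weight (fun _ => 1) p.1 + δ p.2) := by
    rintro ⟨α, k⟩
    refine IsHomogeneous.mul ?_ (hδ k)
    have h1 := isHomogeneous_aeval_of_isWeightedHomogeneous hl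
      (isWeightedHomogeneous_monomial (fun _ => 1) α (1 : K m) rfl)
    rwa [aeval_monomial, map_one, one_mul] at h1
  refine ⟨_, (hbasis.sumElim_left.span_leadingForms (hy m) hhom hg1 hg2 hg3).trans ?_⟩
  rw [funext hm]

end LeadingForms

/-- There is a function `L`, independent of `N` and `K`, such that for every
algebraically closed field `K` and every ideal `I` of `R = K[x_1, …, x_N]` generated by `n`
polynomials of degree at most `d`, the ideal generated by the leading forms (top-degree
homogeneous components) of all nonzero elements of `I` can be generated by at most `L n d`
elements. -/
theorem statement14 :
    ∃ L : ℕ → ℕ → ℕ,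
      ∀ (K : Type u) [Field K] [IsAlgClosed K] (N n d : ℕ)
        (f : Fin n → MvPolynomial (Fin N) K),
        (∀ i, (f i).totalDegree ≤ d) →
        ∃ g : Fin (L n d) → MvPolynomial (Fin N) K,
          Ideal.span (Set.range g) =
            Ideal.span {F | ∃ p ∈ Ideal.span (Set.range f), p ≠ 0 ∧
              F = homogeneousComponent p.totalDegree p} := by
  have key : ∀ n d : ℕ, ∃ L : ℕ, ∀ (K : Type u) [Field K] [IsAlgClosed K] (N : ℕ)
      (f : Fin n → MvPolynomial (Fin N) K), (∀ i, (f i).totalDegree ≤ d) →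
        ∃ g : Fin L → MvPolynomial (Fin N) K,
          Ideal.span (Set.range g) =
            Ideal.span {F | ∃ p ∈ Ideal.span (Set.range f), p ≠ 0 ∧
              F = homogeneousComponent p.totalDegree p} := by
    intro n d
    by_contra! hcon
    choose K hK hKa N f hf hno using hcon
    obtain ⟨L, hL⟩ := UProd.exists_eventually_generators (Filter.hyperfilter ℕ) f hf
    obtain ⟨m, ⟨g, hg⟩, hLm⟩ := (hL.and
      (Nat.hyperfilter_le_atTop (Filter.eventually_ge_atTop L))).exists
    refine hno m (fun j => if h : j.1 < L then g ⟨j, h⟩ else 0) ?_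
    rw [← hg]
    refine le_antisymm (Ideal.span_le.mpr ?_) (Ideal.span_le.mpr ?_)
    · rintro _ ⟨j, rfl⟩
      dsimp only
      split_ifs with h
      · exact Ideal.subset_span ⟨_, rfl⟩
      · exact Ideal.zero_mem _
    · rintro _ ⟨j, rfl⟩
      exact Ideal.subset_span ⟨Fin.castLE hLm j, by simp⟩
  choose L hL using key
  exact ⟨L, fun K _ _ N n d f hf => hL n d K N f hf⟩
end

section
/- Let K be a field (not necessarily algebraically closed), let R be a polynomial ring over K, and let M be an h × c matrix over R with h ≤ c such that for each 1 ≤ i ≤ h all entries of the i-th row are forms of one common degree d_i ≥ 0, and the integers d_1,…,d_h are pairwise distinct. Suppose that for each i the ideal of R generated by the entries of the i-th row has height at least b (the unit ideal, which arises when a row of degree 0 is nonzero, is regarded as having infinite height). Then the ideal of R generated by all h × h minors of M has height at least b − h + 1. -/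
open MvPolynomial

universe u

/-- The height of an ideal: the infimum of the heights of the prime ideals containing it
(so the unit ideal has height `⊤`). -/
noncomputable def idealHeight {R : Type*} [CommRing R] (I : Ideal R) : ℕ∞ :=
  ⨅ (P : PrimeSpectrum R) (_ : I ≤ P.asIdeal), Order.height P

theorem MvPolynomial.height_eq_of_isMaximal {K : Type*} [Field K] (n : ℕ)
    (m : Ideal (MvPolynomial (Fin n) K)) [m.IsMaximal] : m.height = n := by
  induction n with
  | zero =>
    have := Ideal.height_le_ringKrullDim_of_ne_top (I := m) Ideal.IsPrime.ne_top'
    simpa using this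
  | succ n ih =>
    let e := (finSuccEquiv K n).toRingEquiv
    have hM : (m.map e).IsMaximal := Ideal.map_isMaximal_of_equiv e
    have hp : ((m.map e).under (MvPolynomial (Fin n) K)).IsMaximal :=
      Polynomial.isMaximal_comap_C_of_isJacobsonRing _
    have : (m.map e).LiesOver ((m.map e).under (MvPolynomial (Fin n) K)) := ⟨rfl⟩
    rw [← e.height_map m, Polynomial.height_eq_height_add_one
      ((m.map e).under (MvPolynomial (Fin n) K)), ih]
    simp

theorem Ideal.height_le_natCast_of_isIntegral {K B : Type*} [Field K] [CommRing B] {n : ℕ}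
    (g : MvPolynomial (Fin n) K →+* B) (hg : g.IsIntegral) (I : Ideal B) (hI : I ≠ ⊤) :
    I.height ≤ n := by
  algebraize [g]
  have h : ringKrullDim B ≤ ringKrullDim (MvPolynomial (Fin n) K) :=
    Order.krullDim_le_of_strictMono (PrimeSpectrum.comap (algebraMap _ B))
      fun p q hpq ↦ Ideal.IsIntegral.comap_lt_comap (R := MvPolynomial (Fin n) K) hpq
  have := (Ideal.height_le_ringKrullDim_of_ne_top hI).trans h
  rw [MvPolynomial.ringKrullDim_of_isNoetherianRing, ringKrullDim_eq_zero_of_field, zero_add,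
    Nat.card_fin] at this
  exact_mod_cast this

theorem MvPolynomial.card_le_of_injective_of_isIntegral {K B : Type*} [Field K] [CommRing B]
    [IsDomain B] [Algebra K B] {d r : ℕ} (f : MvPolynomial (Fin d) K →ₐ[K] B)
    (hf : Function.Injective f) (g : MvPolynomial (Fin r) K →ₐ[K] B)
    (hg : Function.Injective g) (hgi : g.toRingHom.IsIntegral) : d ≤ r := by
  have h1 := lift_trdeg_le_of_injective f hf
  algebraize [g.toRingHom]
  have : FaithfulSMul (MvPolynomial (Fin r) K) B :=
    (faithfulSMul_iff_algebraMap_injective _ _).mpr hg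
  have h2 := lift_trdeg_add_eq K (MvPolynomial (Fin r) K) B
  have h3 : Algebra.trdeg (MvPolynomial (Fin r) K) B = 0 := trdeg_eq_zero
  rw [h3] at h2
  rw [← h2] at h1
  simpa using h1

theorem MvPolynomial.card_le_height_of_injective {K B : Type*} [Field K] [CommRing B]
    [IsDomain B] [Algebra K B] [Algebra.FiniteType K B] {d : ℕ}
    (f : MvPolynomial (Fin d) K →ₐ[K] B) (hf : Function.Injective f)
    (m : Ideal B) [m.IsMaximal] : (d : ℕ∞) ≤ m.height := by
  have : IsNoetherianRing B := Algebra.FiniteType.isNoetherianRing K B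
  obtain ⟨r, g, hg, hgi⟩ := exists_integral_inj_algHom_of_fg K B
  have hdr := card_le_of_injective_of_isIntegral f hf g hg hgi
  algebraize [g.toRingHom]
  have : FaithfulSMul (MvPolynomial (Fin r) K) B :=
    (faithfulSMul_iff_algebraMap_injective _ _).mpr hg
  have : (m.under (MvPolynomial (Fin r) K)).IsMaximal :=
    Ideal.isMaximal_comap_of_isIntegral_of_isMaximal m
  rw [Ideal.height_eq_height_add_of_liesOver_of_hasGoingDown
    (m.under (MvPolynomial (Fin r) K)) m, height_eq_of_isMaximal]
  exact le_add_right (by exact_mod_cast hdr)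

theorem Ideal.height_add_le_height_comap_of_surjective {R S : Type*} [CommRing R] [CommRing S]
    (φ : R →+* S) (hφ : Function.Surjective φ) (b : ℕ∞)
    (hb : ∀ p : Ideal S, p.IsPrime → b ≤ (p.comap φ).height) (p : Ideal S) [hp : p.IsPrime] :
    p.height + b ≤ (p.comap φ).height := by
  have key (n : ℕ) : ∀ p : Ideal S, p.IsPrime → (n : ℕ∞) ≤ p.height →
      (n : ℕ∞) + b ≤ (p.comap φ).height := by
    induction n with
    | zero => simpa using fun p hp ↦ hb p hp
    | succ n ih =>
      intro p hp hn
      obtain ⟨q, hq, hqp, hnq⟩ : ∃ q : Ideal S, q.IsPrime ∧ q < p ∧ (n : ℕ∞) ≤ q.height := by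
        by_contra! h
        have := hn.trans (Ideal.height_le_iff.mpr h)
        norm_cast at this
        omega
      have hlt : q.comap φ < p.comap φ :=
        (Ideal.orderEmbeddingOfSurjective φ hφ).lt_iff_lt.mpr hqp
      calc ((n + 1 : ℕ) : ℕ∞) + b = n + b + 1 := by push_cast; ring
        _ ≤ (q.comap φ).height + 1 := by gcongr; exact ih q hq hnq
        _ ≤ _ := Ideal.height_add_one_le_of_lt_of_isPrime hlt
  by_cases h : p.height = ⊤
  · have : (p.comap φ).height = ⊤ := ENat.eq_top_iff_forall_ge.mpr fun n ↦
      le_self_add.trans (key n p hp (h ▸ le_top))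
    simp [this]
  · obtain ⟨n, hn⟩ := ENat.ne_top_iff_exists.mp h
    rw [← hn]
    exact key n p hp hn.le

/-- A prime `Q` of a polynomial ring in `n` variables satisfies `n ≤ height Q + d` for some `d`
such that the quotient by `Q` contains `d` algebraically independent elements. -/
theorem MvPolynomial.exists_injective_quotient_le_height_add {K : Type*} [Field K] (n : ℕ)
    (Q : Ideal (MvPolynomial (Fin n) K)) [Q.IsPrime] :
    ∃ (d : ℕ) (f : MvPolynomial (Fin d) K →ₐ[K] MvPolynomial (Fin n) K ⧸ Q),
      Function.Injective f ∧ (n : ℕ∞) ≤ Q.height + d := by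
  induction n using Nat.strong_induction_on with
  | _ n ih =>
  by_cases hQ : Q = ⊥
  · subst hQ
    refine ⟨n, Ideal.Quotient.mkₐ K _, ?_, le_add_self⟩
    exact (RingHom.injective_iff_ker_eq_bot _).mpr Ideal.mk_ker
  obtain ⟨p, hpQ, hp⟩ := Ideal.IsPrime.exists_mem_prime_of_ne_bot ‹_› hQ
  have hspan : (Ideal.span {p}).IsPrime := (Ideal.span_singleton_prime hp.ne_zero).mpr hp
  have hle : Ideal.span {p} ≤ Q := (Ideal.span_singleton_le_iff_mem _).mpr hpQ
  obtain ⟨s, g, hg, hgi⟩ :=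
    exists_integral_inj_algHom_of_fg K (MvPolynomial (Fin n) K ⧸ Ideal.span {p})
  have hns : n ≤ s + 1 := by
    obtain ⟨m, hm, hQm⟩ := Q.exists_le_maximal Ideal.IsPrime.ne_top'
    have h1 := Ideal.height_le_height_add_one_of_mem (hQm hpQ)
    have h2 : (m.map (Ideal.Quotient.mk (Ideal.span {p}))).IsPrime :=
      Ideal.isPrime_map_quotientMk_of_isPrime (hle.trans hQm)
    have h3 := Ideal.height_le_natCast_of_isIntegral g.toRingHom hgi _ h2.ne_top
    rw [height_eq_of_isMaximal] at h1
    have := h1.trans (add_le_add_left h3 1)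
    exact_mod_cast this
  have hheight (P : Ideal (MvPolynomial (Fin n) K ⧸ Ideal.span {p})) [P.IsPrime] :
      P.height + 1 ≤ (P.comap (Ideal.Quotient.mk (Ideal.span {p}))).height := by
    refine Ideal.height_add_le_height_comap_of_surjective _ Ideal.Quotient.mk_surjective 1
      (fun P' hP' ↦ ?_) P
    rw [Order.one_le_iff_pos, pos_iff_ne_zero, Ne, Ideal.height_eq_zero_iff_eq_bot]
    intro h
    have : p ∈ P'.comap (Ideal.Quotient.mk (Ideal.span {p})) := by
      simp [Ideal.Quotient.eq_zero_iff_mem.mpr (Ideal.mem_span_singleton_self p)]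
    rw [h] at this
    exact hp.ne_zero this
  have hsn : s < n := by
    obtain ⟨m, hm⟩ := Ideal.exists_maximal (MvPolynomial (Fin n) K ⧸ Ideal.span {p})
    have h1 := card_le_height_of_injective g hg m
    have h2 := hheight m
    have h3 : (m.comap (Ideal.Quotient.mk (Ideal.span {p}))).IsMaximal :=
      Ideal.comap_isMaximal_of_surjective _ Ideal.Quotient.mk_surjective
    rw [height_eq_of_isMaximal] at h2
    have := (add_le_add_left h1 1).trans h2
    exact_mod_cast this
  let φ : (MvPolynomial (Fin n) K ⧸ Ideal.span {p}) →ₐ[K] MvPolynomial (Fin n) K ⧸ Q :=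
    Ideal.Quotient.factorₐ K hle
  have hφ : (RingHom.ker φ).comap (Ideal.Quotient.mk (Ideal.span {p})) = Q := by
    ext x
    exact Ideal.Quotient.eq_zero_iff_mem
  have : (RingHom.ker φ).IsPrime := RingHom.ker_isPrime _
  have : (RingHom.ker (φ.comp g)).IsPrime := RingHom.ker_isPrime _
  obtain ⟨d, f, hf, hd⟩ := ih s hsn (RingHom.ker (φ.comp g))
  refine ⟨d, (Ideal.kerLiftAlg (φ.comp g)).comp f,
    (Ideal.kerLiftAlg_injective (φ.comp g)).comp hf, ?_⟩
  have hgd : (RingHom.ker (φ.comp g)).height ≤ (RingHom.ker φ).height := by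
    algebraize [g.toRingHom]
    have : FaithfulSMul (MvPolynomial (Fin s) K) (MvPolynomial (Fin n) K ⧸ Ideal.span {p}) :=
      (faithfulSMul_iff_algebraMap_injective _ _).mpr hg
    have : (RingHom.ker φ).LiesOver (RingHom.ker (φ.comp g)) := ⟨rfl⟩
    rw [Ideal.height_eq_height_add_of_liesOver_of_hasGoingDown (RingHom.ker (φ.comp g))
      (RingHom.ker φ)]
    exact le_self_add
  calc (n : ℕ∞) ≤ s + 1 := by exact_mod_cast hns
    _ ≤ ((RingHom.ker (φ.comp g)).height + d) + 1 := by gcongr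
    _ ≤ ((RingHom.ker φ).height + d) + 1 := by gcongr
    _ = ((RingHom.ker φ).height + 1) + d := by ring
    _ ≤ Q.height + d := by
      gcongr
      simpa only [hφ] using hheight (RingHom.ker φ)

theorem idealHeight_le_height {R : Type*} [CommRing R] {I P : Ideal R} [hP : P.IsPrime]
    (h : I ≤ P) : idealHeight I ≤ P.height := by
  rw [show P.height = Order.height (⟨P, hP⟩ : PrimeSpectrum R) from
    PrimeSpectrum.height_eq_orderHeight ⟨P, hP⟩]
  exact iInf₂_le (⟨P, hP⟩ : PrimeSpectrum R) h

theorem Matrix.exists_submatrix_det_ne_zero {F : Type*} [Field F] {h c : ℕ}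
    (A : Matrix (Fin h) (Fin c) F) (hA : LinearIndependent F A.row) :
    ∃ g : Fin h ↪ Fin c, (A.submatrix id g).det ≠ 0 := by
  obtain ⟨κ, a, ha, hspan, hli⟩ := exists_linearIndependent' F A.col
  have : Finite κ := Finite.of_injective a ha
  have := Fintype.ofFinite κ
  have hcard : Fintype.card κ = Fintype.card (Fin h) := by
    rw [← finrank_span_eq_card hli, hspan, ← A.rank_eq_finrank_span_cols, hA.rank_matrix]
  let e : Fin h ≃ κ := (Fintype.equivOfCardEq hcard).symm
  refine ⟨e.toEmbedding.trans ⟨a, ha⟩, ?_⟩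
  have hcol : LinearIndependent F (A.submatrix id (e.toEmbedding.trans ⟨a, ha⟩)).col :=
    hli.comp e e.injective
  rw [Matrix.linearIndependent_cols_iff_isUnit, Matrix.isUnit_iff_isUnit_det] at hcol
  exact hcol.ne_zero

theorem MvPolynomial.aeval_mul_of_isHomogeneous {K A σ : Type*} [CommSemiring K] [CommSemiring A]
    [Algebra K A] {p : MvPolynomial σ K} {n : ℕ} (hp : p.IsHomogeneous n) (x : σ → A) (t : A) :
    aeval (fun i ↦ x i * t) p = aeval x p * t ^ n := by
  simp only [aeval_def, eval₂_eq, Finset.sum_mul, mul_pow, Finset.prod_mul_distrib,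
    Finset.prod_pow_eq_pow_sum]
  refine Finset.sum_congr rfl fun u hu ↦ ?_
  rw [← hp.degree_eq_sum_deg_support hu, mul_assoc]

/-- If the rows of `M` become linearly dependent at the point `x`, then the prime of relations
of `x` has height at least `b + 1 - h`. A dependency exhibits a row of largest degree as a
combination of rows of smaller degree; homogenizing its coefficients with a new variable gives
elements `y` of a domain, generating a proper ideal, modulo which that row vanishes. -/
theorem le_height_ker_aeval_add {K F : Type*} [Field K] [Field F] [Algebra K F] {N h c b : ℕ}
    (x : Fin N → F) (M : Matrix (Fin h) (Fin c) (MvPolynomial (Fin N) K)) (dvec : Fin h → ℕ)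
    (hrow : ∀ i j, (M i j).IsHomogeneous (dvec i)) (hdist : Function.Injective dvec)
    (hht : ∀ i, (b : ℕ∞) ≤ idealHeight (Ideal.span (Set.range (M i))))
    (hdep : ¬ LinearIndependent F (M.map (aeval x)).row) :
    (b : ℕ∞) + 1 ≤ (RingHom.ker (aeval (R := K) x)).height + h := by
  classical
  obtain ⟨a, hsum, i₁, hi₁⟩ := Fintype.not_linearIndependent_iff.mp hdep
  obtain ⟨i₀, hi₀, hmax⟩ := Finset.exists_max_image (Finset.univ.filter (a · ≠ 0)) dvec
    ⟨i₁, by simpa using hi₁⟩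
  replace hi₀ : a i₀ ≠ 0 := by simpa using hi₀
  let s : Finset (Fin h) := (Finset.univ.filter (a · ≠ 0)).erase i₀
  have hs (j : s) : dvec j < dvec i₀ := by
    obtain ⟨hj, hj'⟩ := Finset.mem_erase.mp j.2
    exact lt_of_le_of_ne (hmax j hj') (hdist.ne hj)
  have hscard : s.card + 1 ≤ h := by
    have : s.card < Fintype.card (Fin h) :=
      Finset.card_lt_univ_of_notMem (Finset.notMem_erase i₀ _)
    simpa using this
  let φ (j : s) : Polynomial F :=
    Polynomial.C (-(a j / a i₀)) * Polynomial.X ^ (dvec i₀ - dvec j)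
  have hrel (k : Fin c) : aeval x (M i₀ k) = ∑ j : s, -(a j / a i₀) * aeval x (M j k) := by
    have h1 : ∑ i, a i * aeval x (M i k) = 0 := by
      simpa [Matrix.row] using congrFun hsum k
    have h2 : ∑ i ∈ insert i₀ s, a i * aeval x (M i k) = 0 := by
      rw [← h1]
      refine Finset.sum_subset (Finset.subset_univ _) fun i _ hi ↦ ?_
      have : a i = 0 := by
        by_contra hai
        refine hi ?_
        by_cases hii : i = i₀ <;> simp [s, hii, hai]
      simp [this]
    rw [Finset.sum_insert (Finset.notMem_erase i₀ _), ← Finset.sum_coe_sort] at h2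
    rw [eq_neg_of_add_eq_zero_left h2 |> (eq_div_of_mul_eq hi₀ <| (mul_comm _ _).trans ·),
      neg_div, Finset.sum_div, ← Finset.sum_neg_distrib]
    refine Finset.sum_congr rfl fun j _ ↦ by ring
  let Φ : MvPolynomial (Fin N ⊕ s) K →ₐ[K] Polynomial F :=
    aeval (Sum.elim (fun i ↦ Polynomial.C (x i) * Polynomial.X) φ)
  let B := MvPolynomial (Fin N ⊕ s) K ⧸ RingHom.ker Φ
  have hprime : (RingHom.ker Φ).IsPrime := RingHom.ker_isPrime _
  let Ψ : B →ₐ[K] Polynomial F := Ideal.kerLiftAlg Φ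
  have hΨ : Function.Injective Ψ := Ideal.kerLiftAlg_injective Φ
  let y (j : s) : B := Ideal.Quotient.mk _ (X (Sum.inr j))
  have hy (j : s) : Ψ (y j) = φ j := by
    change Φ (X (Sum.inr j)) = _
    simp [Φ]
  let θ : MvPolynomial (Fin N) K →ₐ[K] B := (Ideal.Quotient.mkₐ K _).comp (rename Sum.inl)
  have hθ (p) : Ψ (θ p) = aeval (fun i ↦ Polynomial.C (x i) * Polynomial.X) p := by
    change Φ (rename Sum.inl p) = _
    simp [Φ, aeval_rename, Function.comp_def]
  have hθM (i k) : Ψ (θ (M i k)) = Polynomial.C (aeval x (M i k)) * Polynomial.X ^ dvec i := by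
    rw [hθ, aeval_mul_of_isHomogeneous (hrow i k)]
    congr 1
    exact aeval_algebraMap_apply (B := Polynomial F) x (M i k)
  have hrowθ (k : Fin c) : θ (M i₀ k) ∈ Ideal.span (Set.range y) := by
    have : θ (M i₀ k) = ∑ j : s, θ (M j k) * y j := by
      apply hΨ
      rw [map_sum, hθM, hrel, map_sum, Finset.sum_mul]
      refine Finset.sum_congr rfl fun j _ ↦ ?_
      rw [map_mul Ψ, hθM, hy, Polynomial.C_mul]
      nth_rw 1 [← Nat.sub_add_cancel (hs j).le]
      rw [pow_add]
      ring
    rw [this]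
    exact Ideal.sum_mem _ fun j _ ↦
      Ideal.mul_mem_left _ _ (Ideal.subset_span (Set.mem_range_self j))
  have hker : RingHom.ker θ ≤ RingHom.ker (aeval (R := K) x) := by
    intro p hp
    have h1 : aeval (fun i ↦ Polynomial.C (x i) * Polynomial.X) p = 0 := by
      rw [← hθ, RingHom.mem_ker.mp hp, map_zero]
    have h2 : aeval x = ((Polynomial.aeval (R := F) (1 : F)).restrictScalars K).comp
        (aeval fun i ↦ Polynomial.C (x i) * Polynomial.X) :=
      algHom_ext fun i ↦ by simp
    rw [RingHom.mem_ker, h2, AlgHom.comp_apply, h1, map_zero]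
  have hproper : Ideal.span (Set.range y) ≠ ⊤ := by
    have : Ideal.span (Set.range y) ≤ RingHom.ker ((Polynomial.evalRingHom 0).comp Ψ.toRingHom) := by
      rw [Ideal.span_le, Set.range_subset_iff]
      intro j
      change Polynomial.eval 0 (Ψ (y j)) = 0
      rw [hy]
      simp [φ, (Nat.sub_pos_of_lt (hs j)).ne']
    exact ne_top_of_le_ne_top (RingHom.ker_ne_top _) this
  obtain ⟨m, hm, hym⟩ := Ideal.exists_le_maximal _ hproper
  have hyset : Set.range y ⊆ m := Ideal.span_le.mp hym
  let π : MvPolynomial (Fin N) K →ₐ[K] B ⧸ Ideal.span (Set.range y) :=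
    (Ideal.Quotient.mkₐ K _).comp θ
  have hπ : Function.Surjective π := by
    have hcomp : π.comp (aeval (Sum.elim X 0)) =
        (Ideal.Quotient.mkₐ K (Ideal.span (Set.range y))).comp
          (Ideal.Quotient.mkₐ K (RingHom.ker Φ)) := by
      refine algHom_ext fun i ↦ ?_
      rcases i with i | j
      · simp [π, θ]
        rfl
      · have : (Ideal.Quotient.mk (Ideal.span (Set.range y))) (y j) = 0 :=
          Ideal.Quotient.eq_zero_iff_mem.mpr (Ideal.subset_span (Set.mem_range_self j))
        rw [AlgHom.comp_apply, aeval_X, Sum.elim_inr, Pi.zero_apply, map_zero]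
        exact this.symm
    intro z
    obtain ⟨z, rfl⟩ := Ideal.Quotient.mk_surjective z
    obtain ⟨z, rfl⟩ := Ideal.Quotient.mk_surjective z
    exact ⟨_, DFunLike.congr_fun hcomp z⟩
  have hmp : (m.map (Ideal.Quotient.mk (Ideal.span (Set.range y)))).IsPrime :=
    Ideal.isPrime_map_quotientMk_of_isPrime hym
  have h1 := Ideal.height_le_height_add_encard_of_subset _ hyset
  have h2 := Ideal.height_add_le_height_comap_of_surjective π.toRingHom hπ b
    (fun p hp ↦ (hht i₀).trans (idealHeight_le_height (by
      rw [Ideal.span_le, Set.range_subset_iff]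
      intro k
      change π (M i₀ k) ∈ p
      have : π (M i₀ k) = 0 := Ideal.Quotient.eq_zero_iff_mem.mpr (hrowθ k)
      simp [this]))) (m.map (Ideal.Quotient.mk (Ideal.span (Set.range y))))
  have h3 : (m.map (Ideal.Quotient.mk (Ideal.span (Set.range y)))).height + b ≤ N := by
    have := WithBot.coe_le_coe.mpr h2 |>.trans
      (Ideal.height_le_ringKrullDim_of_ne_top (Ideal.IsPrime.ne_top inferInstance))
    rw [MvPolynomial.ringKrullDim_of_isNoetherianRing, ringKrullDim_eq_zero_of_field, zero_add,
      Nat.card_fin] at this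
    exact_mod_cast this
  have hθp : (RingHom.ker θ).IsPrime := RingHom.ker_isPrime _
  obtain ⟨d, f, hf, hd⟩ := exists_injective_quotient_le_height_add N (RingHom.ker θ)
  have h4 := card_le_height_of_injective ((Ideal.kerLiftAlg θ).comp f)
    ((Ideal.kerLiftAlg_injective θ).comp hf) m
  have h5 : (Set.range y).encard ≤ s.card := by
    rw [← Set.image_univ]
    exact (Set.encard_image_le y _).trans (by simp)
  have h6 := Ideal.height_mono hker
  have h7 : (N : ℕ∞) + b ≤ N + ((RingHom.ker (aeval (R := K) x)).height + s.card) :=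
    calc (N : ℕ∞) + b
        ≤ (RingHom.ker (aeval (R := K) x)).height
          + ((m.map (Ideal.Quotient.mk (Ideal.span (Set.range y)))).height + s.card) + b := by
          gcongr
          exact hd.trans (add_le_add h6 (h4.trans (h1.trans (by gcongr))))
      _ = ((m.map (Ideal.Quotient.mk (Ideal.span (Set.range y)))).height + b)
          + ((RingHom.ker (aeval (R := K) x)).height + s.card) := by ring
      _ ≤ _ := by gcongr
  calc (b : ℕ∞) + 1 ≤ (RingHom.ker (aeval (R := K) x)).height + s.card + 1 := by
        gcongr
        exact (ENat.add_le_add_iff_left (ENat.natCast_ne_top N)).mp h7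
    _ = (RingHom.ker (aeval (R := K) x)).height + (s.card + 1 : ℕ) := by push_cast; ring
    _ ≤ _ := by gcongr

/-- Let `M` be an `h × c` matrix (`h ≤ c`) over a polynomial ring
`R = K[x_1, …, x_N]` over a field such that the entries of the `i`-th row are all homogeneous
of one degree `d i`, the degrees `d i` being pairwise distinct, and such that the ideal
generated by the entries of each row has height at least `b`.  Then the ideal generated by
the `h × h` minors of `M` has height at least `b − h + 1`. -/
theorem statement16 (K : Type u) [Field K] (N h c b : ℕ) (hhc : h ≤ c)
    (M : Matrix (Fin h) (Fin c) (MvPolynomial (Fin N) K))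
    (dvec : Fin h → ℕ)
    (hrow : ∀ i j, (M i j).IsHomogeneous (dvec i))
    (hdist : Function.Injective dvec)
    (hht : ∀ i, (b : ℕ∞) ≤ idealHeight (Ideal.span (Set.range (M i)))) :
    (b : ℕ∞) + 1 - (h : ℕ∞) ≤
      idealHeight (Ideal.span
        {p : MvPolynomial (Fin N) K | ∃ g : Fin h ↪ Fin c, p = (M.submatrix id g).det}) := by
  refine le_iInf₂ fun P hP ↦ ?_
  rw [← PrimeSpectrum.height_eq_orderHeight P, tsub_le_iff_right]
  let F := FractionRing (MvPolynomial (Fin N) K ⧸ P.asIdeal)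
  let ρ : MvPolynomial (Fin N) K →ₐ[K] F :=
    (IsScalarTower.toAlgHom K (MvPolynomial (Fin N) K ⧸ P.asIdeal) F).comp
      (Ideal.Quotient.mkₐ K P.asIdeal)
  have hρ : RingHom.ker ρ = P.asIdeal := by
    ext p
    change algebraMap _ F (Ideal.Quotient.mk P.asIdeal p) = 0 ↔ _
    rw [FaithfulSMul.algebraMap_eq_zero_iff, Ideal.Quotient.eq_zero_iff_mem]
  have hx : aeval (fun i ↦ ρ (X i)) = ρ := (aeval_unique ρ).symm
  have := le_height_ker_aeval_add (fun i ↦ ρ (X i)) M dvec hrow hdist hht (by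
    rw [hx]
    intro hli
    obtain ⟨g, hg⟩ := Matrix.exists_submatrix_det_ne_zero _ hli
    refine hg ?_
    have h1 : (M.submatrix id g).det ∈ RingHom.ker ρ :=
      by rw [hρ]; exact hP (Ideal.subset_span ⟨g, rfl⟩)
    rw [RingHom.mem_ker, AlgHom.map_det] at h1
    exact h1)
  rwa [hx, hρ] at this
end
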